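/- arXiv:2404.01057 — 4 statements merged into one kernel-verified Lean document; each statement's English description precedes it below -/
import Mathlib

section
/- For every prime p and every fixed integer ℓ ≥ 2, there exists a constant c = c(p,ℓ) such that for all positive integers t and k, the number of subsets of F_p^t \ {0} of size at most k that contain no ℓ pairwise orthogonal vectors is at most 2^{c·t²} · p^{tk/2}. -/
def KFree {V : Type*} (adj : V → V → Prop) (j : ℕ) (S : Finset V) : Prop :=
  ¬ ∃ T ⊆ S, T.card = j ∧ ∀ u ∈ T, ∀ v ∈ T, u ≠ v → adj u v

open Classical in
noncomputable def nbr {V : Type*} (adj : V → V → Prop) (W : Finset V) (h : V) : Finset V :=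
  W.filter (fun x => x ≠ h ∧ adj h x)

lemma mem_nbr {V : Type*} {adj : V → V → Prop} {W : Finset V} {h x : V} :
    x ∈ nbr adj W h ↔ x ∈ W ∧ x ≠ h ∧ adj h x := by
  simp [nbr]

def Sat {V : Type*} (adj : V → V → Prop) (G : Finset V) (a m : ℝ) : Prop :=
  ∀ U ⊆ G, m ≤ (U.card : ℝ) → ∃ H ⊆ U, (U.card : ℝ) ≤ a * H.card ∧
    ∀ h ∈ H, (U.card : ℝ) ≤ a * (nbr adj U h).card

open Classical in
lemma step_lemma {V : Type*} [Fintype V] (adj : V → V → Prop)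
    (hs : ∀ u v, adj u v → adj v u) (G : Finset V) (a m : ℝ) (ha : 1 ≤ a) (hm0 : 0 ≤ m)
    (hm : Sat adj G a m) (j : ℕ) : ∀ W ⊆ G, m * a ^ j ≤ (W.card : ℝ) →
      ∃ D : Finset (Finset V), D.card ≤ (Fintype.card V + 1) ^ j ∧
        (∀ E ∈ D, E ⊆ W ∧ (W.card : ℝ) ≤ a ^ j * E.card) ∧
        ∀ S, KFree adj j (S ∩ W) → ∃ E ∈ D, Disjoint S E := by
  induction j with
  | zero =>
    intro W _ _
    refine ⟨∅, by simp, by simp, ?_⟩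
    intro S hS
    exact absurd ⟨∅, by simp, by simp, by simp⟩ hS
  | succ j ih =>
    intro W hWG hW
    have haj : 1 ≤ a ^ j := one_le_pow₀ ha
    have haj' : 1 ≤ a ^ (j+1) := one_le_pow₀ ha
    obtain ⟨H, hHW, hHc, hH⟩ := hm W hWG (by nlinarith)
    have key : ∀ h : V, h ∈ H → ∃ D : Finset (Finset V), D.card ≤ (Fintype.card V + 1) ^ j ∧
        (∀ E ∈ D, E ⊆ nbr adj W h ∧ ((nbr adj W h).card : ℝ) ≤ a ^ j * E.card) ∧
        ∀ S, KFree adj j (S ∩ nbr adj W h) → ∃ E ∈ D, Disjoint S E := by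
      intro h hh
      apply ih _ ((Finset.filter_subset _ _).trans hWG)
      have h1 := hH h hh
      have h2 : a * (m * a ^ j) ≤ a * (nbr adj W h).card := by
        calc _ = m * a ^ (j+1) := by ring
          _ ≤ _ := hW.trans h1
      exact le_of_mul_le_mul_left h2 (by linarith)
    choose! F hF1 hF2 hF3 using key
    refine ⟨insert H (H.biUnion F), ?_, ?_, ?_⟩
    · calc _ ≤ (H.biUnion F).card + 1 := Finset.card_insert_le _ _
        _ ≤ H.card * (Fintype.card V + 1) ^ j + 1 := by
            gcongr
            exact Finset.card_biUnion_le_card_mul _ _ _ hF1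
        _ ≤ Fintype.card V * (Fintype.card V + 1) ^ j + (Fintype.card V + 1) ^ j := by
            gcongr
            · exact Finset.card_le_univ _
            · exact Nat.one_le_pow _ _ (by omega)
        _ = _ := by ring
    · intro E hE
      rcases Finset.mem_insert.1 hE with rfl | hE
      · refine ⟨hHW, hHc.trans ?_⟩
        gcongr
        calc a = a ^ 1 := by ring
          _ ≤ _ := pow_le_pow_right₀ ha (by omega)
      · obtain ⟨h, hh, hE⟩ := Finset.mem_biUnion.1 hE
        obtain ⟨h1, h2⟩ := hF2 h hh E hE
        refine ⟨h1.trans (Finset.filter_subset _ _), (hH h hh).trans ?_⟩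
        calc _ ≤ a * (a ^ j * E.card) := by gcongr
          _ = _ := by ring
    · intro S hS
      by_cases hd : Disjoint S H
      · exact ⟨H, by simp, hd⟩
      · obtain ⟨h, hhS, hhH⟩ := Finset.not_disjoint_iff.1 hd
        obtain ⟨E, hE, hSE⟩ := hF3 h hhH S (by
          rintro ⟨T, hT, hTc, hTa⟩
          have hT' : ∀ x ∈ T, x ∈ S ∧ x ∈ W ∧ x ≠ h ∧ adj h x := by
            intro x hx
            simpa [nbr] using hT hx
          apply hS
          refine ⟨insert h T, ?_, ?_, ?_⟩
          · intro x hx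
            rcases Finset.mem_insert.1 hx with rfl | hx
            · exact Finset.mem_inter.2 ⟨hhS, hHW hhH⟩
            · exact Finset.mem_inter.2 ⟨(hT' x hx).1, (hT' x hx).2.1⟩
          · rw [Finset.card_insert_of_notMem, hTc]
            intro hx
            exact (hT' h hx).2.2.1 rfl
          · intro u hu v hv huv
            rcases Finset.mem_insert.1 hu with hu1 | hu1
            · rcases Finset.mem_insert.1 hv with hv1 | hv1
              · exact absurd (hu1.trans hv1.symm) huv
              · exact hu1 ▸ (hT' v hv1).2.2.2
            · rcases Finset.mem_insert.1 hv with hv1 | hv1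
              · exact hv1 ▸ hs _ _ (hT' u hu1).2.2.2
              · exact hTa u hu1 v hv1 huv)
        exact ⟨E, Finset.mem_insert_of_mem (Finset.mem_biUnion.2 ⟨h, hhH, hE⟩), hSE⟩

lemma KFree.mono {V : Type*} {adj : V → V → Prop} {j : ℕ} {S S' : Finset V}
    (h : KFree adj j S) (hs : S' ⊆ S) : KFree adj j S' := by
  rintro ⟨T, hT, h2⟩
  exact h ⟨T, hT.trans hs, h2⟩

open Classical in
lemma iter_lemma {V : Type*} [Fintype V] (adj : V → V → Prop)
    (hs : ∀ u v, adj u v → adj v u) (G : Finset V) (a m : ℝ) (ha : 1 ≤ a) (hm0 : 0 ≤ m)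
    (hm : Sat adj G a m) (j r : ℕ) :
      ∃ D : Finset (Finset V), D.card ≤ ((Fintype.card V + 1) ^ j) ^ r ∧
        (∀ E ∈ D, E ⊆ G ∧ ((E.card : ℝ) < m * a ^ j ∨
          (E.card : ℝ) * (a ^ j) ^ r ≤ (a ^ j - 1) ^ r * G.card)) ∧
        ∀ S ⊆ G, KFree adj j S → ∃ E ∈ D, S ⊆ E := by
  induction r with
  | zero =>
    exact ⟨{G}, by simp, by simp, fun S hS _ => ⟨G, by simp, hS⟩⟩
  | succ r ih =>
    obtain ⟨D, hD1, hD2, hD3⟩ := ih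
    have haj : 1 ≤ a ^ j := one_le_pow₀ ha
    have key : ∀ E : Finset V, E ∈ D → ∃ D' : Finset (Finset V),
        D'.card ≤ (Fintype.card V + 1) ^ j ∧
        (∀ E' ∈ D', E' ⊆ G ∧ ((E'.card : ℝ) < m * a ^ j ∨
          (E'.card : ℝ) * (a ^ j) ^ (r+1) ≤ (a ^ j - 1) ^ (r+1) * G.card)) ∧
        ∀ S ⊆ E, KFree adj j S → ∃ E' ∈ D', S ⊆ E' := by
      intro E hE
      obtain ⟨hEG, hE2⟩ := hD2 E hE
      by_cases hlt : (E.card : ℝ) < m * a ^ j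
      · refine ⟨{E}, ?_, by simp [hEG, hlt], fun S hS _ => ⟨E, by simp, hS⟩⟩
        simpa using Nat.one_le_pow _ _ (by omega)
      · have hE3 := hE2.resolve_left hlt
        obtain ⟨F, hF1, hF2, hF3⟩ := step_lemma adj hs G a m ha hm0 hm j E hEG (not_lt.1 hlt)
        refine ⟨F.image (fun X => E \ X), Finset.card_image_le.trans hF1, ?_, ?_⟩
        · intro E' hE'
          obtain ⟨X, hX, rfl⟩ := Finset.mem_image.1 hE'
          obtain ⟨h1, h2⟩ := hF2 X hX
          refine ⟨Finset.sdiff_subset.trans hEG, Or.inr ?_⟩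
          have h3 : ((E \ X).card : ℝ) = E.card - X.card := by
            rw [Finset.card_sdiff_of_subset h1, Nat.cast_sub (Finset.card_le_card h1)]
          rw [h3]
          have h4 : ((E.card : ℝ) - X.card) * a ^ j ≤ (a ^ j - 1) * E.card := by nlinarith
          calc ((E.card : ℝ) - X.card) * (a ^ j) ^ (r+1)
              = (((E.card : ℝ) - X.card) * a ^ j) * (a ^ j) ^ r := by ring
            _ ≤ ((a ^ j - 1) * E.card) * (a ^ j) ^ r := by gcongr
            _ = (a ^ j - 1) * (E.card * (a ^ j) ^ r) := by ring
            _ ≤ (a ^ j - 1) * ((a ^ j - 1) ^ r * G.card) := by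
                apply mul_le_mul_of_nonneg_left hE3; linarith
            _ = _ := by ring
        · intro S hS hK
          obtain ⟨X, hX, hSX⟩ := hF3 S (hK.mono Finset.inter_subset_left)
          exact ⟨E \ X, Finset.mem_image_of_mem _ hX, Finset.subset_sdiff.2 ⟨hS, hSX⟩⟩
    choose! F hF1 hF2 hF3 using key
    refine ⟨D.biUnion F, ?_, ?_, ?_⟩
    · calc _ ≤ D.card * (Fintype.card V + 1) ^ j := Finset.card_biUnion_le_card_mul _ _ _ hF1
        _ ≤ ((Fintype.card V + 1) ^ j) ^ r * (Fintype.card V + 1) ^ j := by gcongr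
        _ = _ := by ring
    · intro E' hE'
      obtain ⟨E, hE, hE'⟩ := Finset.mem_biUnion.1 hE'
      exact hF2 E hE E' hE'
    · intro S hS hK
      obtain ⟨E, hE, hSE⟩ := hD3 S hS hK
      obtain ⟨E', hE', h⟩ := hF3 E hE S hSE hK
      exact ⟨E', Finset.mem_biUnion.2 ⟨E, hE, hE'⟩, h⟩

open Classical in
lemma count_lemma {V : Type*} (E : Finset V) (k : ℕ) (K Q : ℝ) (hK : 0 ≤ K) (hQ : 1 ≤ Q)
    (hE : (E.card : ℝ) ≤ K * Q) :
    (((E.powerset.filter (fun S => S.card ≤ k)).card : ℕ) : ℝ) ≤ Real.exp K * Q ^ k := by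
  have h1 : E.powerset.filter (fun S => S.card ≤ k) ⊆
      (Finset.range (k+1)).biUnion (fun i => E.powersetCard i) := by
    intro S hS
    simp only [Finset.mem_filter, Finset.mem_powerset] at hS
    simp only [Finset.mem_biUnion, Finset.mem_range, Finset.mem_powersetCard]
    exact ⟨S.card, by omega, hS.1, rfl⟩
  have h2 : (E.powerset.filter (fun S => S.card ≤ k)).card ≤
      ∑ i ∈ Finset.range (k+1), E.card.choose i := by
    refine (Finset.card_le_card h1).trans (Finset.card_biUnion_le.trans ?_)
    simp
  calc (((E.powerset.filter (fun S => S.card ≤ k)).card : ℕ) : ℝ)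
      ≤ ∑ i ∈ Finset.range (k+1), (E.card.choose i : ℝ) := by exact_mod_cast h2
    _ ≤ ∑ i ∈ Finset.range (k+1), (K ^ i / (i.factorial : ℝ)) * Q ^ k := by
        apply Finset.sum_le_sum
        intro i hi
        have hi' : i ≤ k := by simpa [Nat.lt_succ_iff] using hi
        calc (E.card.choose i : ℝ) ≤ (E.card : ℝ) ^ i / (i.factorial : ℝ) :=
              Nat.choose_le_pow_div i E.card
          _ ≤ (K * Q) ^ i / (i.factorial : ℝ) := by gcongr
          _ = (K ^ i / (i.factorial : ℝ)) * Q ^ i := by rw [mul_pow]; ring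
          _ ≤ _ := by gcongr
    _ = (∑ i ∈ Finset.range (k+1), K ^ i / (i.factorial : ℝ)) * Q ^ k := by
        rw [Finset.sum_mul]
    _ ≤ _ := by
        gcongr
        exact Real.sum_le_exp_of_nonneg hK _

section field
variable {p : ℕ} [Fact p.Prime] {t : ℕ}

def orth (u v : Fin t → ZMod p) : Prop := ∑ i, u i * v i = 0

noncomputable def gg (x : ZMod p) : ℝ := if x = 0 then (p : ℝ) - 1 else -1

lemma gg_sum : ∑ x : ZMod p, gg x = 0 := by
  have : ∀ x : ZMod p, gg x = (if x = 0 then (p : ℝ) else 0) - 1 := by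
    intro x; unfold gg; split_ifs <;> ring
  simp [this, Finset.sum_sub_distrib, ZMod.card]

lemma gg_abs (x : ZMod p) : |gg x| ≤ p := by
  have hp : (1 : ℝ) ≤ p := by exact_mod_cast (Fact.out : p.Prime).one_le
  unfold gg
  split_ifs
  · rw [abs_le]; constructor <;> linarith
  · simpa using hp

lemma exists_dir (u u' : Fin t → ZMod p) (hu : u ≠ 0) (h : ∀ c : ZMod p, u' ≠ c • u) :
    ∃ w : Fin t → ZMod p, u ⬝ᵥ w = 0 ∧ u' ⬝ᵥ w = 1 := by
  obtain ⟨i, hi⟩ := Function.ne_iff.1 hu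
  simp only [Pi.zero_apply] at hi
  have : ∃ j, u i * u' j - u j * u' i ≠ 0 := by
    by_contra! hc
    apply h (u' i / u i)
    ext j
    have := hc j
    simp only [Pi.smul_apply, smul_eq_mul]
    field_simp
    linear_combination this
  obtain ⟨j, hj⟩ := this
  refine ⟨(u i * u' j - u j * u' i)⁻¹ • (u i • Pi.single j 1 - u j • Pi.single i 1), ?_, ?_⟩
  · simp [dotProduct_smul, dotProduct_sub]
    right; ring
  · simp only [dotProduct_smul, dotProduct_sub, dotProduct_single, smul_eq_mul, mul_one]
    exact inv_mul_cancel₀ hj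

lemma pair_zero (u u' : Fin t → ZMod p) (hu : u ≠ 0) (h : ∀ c : ZMod p, u' ≠ c • u) :
    ∑ v : Fin t → ZMod p, gg (u ⬝ᵥ v) * gg (u' ⬝ᵥ v) = 0 := by
  obtain ⟨w, hw, hw'⟩ := exists_dir u u' hu h
  have h1 : ∀ s : ZMod p, ∑ v : Fin t → ZMod p, gg (u ⬝ᵥ v) * gg (u' ⬝ᵥ v) =
      ∑ v : Fin t → ZMod p, gg (u ⬝ᵥ v) * gg (u' ⬝ᵥ v + s) := by
    intro s
    rw [← Equiv.sum_comp (Equiv.addRight (s • w))]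
    simp [dotProduct_add, dotProduct_smul, hw, hw']
  have h2 : ∑ s : ZMod p, ∑ v : Fin t → ZMod p, gg (u ⬝ᵥ v) * gg (u' ⬝ᵥ v) = 0 := by
    rw [Finset.sum_congr rfl (fun s _ => h1 s), Finset.sum_comm]
    apply Finset.sum_eq_zero
    intro v _
    rw [← Finset.mul_sum]
    have := Equiv.sum_comp (Equiv.addLeft (u' ⬝ᵥ v)) (gg (p := p))
    simp only [Equiv.coe_addLeft] at this
    rw [this, gg_sum, mul_zero]
  rw [Finset.sum_const, Finset.card_univ, ZMod.card, nsmul_eq_mul] at h2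
  have hp : (p : ℝ) ≠ 0 := by exact_mod_cast (Fact.out : p.Prime).ne_zero
  exact (mul_eq_zero.1 h2).resolve_left hp

lemma pair_le (u u' : Fin t → ZMod p) :
    ∑ v : Fin t → ZMod p, gg (u ⬝ᵥ v) * gg (u' ⬝ᵥ v) ≤ (p : ℝ) ^ t * p ^ 2 := by
  calc _ ≤ ∑ v : Fin t → ZMod p, (p : ℝ) ^ 2 := by
        apply Finset.sum_le_sum
        intro v _
        calc _ ≤ |gg (u ⬝ᵥ v) * gg (u' ⬝ᵥ v)| := le_abs_self _
          _ = |gg (u ⬝ᵥ v)| * |gg (u' ⬝ᵥ v)| := abs_mul _ _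
          _ ≤ p * p := by gcongr <;> exact gg_abs _
          _ = _ := by ring
    _ = _ := by simp [ZMod.card]

open Classical in
lemma second_moment (U : Finset (Fin t → ZMod p)) (hU : ∀ u ∈ U, u ≠ 0) :
    ∑ v : Fin t → ZMod p, (∑ u ∈ U, gg (u ⬝ᵥ v)) ^ 2 ≤ (p : ℝ) ^ t * p ^ 3 * U.card := by
  have h1 : ∑ v : Fin t → ZMod p, (∑ u ∈ U, gg (u ⬝ᵥ v)) ^ 2 =
      ∑ u ∈ U, ∑ u' ∈ U, ∑ v : Fin t → ZMod p, gg (u ⬝ᵥ v) * gg (u' ⬝ᵥ v) := by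
    simp_rw [sq, Finset.sum_mul_sum]
    rw [Finset.sum_comm]
    apply Finset.sum_congr rfl
    intro u _
    rw [Finset.sum_comm]
  rw [h1]
  calc _ ≤ ∑ u ∈ U, (p : ℝ) ^ t * p ^ 3 := by
        apply Finset.sum_le_sum
        intro u hu
        calc _ ≤ ∑ u' ∈ U, if u' ∈ (Finset.univ.image (fun c : ZMod p => c • u)) then
                  (p : ℝ) ^ t * p ^ 2 else 0 := by
              apply Finset.sum_le_sum
              intro u' _
              split_ifs with hc
              · exact pair_le u u'
              · refine (pair_zero u u' (hU u hu) ?_).le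
                intro c hcc
                exact hc (Finset.mem_image.2 ⟨c, by simp, hcc.symm⟩)
          _ = ((U.filter (fun u' => u' ∈ (Finset.univ.image (fun c : ZMod p => c • u)))).card : ℝ)
                * ((p : ℝ) ^ t * p ^ 2) := by
              rw [← Finset.sum_filter, Finset.sum_const, nsmul_eq_mul]
          _ ≤ p * ((p : ℝ) ^ t * p ^ 2) := by
              gcongr
              calc _ ≤ (Finset.univ.image (fun c : ZMod p => c • u)).card := by
                    apply Finset.card_le_card
                    intro x hx
                    exact (Finset.mem_filter.1 hx).2
                _ ≤ (Finset.univ : Finset (ZMod p)).card := Finset.card_image_le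
                _ = p := by rw [Finset.card_univ, ZMod.card]
          _ = _ := by ring
    _ = _ := by rw [Finset.sum_const, nsmul_eq_mul]; ring

open Classical in
lemma gg_sum_eq (U : Finset (Fin t → ZMod p)) (v : Fin t → ZMod p) :
    ∑ u ∈ U, gg (u ⬝ᵥ v) = p * (U.filter (fun u => u ⬝ᵥ v = 0)).card - U.card := by
  have : ∀ x : ZMod p, gg x = (if x = 0 then (p : ℝ) else 0) - 1 := by
    intro x; unfold gg; split_ifs <;> ring
  simp_rw [this]
  rw [Finset.sum_sub_distrib, ← Finset.sum_filter]
  simp [mul_comm]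

open Classical in
lemma sat_orth : Sat (orth (p := p) (t := t)) (Finset.univ.filter (· ≠ 0)) (2 * p)
    (6 * p ^ 2 * Real.sqrt ((p : ℝ) ^ t)) := by
  intro U hUG hU
  have hp : (2 : ℝ) ≤ p := by exact_mod_cast (Fact.out : p.Prime).two_le
  have hU0 : ∀ u ∈ U, u ≠ 0 := fun u hu => (Finset.mem_filter.1 (hUG hu)).2
  have hpt : (1 : ℝ) ≤ (p : ℝ) ^ t := one_le_pow₀ (by linarith)
  have hs1 : 1 ≤ Real.sqrt ((p : ℝ) ^ t) := Real.one_le_sqrt.2 hpt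
  have hs2 : Real.sqrt ((p : ℝ) ^ t) ^ 2 = (p : ℝ) ^ t := Real.sq_sqrt (by linarith)
  set s := Real.sqrt ((p : ℝ) ^ t)
  have hu4 : 4 * (p : ℝ) ≤ U.card := by
    refine le_trans ?_ hU
    nlinarith [mul_nonneg (sq_nonneg (p : ℝ)) (sub_nonneg.2 hs1)]
  have husq : 32 * (p : ℝ) ^ 3 * p ^ t ≤ (U.card : ℝ) ^ 2 := by
    calc 32 * (p : ℝ) ^ 3 * p ^ t ≤ 36 * (p : ℝ) ^ 4 * p ^ t := by
          have : 0 ≤ (p : ℝ) ^ 3 := by positivity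
          apply mul_le_mul_of_nonneg_right _ (by positivity)
          nlinarith
      _ = (6 * p ^ 2 * s) ^ 2 := by rw [mul_pow, hs2]; ring
      _ ≤ _ := by gcongr
  set B := U.filter (fun h => ¬ (U.card : ℝ) ≤ 2 * p * (nbr orth U h).card) with hB
  have hBbad : ∀ v ∈ B, (U.card : ℝ) ^ 2 / 16 ≤ (∑ u ∈ U, gg (u ⬝ᵥ v)) ^ 2 := by
    intro v hv
    have hv2 := not_le.1 (Finset.mem_filter.1 hv).2
    have hsub : U.filter (fun u => u ⬝ᵥ v = 0) ⊆ insert v (nbr orth U v) := by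
      intro x hx
      obtain ⟨hx1, hx2⟩ := Finset.mem_filter.1 hx
      by_cases hxv : x = v
      · simp [hxv]
      · refine Finset.mem_insert_of_mem (mem_nbr.2 ⟨hx1, hxv, ?_⟩)
        rw [dotProduct_comm] at hx2
        exact hx2
    have hc : ((U.filter (fun u => u ⬝ᵥ v = 0)).card : ℝ) ≤ (nbr orth U v).card + 1 := by
      exact_mod_cast (Finset.card_le_card hsub).trans (Finset.card_insert_le _ _)
    rw [gg_sum_eq]
    have : (p : ℝ) * (U.filter (fun u => u ⬝ᵥ v = 0)).card - U.card ≤ - (U.card / 4) := by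
      have : (p : ℝ) * (U.filter (fun u => u ⬝ᵥ v = 0)).card ≤ p * ((nbr orth U v).card + 1) := by
        gcongr
      linarith
    nlinarith
  have hBc : (B.card : ℝ) * ((U.card : ℝ) ^ 2 / 16) ≤ (p : ℝ) ^ t * p ^ 3 * U.card := by
    calc _ = ∑ v ∈ B, ((U.card : ℝ) ^ 2 / 16) := by rw [Finset.sum_const, nsmul_eq_mul]
      _ ≤ ∑ v ∈ B, (∑ u ∈ U, gg (u ⬝ᵥ v)) ^ 2 := Finset.sum_le_sum hBbad
      _ ≤ ∑ v : Fin t → ZMod p, (∑ u ∈ U, gg (u ⬝ᵥ v)) ^ 2 :=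
          Finset.sum_le_sum_of_subset_of_nonneg (Finset.subset_univ _)
            (fun _ _ _ => sq_nonneg _)
      _ ≤ _ := second_moment U hU0
  have hUpos : (0 : ℝ) < U.card := by linarith
  have hB2 : (B.card : ℝ) ≤ U.card / 2 := by
    have h1 : (B.card : ℝ) * (U.card : ℝ) ^ 2 ≤ (U.card / 2) * (U.card : ℝ) ^ 2 := by
      have : 32 * (p : ℝ) ^ 3 * p ^ t * U.card ≤ (U.card : ℝ) ^ 2 * U.card := by gcongr
      linarith
    exact le_of_mul_le_mul_right h1 (by positivity)
  refine ⟨U.filter (fun h => (U.card : ℝ) ≤ 2 * p * (nbr orth U h).card),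
    Finset.filter_subset _ _, ?_, fun h hh => (Finset.mem_filter.1 hh).2⟩
  have hsum : ((U.filter (fun h => (U.card : ℝ) ≤ 2 * p * (nbr orth U h).card)).card : ℝ)
      + B.card = U.card := by
    rw [hB, ← Nat.cast_add]
    exact congrArg Nat.cast (Finset.card_filter_add_card_filter_not (s := U)
      (fun h => (U.card : ℝ) ≤ 2 * p * (nbr orth U h).card))
  have : (U.card : ℝ) / 2 ≤ (U.filter (fun h => (U.card : ℝ) ≤ 2 * p * (nbr orth U h).card)).card := by
    linarith
  nlinarith

end field

lemma exists_q (A P : ℝ) (hA : 1 ≤ A) : ∃ q : ℕ, P * (A - 1) ^ q < A ^ q := by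
  obtain ⟨q, hq⟩ := exists_nat_gt (P * A)
  have hq' : ∃ q : ℕ, P * ((A - 1) / A) ^ q < 1 := by
    have : Filter.Tendsto (fun q : ℕ => P * ((A - 1) / A) ^ q) Filter.atTop (nhds (P * 0)) := by
      apply Filter.Tendsto.const_mul
      apply tendsto_pow_atTop_nhds_zero_of_lt_one
      · exact div_nonneg (by linarith) (by linarith)
      · rw [div_lt_one (by linarith)]; linarith
    rw [mul_zero] at this
    exact (this.eventually_lt_const one_pos).exists
  obtain ⟨q, hq⟩ := hq'
  refine ⟨q, ?_⟩
  have hA0 : 0 < A ^ q := by positivity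
  rw [div_pow, mul_div_assoc', div_lt_one hA0] at hq
  exact hq


/-- For every prime `p` and fixed integer `ℓ ≥ 2` there is a constant
`c = c(p,ℓ)` such that for all positive integers `t` and `k`, the number of
subsets of `F_p^t \ {0}` of size at most `k` containing no `ℓ` pairwise
orthogonal vectors is at most `2^(c·t²) · p^(tk/2)`. -/
theorem stmt_10 (p : ℕ) (hp : p.Prime) (ℓ : ℕ) (hℓ : 2 ≤ ℓ) :
    ∃ c : ℝ, ∀ t k : ℕ, 1 ≤ t → 1 ≤ k →
      (Nat.card {C : Finset (Fin t → ZMod p) //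
          (∀ v ∈ C, v ≠ 0) ∧ C.card ≤ k ∧
          ¬ ∃ T ⊆ C, T.card = ℓ ∧
              ∀ u ∈ T, ∀ v ∈ T, u ≠ v → ∑ i, u i * v i = 0} : ℝ) ≤
        2 ^ (c * (t : ℝ) ^ 2) * (p : ℝ) ^ ((t * k : ℝ) / 2) := by
  classical
  haveI : Fact p.Prime := ⟨hp⟩
  have hp2 : (2 : ℝ) ≤ p := by exact_mod_cast hp.two_le
  have hA : (1 : ℝ) ≤ (2 * p : ℝ) ^ ℓ := one_le_pow₀ (by linarith)
  obtain ⟨q, hq⟩ := exists_q ((2 * p : ℝ) ^ ℓ) p hA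
  set A := (2 * p : ℝ) ^ ℓ with hAdef
  set K : ℝ := 6 * p ^ 2 * A with hK
  have hK0 : 0 ≤ K := by positivity
  refine ⟨p * ℓ * q + 2 * K, ?_⟩
  intro t k ht hk
  set G : Finset (Fin t → ZMod p) := Finset.univ.filter (· ≠ 0) with hG
  set s := Real.sqrt ((p : ℝ) ^ t) with hs
  have hs1 : 1 ≤ s := Real.one_le_sqrt.2 (one_le_pow₀ (by linarith))
  obtain ⟨D, hD1, hD2, hD3⟩ := iter_lemma (orth (p := p) (t := t))
    (fun u v h => by unfold orth at *; simpa [mul_comm] using h) G (2 * p) (6 * p ^ 2 * s)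
    (by linarith) (by positivity) sat_orth ℓ (q * t)
  have hcardV : Fintype.card (Fin t → ZMod p) = p ^ t := by simp [ZMod.card]
  have hsmall : ∀ E ∈ D, (E.card : ℝ) ≤ K * s := by
    intro E hE
    obtain ⟨hEG, h | h⟩ := hD2 E hE
    · rw [hK]; rw [← hAdef] at h; nlinarith
    · rw [← hAdef] at h
      have hGc : (G.card : ℝ) ≤ (p : ℝ) ^ t := by
        have := Finset.card_le_univ G
        rw [hcardV] at this
        exact_mod_cast this
      have h1 : (A - 1) ^ (q * t) * (p : ℝ) ^ t < A ^ (q * t) := by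
        rw [pow_mul, pow_mul, ← mul_pow, mul_comm]
        have : 0 ≤ (p : ℝ) * (A - 1) ^ q :=
          mul_nonneg (by linarith) (pow_nonneg (by linarith) _)
        exact pow_lt_pow_left₀ hq this (by omega)
      have h2 : (E.card : ℝ) * A ^ (q * t) < 1 * A ^ (q * t) := by
        calc _ ≤ (A - 1) ^ (q * t) * G.card := h
          _ ≤ (A - 1) ^ (q * t) * (p : ℝ) ^ t :=
            mul_le_mul_of_nonneg_left hGc (pow_nonneg (by linarith) _)
          _ < _ := by rw [one_mul]; exact h1
      have h3 : (E.card : ℝ) < 1 := lt_of_mul_lt_mul_right h2 (by positivity)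
      have h4 : E.card = 0 := by
        have : E.card < 1 := by exact_mod_cast h3
        omega
      rw [h4]; push_cast; positivity
  have hcount : (Nat.card {C : Finset (Fin t → ZMod p) //
          (∀ v ∈ C, v ≠ 0) ∧ C.card ≤ k ∧
          ¬ ∃ T ⊆ C, T.card = ℓ ∧
              ∀ u ∈ T, ∀ v ∈ T, u ≠ v → ∑ i, u i * v i = 0}) ≤
      ∑ E ∈ D, (E.powerset.filter (fun S => S.card ≤ k)).card := by
    rw [Nat.card_eq_fintype_card, Fintype.card_subtype]
    refine (Finset.card_le_card ?_).trans
      (Finset.card_biUnion_le (s := D) (t := fun E => E.powerset.filter (fun S => S.card ≤ k)))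
    intro C hC
    obtain ⟨h1, h2, h3⟩ := (Finset.mem_filter.1 hC).2
    obtain ⟨E, hE, hCE⟩ := hD3 C (fun x hx => by simpa [hG] using h1 x hx) h3
    refine Finset.mem_biUnion.2 ⟨E, hE, Finset.mem_filter.2 ⟨Finset.mem_powerset.2 hCE, h2⟩⟩
  have hD1' : (D.card : ℝ) ≤ (2 : ℝ) ^ (p * ℓ * q * t ^ 2) := by
    have : D.card ≤ 2 ^ (p * ℓ * q * t ^ 2) := by
      calc D.card ≤ ((p ^ t + 1) ^ ℓ) ^ (q * t) := by rw [← hcardV]; exact hD1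
        _ ≤ (((2 ^ p) ^ t) ^ ℓ) ^ (q * t) := by
            gcongr
            have h1 : p ^ t < (2 ^ p) ^ t := Nat.pow_lt_pow_left Nat.lt_two_pow_self (by omega)
            exact h1
        _ = _ := by
            rw [← pow_mul, ← pow_mul, ← pow_mul]; congr 1; ring
    exact_mod_cast this
  have hexp : Real.exp K ≤ (2 : ℝ) ^ (2 * K * (t : ℝ) ^ 2) := by
    rw [Real.rpow_def_of_pos (by norm_num)]
    apply Real.exp_le_exp.2
    have hl := Real.log_two_gt_d9
    have ht1 : (1 : ℝ) ≤ (t : ℝ) ^ 2 := one_le_pow₀ (by exact_mod_cast ht)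
    have h1 : (1 : ℝ) ≤ Real.log 2 * 2 := by linarith
    have h2 : (1 : ℝ) ≤ Real.log 2 * 2 * (t : ℝ) ^ 2 := by nlinarith
    nlinarith
  have hsk : s ^ k = (p : ℝ) ^ ((t * k : ℝ) / 2) := by
    rw [hs, Real.sqrt_eq_rpow, ← Real.rpow_natCast, ← Real.rpow_natCast,
      ← Real.rpow_mul (by positivity), ← Real.rpow_mul (by positivity)]
    congr 1; ring
  calc _ ≤ ∑ E ∈ D, (((E.powerset.filter (fun S => S.card ≤ k)).card : ℕ) : ℝ) := by
        exact_mod_cast hcount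
    _ ≤ ∑ E ∈ D, Real.exp K * s ^ k :=
        Finset.sum_le_sum (fun E hE => by
          convert count_lemma E k K s hK0 hs1 (hsmall E hE))
    _ = D.card * (Real.exp K * s ^ k) := by rw [Finset.sum_const, nsmul_eq_mul]
    _ ≤ (2 : ℝ) ^ (p * ℓ * q * t ^ 2) * ((2 : ℝ) ^ (2 * K * (t : ℝ) ^ 2) * s ^ k) := by
        gcongr
    _ = _ := by
        rw [hsk, ← mul_assoc, ← Real.rpow_natCast, ← Real.rpow_add (by norm_num)]
        congr 2
        push_cast; ring
end

section
/- For every prime p, there exists a constant δ = δ(p) > 0 such that for every field F of characteristic p and all integers k ≥ 2 and d ≥ k, there is a set A ⊆ F^d of non-self-orthogonal vectors with |A| ≥ d^{δ·k/log₂ k}, such that for every two (not necessarily disjoint) subsets A_1, A_2 ⊆ A of size k+1 each, there exist v_1 ∈ A_1 and v_2 ∈ A_2 with <v_1, v_2> = 0. -/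
open Matrix
theorem cardQ (p : ℕ) [Fact p.Prime] (t : ℕ) :
    p ^ t ≤ Fintype.card {v : Fin (t+1) → ZMod p // v ⬝ᵥ v ≠ 0} := by
  classical
  have h : Fintype.card (Fin t → ZMod p) = p ^ t := by simp [ZMod.card]
  rw [← h]
  refine Fintype.card_le_of_injective
    (fun u => ⟨Fin.cons (if u ⬝ᵥ u = 0 then 1 else 0) u, ?_⟩) ?_
  · by_cases h : u ⬝ᵥ u = 0
    · rw [if_pos h]
      simp only [dotProduct, Fin.sum_univ_succ, Fin.cons_zero, Fin.cons_succ] at h ⊢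
      simp [h]
    · rw [if_neg h]
      simp only [dotProduct, Fin.sum_univ_succ, Fin.cons_zero, Fin.cons_succ] at h ⊢
      simpa using h
  · intro u v huv
    have := congrArg (fun w => Fin.tail w.1) huv
    simpa using this

/-- low rank or independent -/
theorem rank_dich (p : ℕ) [Fact p.Prime] (m t r : ℕ) (g : Fin m → Fin t → ZMod p) :
    (∃ e : Fin r → Fin m, LinearIndependent (ZMod p) (g ∘ e)) ∨
    (∃ U : Matrix (Fin m) (Fin r) (ZMod p), ∃ W : Matrix (Fin r) (Fin t) (ZMod p),
      g = U * W) := by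
  classical
  obtain ⟨b, hb, hs, hl⟩ := exists_linearIndependent (ZMod p) (Set.range g)
  have hfin : b.Finite := (Set.finite_range g).subset hb
  have : Fintype b := hfin.fintype
  by_cases hr : r ≤ Fintype.card b
  · left
    obtain ⟨φ⟩ : Nonempty (Fin r ↪ b) := Function.Embedding.nonempty_of_card_le (by simpa using hr)
    choose e he using fun i => hb (φ i).2
    refine ⟨e, ?_⟩
    have : g ∘ e = (fun x : b => (x : Fin t → ZMod p)) ∘ φ := by
      funext i; simp [he]
    rw [this]
    exact hl.comp _ φ.injective
  · right
    obtain ⟨φ⟩ : Nonempty (b ↪ Fin r) := Function.Embedding.nonempty_of_card_le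
      (by rw [Fintype.card_fin]; omega)
    let W : Fin r → Fin t → ZMod p := Function.extend φ (fun x => x.1) 0
    have hmem : ∀ i, g i ∈ Submodule.span (ZMod p) (Set.range W) := by
      intro i
      have h1 : g i ∈ Submodule.span (ZMod p) b := hs ▸ Submodule.subset_span ⟨i, rfl⟩
      refine Submodule.span_mono ?_ h1
      intro x hx
      exact ⟨φ ⟨x, hx⟩, φ.injective.extend_apply _ _ _⟩
    simp only [Submodule.mem_span_range_iff_exists_fun] at hmem
    choose U hU using hmem
    refine ⟨Matrix.of U, Matrix.of W, ?_⟩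
    funext i j
    rw [← hU i]
    simp [Matrix.mul_apply]

theorem card_low (p : ℕ) [Fact p.Prime] (m t r : ℕ) :
    Nat.card {g : Fin m → Fin t → ZMod p //
      ¬ ∃ e : Fin r → Fin m, LinearIndependent (ZMod p) (g ∘ e)} ≤ p ^ (r * (m + t)) := by
  classical
  have h : Nat.card (Matrix (Fin m) (Fin r) (ZMod p) × Matrix (Fin r) (Fin t) (ZMod p))
      = p ^ (r * (m+t)) := by
    simp [Matrix, Nat.card_eq_fintype_card, ZMod.card]
    ring
  rw [← h]
  have := fun g : {g : Fin m → Fin t → ZMod p //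
      ¬ ∃ e : Fin r → Fin m, LinearIndependent (ZMod p) (g ∘ e)} =>
      (rank_dich p m t r g.1).resolve_left g.2
  choose U W hUW using this
  have : Finite (Matrix (Fin m) (Fin r) (ZMod p) × Matrix (Fin r) (Fin t) (ZMod p)) := by
    unfold Matrix; infer_instance
  refine Nat.card_le_card_of_injective (fun g => (U g, W g)) ?_
  intro g g' h
  simp only [Prod.mk.injEq] at h
  apply Subtype.ext
  rw [hUW g, hUW g', h.1, h.2]

/-- number of vectors nonorthogonal to r independent vectors -/
theorem card_nonorth (p : ℕ) [Fact p.Prime] (t r : ℕ) (w : Fin r → Fin t → ZMod p)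
    (hw : LinearIndependent (ZMod p) w) :
    Nat.card {v : Fin t → ZMod p // ∀ i, w i ⬝ᵥ v ≠ 0} * p ^ r = p ^ t * (p - 1) ^ r := by
  classical
  let L := Matrix.mulVecLin (Matrix.of w)
  have hsurj : Function.Surjective L := by
    rw [← LinearMap.range_eq_top]
    apply Submodule.eq_top_of_finrank_eq
    have : (Matrix.of w).rank = Fintype.card (Fin r) := LinearIndependent.rank_matrix hw
    simpa [Matrix.rank] using this
  have hk : Nat.card (LinearMap.ker L) * p ^ r = p ^ t := by
    have h1 := L.toAddMonoidHom.ker.card_mul_index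
    have h2 : L.toAddMonoidHom.ker.index = p ^ r := by
      rw [AddSubgroup.index_ker, AddMonoidHom.range_eq_top.2 hsurj]
      simp [Nat.card_eq_fintype_card, ZMod.card]
    rw [h2] at h1
    simpa [Nat.card_eq_fintype_card, ZMod.card] using h1
  obtain ⟨G, hG⟩ := hsurj.hasRightInverse
  have e : {v : Fin t → ZMod p // ∀ i, w i ⬝ᵥ v ≠ 0} ≃ (Fin r → {x : ZMod p // x ≠ 0}) × LinearMap.ker L :=
    { toFun := fun v => (fun i => ⟨w i ⬝ᵥ v.1, v.2 i⟩, ⟨v.1 - G (L v.1), by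
        simp [hG (L v.1)]⟩)
      invFun := fun x => ⟨G (fun i => (x.1 i).1) + x.2.1, fun i => by
        have h1 : L (G (fun i => (x.1 i).1) + x.2.1) i = (x.1 i).1 := by
          rw [map_add, hG, LinearMap.mem_ker.1 x.2.2]; simp
        have h2 : L (G (fun i => (x.1 i).1) + x.2.1) i = w i ⬝ᵥ (G (fun i => (x.1 i).1) + x.2.1) := rfl
        rw [← h2, h1]; exact (x.1 i).2⟩
      left_inv := fun v => by
        apply Subtype.ext
        have : (fun i => w i ⬝ᵥ v.1) = L v.1 := rfl
        simp [this]
      right_inv := fun x => by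
        have h1 : L (G (fun i => (x.1 i).1) + x.2.1) = fun i => (x.1 i).1 := by
          rw [map_add, hG, LinearMap.mem_ker.1 x.2.2]; simp
        refine Prod.ext ?_ ?_
        · funext i
          exact Subtype.ext (congrFun h1 i)
        · apply Subtype.ext
          simp only [h1]
          simp }
  rw [Nat.card_congr e, Nat.card_prod, mul_assoc, hk]
  have : Nat.card {x : ZMod p // x ≠ 0} = p - 1 := by
    rw [Nat.card_eq_fintype_card, Fintype.card_subtype_compl]; simp [ZMod.card]
  rw [Nat.card_pi]; simp only [this]; simp [mul_comm]

theorem card_badV (p : ℕ) [Fact p.Prime] (m t r : ℕ) :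
    (Nat.card {c : (Fin m → Fin t → ZMod p) × (Fin m → Fin t → ZMod p) //
      ∀ i j, c.1 i ⬝ᵥ c.2 j ≠ 0} : ℝ) ≤
    (p:ℝ) ^ (r * (m + t)) * (p:ℝ) ^ (t * m) +
      (p:ℝ) ^ (t * m) * ((p:ℝ) ^ t * (((p:ℝ) - 1) / p) ^ r) ^ m := by
  classical
  have hp := (Fact.out : p.Prime)
  have hp0 : (0:ℝ) < p := by exact_mod_cast hp.pos
  have hp1 : (1:ℝ) ≤ p := by exact_mod_cast hp.one_le
  have hcardV : Nat.card (Fin m → Fin t → ZMod p) = p ^ (t * m) := by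
    simp [Nat.card_eq_fintype_card, ZMod.card, pow_mul]
  set Y : ℝ := ((p:ℝ) ^ t * (((p:ℝ) - 1) / p) ^ r) ^ m with hY
  have hY0 : 0 ≤ Y := by
    have : (0:ℝ) ≤ (p:ℝ) - 1 := by linarith
    positivity
  let P : (Fin m → Fin t → ZMod p) → Prop := fun g =>
    ∃ e : Fin r → Fin m, LinearIndependent (ZMod p) (g ∘ e)
  let e : {c : (Fin m → Fin t → ZMod p) × (Fin m → Fin t → ZMod p) //
      ∀ i j, c.1 i ⬝ᵥ c.2 j ≠ 0} ≃ Σ g : Fin m → Fin t → ZMod p,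
        {h : Fin m → Fin t → ZMod p // ∀ i j, g i ⬝ᵥ h j ≠ 0} :=
    { toFun := fun c => ⟨c.1.1, c.1.2, c.2⟩
      invFun := fun c => ⟨(c.1, c.2.1), c.2.2⟩
      left_inv := fun _ => rfl
      right_inv := fun _ => rfl }
  rw [Nat.card_congr e, Nat.card_sigma]
  push_cast
  have hgood : ∀ g, P g →
      (Nat.card {h : Fin m → Fin t → ZMod p // ∀ i j, g i ⬝ᵥ h j ≠ 0} : ℝ) ≤ Y := by
    rintro g ⟨a, ha⟩
    have h1 := card_nonorth p t r (g ∘ a) ha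
    have h2 : Nat.card {h : Fin m → Fin t → ZMod p // ∀ i j, g i ⬝ᵥ h j ≠ 0} ≤
        (Nat.card {v : Fin t → ZMod p // ∀ i, (g ∘ a) i ⬝ᵥ v ≠ 0}) ^ m := by
      have : Nat.card (Fin m → {v : Fin t → ZMod p // ∀ i, (g ∘ a) i ⬝ᵥ v ≠ 0}) =
        (Nat.card {v : Fin t → ZMod p // ∀ i, (g ∘ a) i ⬝ᵥ v ≠ 0}) ^ m := by
        rw [Nat.card_pi]; simp
      rw [← this]
      refine Nat.card_le_card_of_injective
        (fun h j => ⟨h.1 j, fun i => h.2 (a i) j⟩) ?_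
      intro h h' hh
      apply Subtype.ext
      funext j
      exact congrArg Subtype.val (congrFun hh j)
    have h3 : (Nat.card {v : Fin t → ZMod p // ∀ i, (g ∘ a) i ⬝ᵥ v ≠ 0} : ℝ) =
        (p:ℝ) ^ t * (((p:ℝ) - 1) / p) ^ r := by
      have h4 : (Nat.card {v : Fin t → ZMod p // ∀ i, (g ∘ a) i ⬝ᵥ v ≠ 0} : ℝ) * (p:ℝ) ^ r
          = (p:ℝ) ^ t * ((p:ℝ) - 1) ^ r := by
        have := congrArg (Nat.cast : ℕ → ℝ) h1
        rw [Nat.cast_mul, Nat.cast_mul, Nat.cast_pow, Nat.cast_pow, Nat.cast_pow,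
          Nat.cast_sub hp.one_le, Nat.cast_one] at this
        exact this
      rw [div_pow, ← mul_div_assoc, ← h4]
      field_simp
    rw [hY, ← h3]
    exact_mod_cast h2
  have hbad : ∀ g : Fin m → Fin t → ZMod p,
      (Nat.card {h : Fin m → Fin t → ZMod p // ∀ i j, g i ⬝ᵥ h j ≠ 0} : ℝ) ≤ (p:ℝ) ^ (t * m) := by
    intro g
    have : Nat.card {h : Fin m → Fin t → ZMod p // ∀ i j, g i ⬝ᵥ h j ≠ 0} ≤ p ^ (t * m) := by
      rw [← hcardV]
      exact Nat.card_le_card_of_injective _ Subtype.val_injective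
    exact_mod_cast this
  calc ∑ g : Fin m → Fin t → ZMod p,
        (Nat.card {h : Fin m → Fin t → ZMod p // ∀ i j, g i ⬝ᵥ h j ≠ 0} : ℝ)
      ≤ ∑ g : Fin m → Fin t → ZMod p, ((if ¬ P g then (p:ℝ) ^ (t * m) else 0) + Y) := by
        refine Finset.sum_le_sum fun g _ => ?_
        by_cases h : P g
        · simpa [h] using hgood g h
        · simp only [h, not_false_eq_true, if_true]
          linarith [hbad g]
    _ = (Nat.card {g // ¬ P g} : ℝ) * (p:ℝ) ^ (t * m) + (p:ℝ) ^ (t * m) * Y := by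
        rw [Finset.sum_add_distrib, ← Finset.sum_filter, Finset.sum_const, Finset.sum_const,
          nsmul_eq_mul, nsmul_eq_mul, Finset.card_univ, ← Nat.card_eq_fintype_card, hcardV,
          Nat.card_eq_fintype_card, Fintype.card_subtype]
        push_cast; rfl
    _ ≤ _ := by
        have : (Nat.card {g // ¬ P g} : ℝ) ≤ (p:ℝ) ^ (r * (m + t)) := by
          exact_mod_cast card_low p m t r
        gcongr

abbrev Bad (X : Type) (R : X → X → Prop) (m : ℕ) : Type :=
  {c : Fin m ⊕ Fin m → X // ∀ i j, R (c (Sum.inl i)) (c (Sum.inr j))}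

theorem exists_random (X : Type) [Fintype X] [Nonempty X] (R : X → X → Prop) (m N : ℕ)
    (h : N ^ (2 * m) * Nat.card (Bad X R m) < Nat.card X ^ (2 * m)) :
    ∃ f : Fin N → X, ∀ a : Fin m ⊕ Fin m ↪ Fin N,
      ∃ i j, ¬ R (f (a (Sum.inl i))) (f (a (Sum.inr j))) := by
  classical
  by_contra hcon
  push Not at hcon
  choose a ha using hcon
  let T : (Fin m ⊕ Fin m ↪ Fin N) → Type := fun b =>
    {f : Fin N → X // ∀ i j, R (f (b (Sum.inl i))) (f (b (Sum.inr j)))}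
  have hT : ∀ b, Nat.card (T b) * Nat.card X ^ (2 * m) ≤ Nat.card (Bad X R m) * Nat.card X ^ N := by
    intro b
    have e1 : Nat.card (T b × (Fin m ⊕ Fin m → X)) = Nat.card (T b) * Nat.card X ^ (2 * m) := by
      rw [Nat.card_prod, Nat.card_fun]; simp [two_mul]
    have e2 : Nat.card (Bad X R m × (Fin N → X)) = Nat.card (Bad X R m) * Nat.card X ^ N := by
      rw [Nat.card_prod, Nat.card_fun]; simp
    rw [← e1, ← e2]
    refine Nat.card_le_card_of_injective
      (fun x => (⟨x.1.1 ∘ b, x.1.2⟩, Function.extend b x.2 x.1.1)) ?_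
    rintro ⟨⟨f, hf⟩, c⟩ ⟨⟨f', hf'⟩, c'⟩ hh
    simp only [Prod.mk.injEq, Subtype.mk.injEq] at hh ⊢
    obtain ⟨h1, h2⟩ := hh
    constructor
    · apply Subtype.ext
      funext x
      by_cases hx : ∃ y, b y = x
      · obtain ⟨y, rfl⟩ := hx
        exact congrFun h1 y
      · have := congrFun h2 x
        rwa [Function.extend_apply' _ _ _ hx, Function.extend_apply' _ _ _ hx] at this
    · funext y
      have := congrFun h2 (b y)
      rwa [b.injective.extend_apply, b.injective.extend_apply] at this
  have hS : Nat.card X ^ N ≤ ∑ b, Nat.card (T b) := by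
    rw [← Nat.card_sigma]
    have : Nat.card (Fin N → X) = Nat.card X ^ N := by rw [Nat.card_fun]; simp
    rw [← this]
    refine Nat.card_le_card_of_injective (fun f => ⟨a f, f, ha f⟩) ?_
    intro f f' hh
    have := congrArg (fun x : (Σ b, T b) => x.2.1) hh
    exact this
  have hE : Fintype.card (Fin m ⊕ Fin m ↪ Fin N) ≤ N ^ (2 * m) := by
    have : Fintype.card (Fin m ⊕ Fin m → Fin N) = N ^ (2 * m) := by simp [two_mul]
    rw [← this]
    exact Fintype.card_le_of_injective (fun f => (f : Fin m ⊕ Fin m → Fin N)) DFunLike.coe_injective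
  have hX : 0 < Nat.card X ^ N := pow_pos Nat.card_pos _
  have : Nat.card X ^ N * Nat.card X ^ (2 * m) < Nat.card X ^ N * Nat.card X ^ (2 * m) :=
    calc Nat.card X ^ N * Nat.card X ^ (2 * m)
        ≤ (∑ b, Nat.card (T b)) * Nat.card X ^ (2 * m) := Nat.mul_le_mul_right _ hS
      _ = ∑ b, Nat.card (T b) * Nat.card X ^ (2 * m) := Finset.sum_mul _ _ _
      _ ≤ ∑ b : Fin m ⊕ Fin m ↪ Fin N, Nat.card (Bad X R m) * Nat.card X ^ N :=
          Finset.sum_le_sum fun b _ => hT b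
      _ = Fintype.card (Fin m ⊕ Fin m ↪ Fin N) * (Nat.card (Bad X R m) * Nat.card X ^ N) := by
          simp
      _ ≤ N ^ (2 * m) * (Nat.card (Bad X R m) * Nat.card X ^ N) := Nat.mul_le_mul_right _ hE
      _ = Nat.card X ^ N * (N ^ (2 * m) * Nat.card (Bad X R m)) := by ring
      _ < _ := by gcongr
  exact lt_irrefl _ this

theorem card_bad_pi (X : Type) [Fintype X] (R : X → X → Prop) (m n : ℕ) :
    Nat.card (Bad (Fin n → X) (fun x y => ∀ l, R (x l) (y l)) m) = Nat.card (Bad X R m) ^ n := by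
  have : Nat.card (Fin n → Bad X R m) = Nat.card (Bad X R m) ^ n := by rw [Nat.card_fun]; simp
  rw [← this]
  exact Nat.card_congr
    { toFun := fun c l => ⟨fun i => c.1 i l, fun i j => c.2 i j l⟩
      invFun := fun c => ⟨fun i l => (c l).1 i, fun i j l => (c l).2 i j⟩
      left_inv := fun _ => rfl
      right_inv := fun _ => rfl }

abbrev QV (p t : ℕ) : Type := {v : Fin t → ZMod p // v ⬝ᵥ v ≠ 0}

theorem card_badQ (p : ℕ) [Fact p.Prime] (s : ℕ) (hs : 1 ≤ s)
    (hbig : 2 * (p:ℝ) ^ 8 ≤ ((p:ℝ) / (p - 1)) ^ (2 * s)) :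
    (Nat.card (Bad (QV p (4 * s)) (fun x y => x.1 ⬝ᵥ y.1 ≠ 0) (4 * s)) : ℝ)
      * ((p:ℝ) / (p - 1)) ^ (2 * s ^ 2) ≤ (Nat.card (QV p (4 * s)) : ℝ) ^ (8 * s) := by
  classical
  have hp := (Fact.out : p.Prime)
  have hp2 : (2:ℝ) ≤ p := by exact_mod_cast hp.two_le
  have hp0 : (0:ℝ) < p := by linarith
  have hp1 : (0:ℝ) < (p:ℝ) - 1 := by linarith
  have hQ : (p:ℝ) ^ (4 * s) ≤ (Nat.card (QV p (4 * s)) : ℝ) * p := by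
    obtain ⟨t, ht⟩ : ∃ t, 4 * s = t + 1 := ⟨4 * s - 1, by omega⟩
    rw [ht]
    have := cardQ p t
    rw [← Nat.card_eq_fintype_card] at this
    have h2 : (p:ℝ) ^ t ≤ (Nat.card (QV p (t + 1)) : ℝ) := by exact_mod_cast this
    rw [pow_succ]; gcongr
  have hB : (Nat.card (Bad (QV p (4 * s)) (fun x y => x.1 ⬝ᵥ y.1 ≠ 0) (4 * s)) : ℝ) ≤
      Nat.card {c : (Fin (4*s) → Fin (4*s) → ZMod p) × (Fin (4*s) → Fin (4*s) → ZMod p) //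
      ∀ i j, c.1 i ⬝ᵥ c.2 j ≠ 0} := by
    norm_cast
    refine Nat.card_le_card_of_injective
      (fun c => ⟨(fun i => (c.1 (Sum.inl i)).1, fun i => (c.1 (Sum.inr i)).1), c.2⟩) ?_
    intro c c' h
    simp only [Subtype.mk.injEq, Prod.mk.injEq] at h
    apply Subtype.ext
    funext x
    apply Subtype.ext
    rcases x with x | x
    · exact congrFun h.1 x
    · exact congrFun h.2 x
  have hV := card_badV p (4 * s) (4 * s) s
  set ρ : ℝ := (p:ℝ) / (p - 1) with hρ
  have hρ0 : 0 < ρ := by positivity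
  have hρi : ((p:ℝ) - 1) / p = ρ⁻¹ := by rw [hρ, inv_div]
  have hρp : ρ ≤ (p:ℝ) ^ 2 := by
    rw [hρ, div_le_iff₀ hp1]; nlinarith
  rw [hρi] at hV
  set D : ℝ := (p:ℝ) ^ (32 * s ^ 2) with hD
  have hD0 : 0 < D := by positivity
  have h1 : (p:ℝ) ^ (s * (4 * s + 4 * s)) * (p:ℝ) ^ (4 * s * (4 * s)) * ρ ^ (4 * s ^ 2) ≤ D := by
    calc _ ≤ (p:ℝ) ^ (s * (4 * s + 4 * s)) * (p:ℝ) ^ (4 * s * (4 * s)) * ((p:ℝ) ^ 2) ^ (4 * s ^ 2) := by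
            gcongr
      _ = D := by rw [hD, ← pow_mul, ← pow_add, ← pow_add]; congr 1; ring
  have h2 : (p:ℝ) ^ (4 * s * (4 * s)) * ((p:ℝ) ^ (4 * s) * (ρ⁻¹) ^ s) ^ (4 * s) * ρ ^ (4 * s ^ 2) = D := by
    rw [mul_pow, ← pow_mul, ← pow_mul, inv_pow, hD]
    have : s * (4 * s) = 4 * s ^ 2 := by ring
    rw [this]
    have h3 : (p:ℝ) ^ (32 * s ^ 2) = (p:ℝ) ^ (4 * s * (4 * s)) * (p:ℝ) ^ (4 * s * (4 * s)) := by
      rw [← pow_add]; congr 1; ring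
    rw [h3]
    field_simp
  have h3 : (Nat.card (Bad (QV p (4 * s)) (fun x y => x.1 ⬝ᵥ y.1 ≠ 0) (4 * s)) : ℝ) * ρ ^ (4 * s ^ 2)
      ≤ 2 * D := by
    have := mul_le_mul_of_nonneg_right (hB.trans hV) (by positivity : (0:ℝ) ≤ ρ ^ (4 * s ^ 2))
    rw [add_mul, h2] at this
    linarith
  have h4 : 2 * (p:ℝ) ^ (8 * s) ≤ ρ ^ (2 * s ^ 2) := by
    calc 2 * (p:ℝ) ^ (8 * s) ≤ 2 ^ s * (p:ℝ) ^ (8 * s) := by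
            gcongr
            exact le_self_pow₀ (by norm_num) (by omega)
      _ = (2 * (p:ℝ) ^ 8) ^ s := by rw [mul_pow, pow_mul]
      _ ≤ (ρ ^ (2 * s)) ^ s := by gcongr
      _ = _ := by rw [← pow_mul]; congr 1; ring
  have h5 : D ≤ (Nat.card (QV p (4 * s)) : ℝ) ^ (8 * s) * (p:ℝ) ^ (8 * s) := by
    rw [← mul_pow]
    calc D = ((p:ℝ) ^ (4 * s)) ^ (8 * s) := by rw [hD, ← pow_mul]; congr 1; ring
      _ ≤ _ := by gcongr
  have h6 : ρ ^ (4 * s ^ 2) = ρ ^ (2 * s ^ 2) * ρ ^ (2 * s ^ 2) := by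
    rw [← pow_add]; congr 1; ring
  rw [h6, ← mul_assoc] at h3
  have h7 : (Nat.card (Bad (QV p (4 * s)) (fun x y => x.1 ⬝ᵥ y.1 ≠ 0) (4 * s)) : ℝ) * ρ ^ (2 * s ^ 2) * ρ ^ (2 * s ^ 2)
      ≤ (Nat.card (QV p (4 * s)) : ℝ) ^ (8 * s) * ρ ^ (2 * s ^ 2) := by
    calc _ ≤ 2 * D := h3
      _ ≤ 2 * ((Nat.card (QV p (4 * s)) : ℝ) ^ (8 * s) * (p:ℝ) ^ (8 * s)) := by gcongr
      _ = (Nat.card (QV p (4 * s)) : ℝ) ^ (8 * s) * (2 * (p:ℝ) ^ (8 * s)) := by ring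
      _ ≤ _ := by gcongr
  exact le_of_mul_le_mul_right h7 (by positivity)

/-- tensor product of the coordinates, padded by zero -/
noncomputable def tens {p : ℕ} (F : Type) [Field F] [CharP F p] {n t d : ℕ}
    (e : (Fin n → Fin t) ↪ Fin d) (x : Fin n → Fin t → ZMod p) : Fin d → F :=
  Function.extend e (fun j => ∏ l, (ZMod.castHom (dvd_refl p) F) (x l (j l))) 0

theorem tens_inner {p : ℕ} (F : Type) [Field F] [CharP F p] {n t d : ℕ}
    (e : (Fin n → Fin t) ↪ Fin d) (x y : Fin n → Fin t → ZMod p) :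
    ∑ i, tens F e x i * tens F e y i
      = ∏ l, (ZMod.castHom (dvd_refl p) F) (x l ⬝ᵥ y l) := by
  classical
  have h1 : ∑ i, tens F e x i * tens F e y i =
      ∑ i ∈ Finset.univ.map e, tens F e x i * tens F e y i := by
    symm
    apply Finset.sum_subset (Finset.subset_univ _)
    intro i _ hi
    have : ¬ ∃ j, e j = i := by simpa using hi
    simp [tens, Function.extend_apply' _ _ _ this]
  rw [h1, Finset.sum_map]
  simp only [tens, e.injective.extend_apply, ← Finset.prod_mul_distrib, ← map_mul, dotProduct,
    map_sum]
  rw [Finset.prod_univ_sum]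
  simp

theorem core (p : ℕ) [Fact p.Prime] (F : Type) [Field F] [CharP F p] (s n N k d : ℕ)
    (hs : 1 ≤ s) (hbig : 2 * (p:ℝ) ^ 8 ≤ ((p:ℝ) / (p - 1)) ^ (2 * s))
    (hN : (N:ℝ) ^ (8 * s) < ((p:ℝ) / (p - 1)) ^ (2 * s ^ 2 * n))
    (hd : (4 * s) ^ n ≤ d) (hk : 8 * s ≤ k + 1) :
    ∃ A : Finset (Fin d → F), N ≤ 8 * s * A.card ∧
            (∀ v ∈ A, ∑ i, v i * v i ≠ 0) ∧
            (∀ A₁ ⊆ A, ∀ A₂ ⊆ A, A₁.card = k + 1 → A₂.card = k + 1 →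
              ∃ v₁ ∈ A₁, ∃ v₂ ∈ A₂, ∑ i, v₁ i * v₂ i = 0) := by
  classical
  have hp := (Fact.out : p.Prime)
  have hp2 : (2:ℝ) ≤ p := by exact_mod_cast hp.two_le
  have hp1 : (0:ℝ) < (p:ℝ) - 1 := by linarith
  obtain ⟨e⟩ : Nonempty ((Fin n → Fin (4 * s)) ↪ Fin d) :=
    Function.Embedding.nonempty_of_card_le (by simpa using hd)
  have hne : Nonempty (QV p (4 * s)) := by
    obtain ⟨t, ht⟩ : ∃ t, 4 * s = t + 1 := ⟨4 * s - 1, by omega⟩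
    rw [ht]
    have := cardQ p t
    exact Fintype.card_pos_iff.1 (lt_of_lt_of_le (pow_pos hp.pos t) this)
  let R : (Fin n → QV p (4 * s)) → (Fin n → QV p (4 * s)) → Prop :=
    fun x y => ∀ l, (x l).1 ⬝ᵥ (y l).1 ≠ 0
  have hcount : N ^ (2 * (4 * s)) * Nat.card (Bad (Fin n → QV p (4 * s)) R (4 * s)) <
      Nat.card (Fin n → QV p (4 * s)) ^ (2 * (4 * s)) := by
    have h1 : Nat.card (Bad (Fin n → QV p (4 * s)) R (4 * s)) = _ :=
      card_bad_pi (QV p (4 * s)) (fun x y => x.1 ⬝ᵥ y.1 ≠ 0) (4 * s) n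
    have h2 : Nat.card (Fin n → QV p (4 * s)) = Nat.card (QV p (4 * s)) ^ n := by
      rw [Nat.card_fun]; simp
    have hB := card_badQ p s hs hbig
    rw [h1, h2]
    set B := Nat.card (Bad (QV p (4 * s)) (fun x y => x.1 ⬝ᵥ y.1 ≠ 0) (4 * s))
    have hq : 0 < Nat.card (QV p (4 * s)) := Nat.card_pos
    set q := Nat.card (QV p (4 * s))
    rw [← mul_assoc]
    norm_num only
    have : (N:ℝ) ^ (8 * s) * (B:ℝ) ^ n < ((q:ℝ) ^ n) ^ (8 * s) := by
      rcases Nat.eq_zero_or_pos (B ^ n) with h0 | h0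
      · have : (B:ℝ) ^ n = 0 := by exact_mod_cast h0
        rw [this, mul_zero]
        positivity
      · have h0' : (0:ℝ) < (B:ℝ) ^ n := by exact_mod_cast h0
        calc (N:ℝ) ^ (8 * s) * (B:ℝ) ^ n
            < ((p:ℝ) / (p - 1)) ^ (2 * s ^ 2 * n) * (B:ℝ) ^ n := by gcongr
          _ = ((B:ℝ) * ((p:ℝ) / (p - 1)) ^ (2 * s ^ 2)) ^ n := by rw [mul_pow, ← pow_mul]; ring
          _ ≤ ((q:ℝ) ^ (8 * s)) ^ n := by gcongr
          _ = _ := by rw [← pow_mul, ← pow_mul, mul_comm]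
    exact_mod_cast this
  obtain ⟨f, hf⟩ := exists_random _ R (4 * s) N hcount
  let Φ : Fin N → Fin d → F := fun i => tens F e (fun l => (f i l).1)
  have hΦ : ∀ i j, ∑ x, Φ i x * Φ j x = 0 ↔ ¬ R (f i) (f j) := by
    intro i j
    simp only [Φ, tens_inner, Finset.prod_eq_zero_iff, R, map_eq_zero]
    simp
  have hself : ∀ i, ∑ x, Φ i x * Φ i x ≠ 0 := by
    intro i h
    exact (hΦ i i).1 h fun l => (f i l).2
  refine ⟨Finset.univ.image Φ, ?_, ?_, ?_⟩
  · have := Finset.card_le_mul_card_image (s := (Finset.univ : Finset (Fin N))) (f := Φ) (8 * s) ?_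
    · simpa using this
    · intro v hv
      by_contra hlt
      push Not at hlt
      obtain ⟨a⟩ : Nonempty (Fin (4 * s) ⊕ Fin (4 * s) ↪
          {i // i ∈ Finset.univ.filter (fun i => Φ i = v)}) :=
        Function.Embedding.nonempty_of_card_le (by
          rw [Fintype.card_coe]; simp only [Fintype.card_sum, Fintype.card_fin]; omega)
      obtain ⟨i, j, hij⟩ := hf (a.trans (Function.Embedding.subtype _))
      rw [← hΦ] at hij
      have h1 := (a (Sum.inl i)).2
      have h2 := (a (Sum.inr j)).2
      simp only [Finset.mem_filter, Finset.mem_univ, true_and] at h1 h2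
      simp only [Function.Embedding.trans_apply, Function.Embedding.subtype_apply] at hij
      have h3 := hself (a (Sum.inl i)).1
      have h4 := h2.trans h1.symm
      rw [h4] at hij
      exact h3 hij
  · intro v hv
    obtain ⟨i, -, rfl⟩ := Finset.mem_image.1 hv
    exact hself i
  · intro A₁ h₁ A₂ h₂ c₁ c₂
    obtain ⟨B₁, hB₁, cB₁⟩ := Finset.exists_subset_card_eq (s := A₁) (n := 4 * s) (by omega)
    have : 4 * s ≤ (A₂ \ B₁).card := by
      have := Finset.le_card_sdiff B₁ A₂
      omega
    obtain ⟨B₂, hB₂, cB₂⟩ := Finset.exists_subset_card_eq this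
    let e₁ := B₁.equivFinOfCardEq cB₁
    let e₂ := B₂.equivFinOfCardEq cB₂
    let w : Fin (4 * s) ⊕ Fin (4 * s) → Fin d → F :=
      Sum.elim (fun i => (e₁.symm i).1) (fun i => (e₂.symm i).1)
    have hw : Function.Injective w := by
      rintro (i | i) (j | j) hij
      · simpa [w] using hij
      · exfalso
        simp only [w, Sum.elim_inl, Sum.elim_inr] at hij
        have h3 := hB₂ (e₂.symm j).2
        rw [← hij] at h3
        exact (Finset.mem_sdiff.1 h3).2 (e₁.symm i).2
      · exfalso
        simp only [w, Sum.elim_inl, Sum.elim_inr] at hij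
        have h3 := hB₂ (e₂.symm i).2
        rw [hij] at h3
        exact (Finset.mem_sdiff.1 h3).2 (e₁.symm j).2
      · simpa [w] using hij
    have hmem : ∀ x, ∃ i, Φ i = w x := by
      rintro (i | i)
      · have := h₁ (hB₁ (e₁.symm i).2)
        simpa [w] using this
      · have := h₂ (Finset.mem_sdiff.1 (hB₂ (e₂.symm i).2)).1
        simpa [w] using this
    choose a ha using hmem
    have hainj : Function.Injective a := by
      intro x y hxy
      apply hw
      rw [← ha, ← ha, hxy]
    obtain ⟨i, j, hij⟩ := hf ⟨a, hainj⟩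
    rw [← hΦ] at hij
    simp only [Function.Embedding.coeFn_mk, ha] at hij
    exact ⟨_, hB₁ (e₁.symm i).2, _, (Finset.mem_sdiff.1 (hB₂ (e₂.symm j).2)).1, hij⟩

theorem small_case (F : Type) [Field F] (k d : ℕ) (hk : 2 ≤ k) :
    ∃ A : Finset (Fin d → F), A.card = d ∧
            (∀ v ∈ A, ∑ i, v i * v i ≠ 0) ∧
            (∀ A₁ ⊆ A, ∀ A₂ ⊆ A, A₁.card = k + 1 → A₂.card = k + 1 →
              ∃ v₁ ∈ A₁, ∃ v₂ ∈ A₂, ∑ i, v₁ i * v₂ i = 0) := by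
  classical
  let Φ : Fin d → Fin d → F := fun i => Pi.single i 1
  have hinj : Function.Injective Φ := fun i j h => by
    by_contra hne
    have := congrFun h i
    simp [Φ, Pi.single_apply, hne] at this
  have hin : ∀ i j, ∑ x, Φ i x * Φ j x = if i = j then 1 else 0 := by
    intro i j
    simp [Φ, Pi.single_apply, eq_comm]
  refine ⟨Finset.univ.image Φ, ?_, ?_, ?_⟩
  · rw [Finset.card_image_of_injective _ hinj]; simp
  · intro v hv
    obtain ⟨i, -, rfl⟩ := Finset.mem_image.1 hv
    simp [hin]
  · intro A₁ h₁ A₂ h₂ c₁ c₂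
    obtain ⟨u, hu⟩ : A₁.Nonempty := Finset.card_pos.1 (by omega)
    obtain ⟨v, hv, hne⟩ := Finset.exists_mem_ne (s := A₂) (by omega) u
    obtain ⟨i, -, rfl⟩ := Finset.mem_image.1 (h₁ hu)
    obtain ⟨j, -, rfl⟩ := Finset.mem_image.1 (h₂ hv)
    refine ⟨_, hu, _, hv, ?_⟩
    rw [hin, if_neg]
    rintro rfl
    exact hne rfl

/-- For every prime `p` there is `δ = δ(p) > 0` such that for every field `F`
of characteristic `p` and all integers `k ≥ 2` and `d ≥ k`, there is a set
`A ⊆ F^d` of non-self-orthogonal vectors, of size at least `d^(δ·k/log₂ k)`,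
such that any two subsets of `A` of size `k+1` each contain vectors `v₁, v₂`
(one from each) with `⟪v₁,v₂⟫ = 0`. -/
theorem stmt_11 (p : ℕ) (hp : p.Prime) :
    ∃ δ : ℝ, 0 < δ ∧
      ∀ (F : Type) [Field F], CharP F p →
        ∀ k d : ℕ, 2 ≤ k → k ≤ d →
          ∃ A : Finset (Fin d → F),
            (d : ℝ) ^ (δ * k / Real.logb 2 k) ≤ (A.card : ℝ) ∧
            (∀ v ∈ A, ∑ i, v i * v i ≠ 0) ∧
            (∀ A₁ ⊆ A, ∀ A₂ ⊆ A, A₁.card = k + 1 → A₂.card = k + 1 →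
              ∃ v₁ ∈ A₁, ∃ v₂ ∈ A₂, ∑ i, v₁ i * v₂ i = 0) := by
  have : Fact p.Prime := ⟨hp⟩
  have hp2 : (2:ℝ) ≤ p := by exact_mod_cast hp.two_le
  have hp1 : (0:ℝ) < (p:ℝ) - 1 := by linarith
  set ρ : ℝ := (p:ℝ) / (p - 1) with hρ
  have hρ1 : 1 < ρ := by rw [hρ, lt_div_iff₀ hp1]; linarith
  set τ : ℝ := ρ ^ ((1:ℝ) / 16) with hτ
  have hτ1 : 1 < τ := Real.one_lt_rpow hρ1 (by norm_num)
  have hτ0 : 0 < τ := by linarith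
  have hτρ : τ ^ 16 = ρ := by
    rw [hτ, ← Real.rpow_natCast, ← Real.rpow_mul (by linarith)]; norm_num
  -- eventual inequalities
  have hev1 : ∀ᶠ s : ℕ in Filter.atTop, 16 * (s:ℝ) ≤ τ ^ s := by
    have h := tendsto_pow_const_div_const_pow_of_one_lt 1 hτ1
    have h2 := h.eventually (gt_mem_nhds (show (0:ℝ) < 1 / 16 by norm_num))
    filter_upwards [h2] with s hs
    have h3 : 0 < τ ^ s := by positivity
    rw [div_lt_iff₀ h3, pow_one] at hs
    linarith
  have hev2 : ∀ᶠ s : ℕ in Filter.atTop, 2 * (p:ℝ) ^ 8 ≤ ρ ^ s :=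
    (tendsto_pow_atTop_atTop_of_one_lt hρ1).eventually_ge_atTop _
  obtain ⟨s0, hs0⟩ := Filter.eventually_atTop.1 (hev1.and hev2)
  have hlog : 0 < Real.logb 2 τ := Real.logb_pos (by norm_num) hτ1
  set δ : ℝ := min (Real.logb 2 τ / 32) (1 / (8 * s0 + 8)) with hδ
  have hδ0 : 0 < δ := lt_min (by positivity) (by positivity)
  refine ⟨δ, hδ0, ?_⟩
  intro F _ hchar k d hk hkd
  have hk2 : (2:ℝ) ≤ k := by exact_mod_cast hk
  have hd1 : (1:ℝ) ≤ d := by exact_mod_cast (by omega : 1 ≤ d)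
  have hlk : 1 ≤ Real.logb 2 k := by
    rw [Real.le_logb_iff_rpow_le (by norm_num) (by linarith)]; simpa using hk2
  by_cases hsmall : k < 8 * s0 + 8
  · obtain ⟨A, hA, h2, h3⟩ := small_case F k d hk
    refine ⟨A, ?_, h2, h3⟩
    rw [hA]
    have : δ * k / Real.logb 2 k ≤ 1 := by
      rw [div_le_one (by linarith)]
      refine le_trans ?_ hlk
      have h4 : δ ≤ 1 / (8 * s0 + 8) := min_le_right _ _
      have h5 : (k:ℝ) ≤ 8 * s0 + 8 := by exact_mod_cast hsmall.le
      calc δ * k ≤ 1 / (8 * s0 + 8) * (8 * s0 + 8) := by gcongr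
        _ = 1 := by field_simp
    calc (d:ℝ) ^ (δ * k / Real.logb 2 k) ≤ (d:ℝ) ^ (1:ℝ) :=
          Real.rpow_le_rpow_of_exponent_le hd1 this
      _ = d := Real.rpow_one _
  · push Not at hsmall
    obtain ⟨s, hs⟩ : ∃ s, s = (k + 1) / 8 := ⟨_, rfl⟩
    have hss0 : s0 ≤ s := by omega
    have hs1 : 1 ≤ s := by omega
    have hsk : 8 * s ≤ k + 1 := by omega
    have hks : k ≤ 16 * s := by omega
    have h4k : 4 * s ≤ k := by omega
    obtain ⟨n, hn⟩ : ∃ n, n = Nat.log (4 * s) d := ⟨_, rfl⟩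
    have hn1 : 1 ≤ n := hn ▸ Nat.log_pos (by omega) (by omega)
    have hnd : (4 * s) ^ n ≤ d := hn ▸ Nat.pow_log_le_self _ (by omega)
    have hdn : d < (4 * s) ^ (n + 1) := hn ▸ Nat.lt_pow_succ_log_self (by omega) _
    have hdk : d ≤ k ^ (2 * n) :=
      calc d ≤ (4 * s) ^ (n + 1) := hdn.le
        _ ≤ k ^ (n + 1) := Nat.pow_le_pow_left h4k _
        _ ≤ k ^ (2 * n) := Nat.pow_le_pow_right (by omega) (by omega)
    set N := ⌊τ ^ (2 * s * n)⌋₊ with hN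
    have hNle : (N:ℝ) ≤ τ ^ (2 * s * n) := Nat.floor_le (by positivity)
    have hNge : τ ^ (2 * s * n) ≤ 2 * N := by
      have h1 : τ ^ (2 * s * n) < N + 1 := Nat.lt_floor_add_one _
      have h2 : 1 ≤ N := Nat.le_floor (by simpa using one_le_pow₀ hτ1.le)
      have h3 : (1:ℝ) ≤ N := by exact_mod_cast h2
      linarith
    have hNpow : (N:ℝ) ^ (8 * s) < ρ ^ (2 * s ^ 2 * n) := by
      calc (N:ℝ) ^ (8 * s) ≤ (τ ^ (2 * s * n)) ^ (8 * s) := by gcongr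
        _ = ρ ^ (s ^ 2 * n) := by rw [← hτρ, ← pow_mul, ← pow_mul]; congr 1; ring
        _ < ρ ^ (2 * s ^ 2 * n) := by
          apply pow_lt_pow_right₀ hρ1
          have : 0 < s ^ 2 * n := by positivity
          nlinarith
    have hbig : 2 * (p:ℝ) ^ 8 ≤ ρ ^ (2 * s) := (hs0 (2 * s) (by omega)).2
    obtain ⟨A, hA, h2, h3⟩ := core p F s n N k d hs1 hbig hNpow hnd hsk
    refine ⟨A, ?_, h2, h3⟩
    have hA' : (N:ℝ) ≤ 8 * s * A.card := by exact_mod_cast hA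
    have hs' : (0:ℝ) < s := by exact_mod_cast hs1
    have hτs : 16 * (s:ℝ) ≤ τ ^ (s * n) :=
      (hs0 s hss0).1.trans (pow_le_pow_right₀ hτ1.le (Nat.le_mul_of_pos_right _ hn1))
    have hcard : τ ^ (s * n) ≤ A.card := by
      have h4 : τ ^ (2 * s * n) = τ ^ (s * n) * τ ^ (s * n) := by
        rw [← pow_add]; congr 1; ring
      have h5 : 0 < τ ^ (s * n) := by positivity
      have h6 : 16 * (s:ℝ) * τ ^ (s * n) ≤ 16 * s * A.card := by
        calc 16 * (s:ℝ) * τ ^ (s * n) ≤ τ ^ (s * n) * τ ^ (s * n) := by gcongr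
          _ ≤ 16 * s * A.card := by rw [← h4]; linarith
      exact le_of_mul_le_mul_left h6 (by positivity)
    refine le_trans ?_ hcard
    have hx0 : 0 ≤ δ * k / Real.logb 2 k := by positivity
    have hkpow : (k:ℝ) = 2 ^ Real.logb 2 k :=
      (Real.rpow_logb (by norm_num) (by norm_num) (by linarith)).symm
    have hτpow : τ = 2 ^ Real.logb 2 τ :=
      (Real.rpow_logb (by norm_num) (by norm_num) hτ0).symm
    have hdk' : (d:ℝ) ≤ (k:ℝ) ^ (2 * n) := by exact_mod_cast hdk
    calc (d:ℝ) ^ (δ * k / Real.logb 2 k) ≤ ((k:ℝ) ^ (2 * n)) ^ (δ * k / Real.logb 2 k) := by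
          gcongr
      _ = (k:ℝ) ^ ((2 * n : ℕ) * (δ * k / Real.logb 2 k)) := by
          rw [← Real.rpow_natCast, ← Real.rpow_mul (by linarith)]
      _ = (2:ℝ) ^ (Real.logb 2 k * ((2 * n : ℕ) * (δ * k / Real.logb 2 k))) := by
          rw [Real.rpow_mul (x := 2) (by norm_num) (Real.logb 2 k), ← hkpow]
      _ = (2:ℝ) ^ (2 * n * δ * k) := by
          congr 1; push_cast; field_simp
      _ ≤ (2:ℝ) ^ (Real.logb 2 τ * (s * n : ℕ)) := by
          apply Real.rpow_le_rpow_of_exponent_le (by norm_num)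
          have h4 : δ ≤ Real.logb 2 τ / 32 := min_le_left _ _
          have h5 : (k:ℝ) ≤ 16 * s := by exact_mod_cast hks
          calc 2 * n * δ * k ≤ 2 * n * (Real.logb 2 τ / 32) * (16 * s) := by gcongr
            _ = _ := by push_cast; ring
      _ = τ ^ (s * n) := by
          rw [Real.rpow_mul (by norm_num), ← hτpow, Real.rpow_natCast]
end

section
/- For every prime p and integer ℓ ≥ 1, there exists a constant δ = δ(p,ℓ) > 0 such that for every field F of characteristic p and all integers k ≥ 2, d ≥ k ≥ ℓ, there exists a set A ⊆ F^d of non-self-orthogonal vectors with |A| ≥ d^{δ·k/log₂ k}, such that every k+1 vectors of A include ℓ+1 pairwise orthogonal vectors. -/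
namespace NearOrth

open Finset

/-- random map avoiding a small family of bad tuples -/
lemma count_avoid {X : Type} [Fintype X] [DecidableEq X] [Nonempty X] (n N : ℕ)
    (Bad : Finset (Fin n → X)) (hb : N ^ n * Bad.card < (Fintype.card X) ^ n) :
    ∃ w : Fin N → X, ∀ g : Fin n → Fin N, Function.Injective g → w ∘ g ∉ Bad := by
  classical
  by_contra hcon
  push Not at hcon
  set M := Fintype.card X with hM
  have hMpos : 0 < M := Fintype.card_pos
  have hfib : ∀ g : Fin n → Fin N, Function.Injective g →
      (univ.filter (fun w : Fin N → X => w ∘ g ∈ Bad)).card * M ^ n ≤ Bad.card * M ^ N := by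
    intro g hg
    have h1 : ((univ.filter (fun w : Fin N → X => w ∘ g ∈ Bad)) ×ˢ
        (univ : Finset (Fin n → X))).card ≤ (Bad ×ˢ (univ : Finset (Fin N → X))).card := by
      apply Finset.card_le_card_of_injOn
        (fun q => (q.1 ∘ g, Function.extend g q.2 q.1))
      · intro q hq
        simpa using hq
      · rintro ⟨w, y⟩ - ⟨w', y'⟩ - h
        simp only [Prod.mk.injEq] at h
        obtain ⟨h1, h2⟩ := h
        have hy : y = y' := by
          funext i
          have := congrFun h2 (g i)
          simpa [hg.extend_apply] using this
        have hw : w = w' := by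
          funext i
          by_cases hi : ∃ a, g a = i
          · obtain ⟨a, rfl⟩ := hi
            exact congrFun h1 a
          · have := congrFun h2 i
            simpa [Function.extend_apply' _ _ _ hi] using this
        rw [hy, hw]
    simpa [card_product, hM] using h1
  have hcov : (univ : Finset (Fin N → X)) ⊆
      (univ.filter (fun g : Fin n → Fin N => Function.Injective g)).biUnion
        (fun g => univ.filter (fun w : Fin N → X => w ∘ g ∈ Bad)) := by
    intro w _
    obtain ⟨g, hg, hgb⟩ := hcon w
    simp only [mem_biUnion, mem_filter, mem_univ, true_and]
    exact ⟨g, hg, hgb⟩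
  have h2 : M ^ N * M ^ n ≤ N ^ n * (Bad.card * M ^ N) := by
    calc M ^ N * M ^ n = (univ : Finset (Fin N → X)).card * M ^ n := by simp [hM]
      _ ≤ (∑ g ∈ univ.filter (fun g : Fin n → Fin N => Function.Injective g),
          (univ.filter (fun w : Fin N → X => w ∘ g ∈ Bad)).card) * M ^ n := by
            gcongr
            exact (card_le_card hcov).trans card_biUnion_le
      _ = ∑ g ∈ univ.filter (fun g : Fin n → Fin N => Function.Injective g),
          (univ.filter (fun w : Fin N → X => w ∘ g ∈ Bad)).card * M ^ n := by
            rw [sum_mul]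
      _ ≤ ∑ g ∈ univ.filter (fun g : Fin n → Fin N => Function.Injective g),
          Bad.card * M ^ N := by
            apply sum_le_sum
            intro g hg
            exact hfib g (by simpa using hg)
      _ ≤ N ^ n * (Bad.card * M ^ N) := by
            rw [sum_const, smul_eq_mul]
            gcongr
            refine (card_filter_le _ _).trans ?_
            simp
  have h3 : 0 < M ^ N := pow_pos hMpos N
  nlinarith

section
variable {p : ℕ} [Fact p.Prime] {t : ℕ}

/-- pairwise orthogonal -/
def Clq (T : Finset (Fin t → ZMod p)) : Prop :=
  ∀ u ∈ T, ∀ v ∈ T, u ≠ v → u ⬝ᵥ v = 0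

/-- containing K pairwise orthogonal vectors -/
def HasClq (K : ℕ) (L : Set (Fin t → ZMod p)) : Prop :=
  ∃ T : Finset (Fin t → ZMod p), (T : Set (Fin t → ZMod p)) ⊆ L ∧ T.card = K ∧ Clq T

/-- a jointly independent family of cliques, at most `r` of each size -/
def IsStr (r : ℕ) (L : Set (Fin t → ZMod p)) (C : Finset (Finset (Fin t → ZMod p))) : Prop :=
  (∀ T ∈ C, T.Nonempty ∧ (T : Set (Fin t → ZMod p)) ⊆ L ∧ Clq T) ∧
  (C : Set (Finset (Fin t → ZMod p))).PairwiseDisjoint id ∧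
  LinearIndepOn (ZMod p) id (↑(C.biUnion id) : Set (Fin t → ZMod p)) ∧
  (∀ j, (C.filter (fun T => T.card = j)).card ≤ r)

/-- existence of a structure with `n` vectors -/
def Str (r : ℕ) (L : Set (Fin t → ZMod p)) (n : ℕ) : Prop :=
  ∃ C : Finset (Finset (Fin t → ZMod p)), IsStr r L C ∧ (C.biUnion id).card = n

lemma HasClq.mono {K : ℕ} {L L' : Set (Fin t → ZMod p)} (h : L ⊆ L') :
    HasClq K L → HasClq K L' := by
  rintro ⟨T, hT, h2⟩
  exact ⟨T, hT.trans h, h2⟩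

lemma Str.mono {r n : ℕ} {L L' : Set (Fin t → ZMod p)} (h : L ⊆ L') :
    Str r L n → Str r L' n := by
  rintro ⟨C, ⟨h1, h2⟩, h3⟩
  exact ⟨C, ⟨fun T hT => ⟨(h1 T hT).1, (h1 T hT).2.1.trans h, (h1 T hT).2.2⟩, h2⟩, h3⟩

lemma card_lt_of_noClq {K : ℕ} {L : Set (Fin t → ZMod p)} (h : ¬ HasClq K L)
    {T : Finset (Fin t → ZMod p)} (hT : (T : Set (Fin t → ZMod p)) ⊆ L) (hc : Clq T) :
    T.card < K := by
  by_contra hK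
  push Not at hK
  obtain ⟨T', hT', hcard⟩ := Finset.exists_subset_card_eq hK
  exact h ⟨T', fun x hx => hT (hT' hx), hcard, fun u hu v hv => hc u (hT' hu) v (hT' hv)⟩

lemma str_bound {K r n : ℕ} {L : Set (Fin t → ZMod p)} (h : ¬ HasClq K L) (hs : Str r L n) :
    n ≤ K * K * r := by
  obtain ⟨C, ⟨h1, h2, h3, h4⟩, rfl⟩ := hs
  have hlt : ∀ T ∈ C, T.card < K := fun T hT => card_lt_of_noClq h (h1 T hT).2.1 (h1 T hT).2.2
  have hC : C.card ≤ K * r := by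
    have := Finset.card_eq_sum_card_fiberwise (s := C) (t := range K) (f := Finset.card)
      (by intro T hT; simpa using hlt T hT)
    rw [this]
    calc _ ≤ ∑ j ∈ range K, r := sum_le_sum (fun j _ => h4 j)
      _ = K * r := by simp
  calc (C.biUnion id).card ≤ ∑ T ∈ C, (id T).card := card_biUnion_le
    _ ≤ ∑ T ∈ C, K := sum_le_sum (fun T hT => (hlt T hT).le)
    _ = C.card * K := by simp
    _ ≤ (K * r) * K := by gcongr
    _ = K * K * r := by ring

lemma card_surj {ι : Type} [Fintype ι] (b : ι → (Fin t → ZMod p))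
    (hb : LinearIndependent (ZMod p) b) :
    Function.Surjective (fun (v : Fin t → ZMod p) (i : ι) => b i ⬝ᵥ v) := by
  classical
  have hr := LinearIndependent.rank_matrix (M := Matrix.of b) (by simpa using hb)
  have : LinearMap.range (Matrix.of b).mulVecLin = ⊤ := by
    apply Submodule.eq_top_of_finrank_eq
    rw [← Matrix.rank, hr]; simp
  have h2 := LinearMap.range_eq_top.mp this
  intro f
  obtain ⟨v, hv⟩ := h2 f
  exact ⟨v, hv⟩

/-- number of vectors not orthogonal to any of `r` jointly independent `j`-sets -/
lemma card_nonorth (D : Finset (Finset (Fin t → ZMod p))) (j : ℕ)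
    (hj : ∀ T ∈ D, T.card = j)
    (hd : (D : Set (Finset (Fin t → ZMod p))).PairwiseDisjoint id)
    (hli : LinearIndepOn (ZMod p) id (↑(D.biUnion id) : Set (Fin t → ZMod p))) :
    ((univ.filter (fun v : Fin t → ZMod p => ∀ T ∈ D, ∃ u ∈ T, u ⬝ᵥ v ≠ 0)).card : ℝ)
      ≤ (p : ℝ) ^ t * (1 - ((p : ℝ) ^ j)⁻¹) ^ D.card := by
  classical
  let ι := Σ T : D, (T.1 : Finset (Fin t → ZMod p))
  let b : ι → (Fin t → ZMod p) := fun x => x.2.1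
  have hbU : ∀ x : ι, b x ∈ (↑(D.biUnion id) : Set (Fin t → ZMod p)) := by
    intro x
    simp only [coe_biUnion, Set.mem_iUnion]
    exact ⟨x.1.1, x.1.2, x.2.2⟩
  have hbi : Function.Injective b := by
    rintro ⟨⟨T, hT⟩, ⟨u, hu⟩⟩ ⟨⟨T', hT'⟩, ⟨u', hu'⟩⟩ h
    simp only [b] at h
    subst h
    have : T = T' := by
      by_contra hne
      exact Finset.disjoint_left.mp (hd hT hT' hne) hu hu'
    subst this
    rfl
  have hb : LinearIndependent (ZMod p) b :=
    LinearIndependent.comp hli (fun x : ι => ⟨b x, hbU x⟩)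
      (fun x y h => hbi (by simpa using h))
  have hs := card_surj b hb
  -- dependent version
  let φ : (Fin t → ZMod p) →+ (∀ T : D, ((T.1 : Finset (Fin t → ZMod p)) → ZMod p)) :=
    { toFun := fun v T u => u.1 ⬝ᵥ v
      map_zero' := by funext T u; simp
      map_add' := by intro x y; funext T u; simp [dotProduct_add] }
  have hφ : Function.Surjective φ := by
    intro y
    obtain ⟨v, hv⟩ := hs (fun x => y x.1 x.2)
    refine ⟨v, ?_⟩
    funext T u
    exact congrFun hv ⟨T, u⟩
  -- fibres
  have hfib : ∀ y : (∀ T : D, ((T.1 : Finset (Fin t → ZMod p)) → ZMod p)), (univ.filter (fun v => φ v = y)).card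
      = (univ.filter (fun v => φ v = 0)).card := by
    intro y
    obtain ⟨v0, rfl⟩ := hφ y
    apply Finset.card_bij' (fun v _ => v - v0) (fun v _ => v + v0)
    · intro v hv; simp at hv; simp [hv]
    · intro v hv; simp at hv; simp [hv]
    · intro v hv; simp
    · intro v hv; simp
  set κ := (univ.filter (fun v => φ v = 0)).card with hκ
  have hYcard : Fintype.card (∀ T : D, ((T.1 : Finset (Fin t → ZMod p)) → ZMod p)) = (p ^ j) ^ D.card := by
    simp only [Fintype.card_pi, ZMod.card]
    rw [Finset.prod_congr rfl (g := fun _ => p ^ j)]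
    · simp
    · intro T _
      simp [hj T.1 T.2]
  have htot : p ^ t = (p ^ j) ^ D.card * κ := by
    have := Finset.card_eq_sum_card_fiberwise (s := (univ : Finset (Fin t → ZMod p)))
      (t := (univ : Finset (∀ T : D, ((T.1 : Finset (Fin t → ZMod p)) → ZMod p)))) (f := φ) (by intro _ _; simp)
    rw [Finset.sum_congr rfl (fun y _ => hfib y)] at this
    simpa [hYcard, ZMod.card] using this
  let Z : Finset (∀ T : D, ((T.1 : Finset (Fin t → ZMod p)) → ZMod p)) := Fintype.piFinset (fun T : D => univ.filter (fun g => g ≠ 0))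
  have hZ : Z.card = (p ^ j - 1) ^ D.card := by
    simp only [Z, Fintype.card_piFinset]
    rw [Finset.prod_congr rfl (g := fun _ => p ^ j - 1)]
    · simp
    · intro T _
      rw [Finset.filter_ne', Finset.card_erase_of_mem (mem_univ _)]
      simp [hj T.1 T.2, ZMod.card]
  have hset : (univ.filter (fun v : Fin t → ZMod p => ∀ T ∈ D, ∃ u ∈ T, u ⬝ᵥ v ≠ 0)).card
      ≤ (p ^ j - 1) ^ D.card * κ := by
    have := Finset.card_eq_sum_card_fiberwise
      (s := univ.filter (fun v : Fin t → ZMod p => ∀ T ∈ D, ∃ u ∈ T, u ⬝ᵥ v ≠ 0))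
      (t := Z) (f := φ) (by
        intro v hv
        simp only [coe_filter, mem_univ, true_and, Set.mem_ofPred_eq] at hv
        rw [Finset.mem_coe, Fintype.mem_piFinset]
        intro T
        rw [mem_filter]
        refine ⟨mem_univ _, fun h0 => ?_⟩
        obtain ⟨u, hu, hne⟩ := hv T.1 T.2
        exact hne (congrFun h0 ⟨u, hu⟩))
    rw [this, ← hZ, ← smul_eq_mul, ← Finset.sum_const]
    apply Finset.sum_le_sum
    intro y _
    rw [← hfib y]
    apply Finset.card_le_card
    intro v hv
    simp only [mem_filter, mem_univ, true_and] at hv ⊢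
    exact hv.2
  have hp0 : (0 : ℝ) < (p : ℝ) := by exact_mod_cast (Fact.out : p.Prime).pos
  have hp1 : 1 ≤ p ^ j := Nat.one_le_pow _ _ (Fact.out : p.Prime).pos
  calc _ ≤ (((p ^ j - 1) ^ D.card * κ : ℕ) : ℝ) := by exact_mod_cast hset
    _ = ((p : ℝ) ^ j - 1) ^ D.card * κ := by push_cast [Nat.cast_sub hp1]; ring
    _ = ((p : ℝ) ^ j * (1 - ((p : ℝ) ^ j)⁻¹)) ^ D.card * κ := by
        congr 2; field_simp
    _ = ((p ^ j) ^ D.card * κ : ℕ) * (1 - ((p : ℝ) ^ j)⁻¹) ^ D.card := by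
        push_cast; rw [mul_pow]; ring
    _ = _ := by rw [← htot]; push_cast; ring

lemma str_extend {r : ℕ} {L : Set (Fin t → ZMod p)} {C : Finset (Finset (Fin t → ZMod p))}
    (hC : IsStr r L C) (T : Finset (Fin t → ZMod p)) (hT : T ∈ C ∨ T = ∅)
    (hlev : (C.filter (fun S => S.card = T.card + 1)).card < r)
    (v : Fin t → ZMod p)
    (hv : v ∉ Submodule.span (ZMod p) (↑(C.biUnion id) : Set (Fin t → ZMod p)))
    (hvT : ∀ u ∈ T, u ⬝ᵥ v = 0) :
    Str r (insert v L) ((C.biUnion id).card + 1) := by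
  classical
  obtain ⟨h1, h2, h3, h4⟩ := hC
  have hvU : v ∉ C.biUnion id := fun h => hv (Submodule.subset_span (by simpa using h))
  have hvS : ∀ S ∈ C, v ∉ S := fun S hS h => hvU (mem_biUnion.mpr ⟨S, hS, h⟩)
  have hvT' : v ∉ T := by
    rcases hT with hT | rfl
    · exact hvS T hT
    · simp
  have hTU : T ⊆ C.biUnion id := by
    rcases hT with hT | rfl
    · exact subset_biUnion_of_mem id hT
    · simp
  have hdisj : ∀ S ∈ C, S ≠ T → Disjoint T S := by
    intro S hS hne
    rcases hT with hT | rfl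
    · exact h2 hT hS hne.symm
    · simp
  have hTprop : (T : Set (Fin t → ZMod p)) ⊆ L ∧ Clq T := by
    rcases hT with hT | rfl
    · exact (h1 T hT).2
    · constructor
      · simp
      · intro u hu; simp at hu
  have hU : (insert (insert v T) (C.erase T)).biUnion id = insert v (C.biUnion id) := by
    ext x
    simp only [mem_biUnion, mem_insert, mem_erase, id]
    constructor
    · rintro ⟨S, rfl | ⟨_, hS⟩, hx⟩
      · rcases mem_insert.mp hx with rfl | hx
        · exact Or.inl rfl
        · right
          simpa using hTU hx
      · exact Or.inr ⟨S, hS, hx⟩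
    · rintro (rfl | ⟨S, hS, hx⟩)
      · exact ⟨_, Or.inl rfl, mem_insert_self _ _⟩
      · by_cases hST : S = T
        · exact ⟨_, Or.inl rfl, mem_insert_of_mem (hST ▸ hx)⟩
        · exact ⟨S, Or.inr ⟨hST, hS⟩, hx⟩
  refine ⟨insert (insert v T) (C.erase T), ⟨?_, ?_, ?_, ?_⟩, ?_⟩
  · intro S hS
    rcases mem_insert.mp hS with rfl | hS
    · refine ⟨insert_nonempty _ _, ?_, ?_⟩
      · rw [coe_insert]; exact Set.insert_subset_insert hTprop.1
      · intro u hu w hw hne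
        rcases mem_insert.mp hu with hu' | hu' <;> rcases mem_insert.mp hw with hw' | hw'
        · exact absurd (hu'.trans hw'.symm) hne
        · rw [dotProduct_comm, hu']; exact hvT w hw'
        · rw [hw']; exact hvT u hu'
        · exact hTprop.2 u hu' w hw' hne
    · have := h1 S (mem_of_mem_erase hS)
      exact ⟨this.1, this.2.1.trans (Set.subset_insert _ _), this.2.2⟩
  · rw [coe_insert]
    apply Set.PairwiseDisjoint.insert
    · exact h2.subset (by intro S hS; exact mem_of_mem_erase hS)
    · intro S hS _
      have hS' := mem_erase.mp hS
      simp only [id]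
      rw [disjoint_insert_left]
      exact ⟨hvS S hS'.2, hdisj S hS'.2 hS'.1⟩
  · rw [hU, coe_insert]
    refine LinearIndepOn.insert h3 ?_
    simpa using hv
  · intro j
    rw [filter_insert]
    split_ifs with hj
    · refine (card_insert_le _ _).trans ?_
      rw [card_insert_of_notMem hvT'] at hj
      subst hj
      have : ((C.erase T).filter (fun S => S.card = T.card + 1)).card
          ≤ (C.filter (fun S => S.card = T.card + 1)).card :=
        card_le_card (filter_subset_filter _ (erase_subset _ _))
      omega
    · exact (card_le_card (filter_subset_filter _ (erase_subset _ _))).trans (h4 j)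
  · rw [hU, card_insert_of_notMem hvU]

open Classical in
lemma card_span (U : Finset (Fin t → ZMod p)) (D : ℕ) (hD : U.card ≤ D) :
    (((univ.filter (fun v => v ∈ Submodule.span (ZMod p) (↑U : Set (Fin t → ZMod p)))) :
      Finset (Fin t → ZMod p)).card : ℝ) ≤ (p : ℝ) ^ D := by
  classical
  have h1 : (univ.filter (fun v => v ∈ Submodule.span (ZMod p) (↑U : Set (Fin t → ZMod p)))).card
      = Fintype.card (Submodule.span (ZMod p) (↑U : Set (Fin t → ZMod p))) := by
    rw [Fintype.card_subtype]
  have h2 := Module.card_eq_pow_finrank (K := ZMod p)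
    (V := Submodule.span (ZMod p) (↑U : Set (Fin t → ZMod p)))
  have h3 := finrank_span_finset_le_card (R := ZMod p) U
  have hp : 1 ≤ p := (Fact.out : p.Prime).one_le
  rw [h1, h2, ZMod.card]
  exact_mod_cast Nat.pow_le_pow_right hp (h3.trans hD)

lemma str_step {K r n : ℕ} (hK : 0 < K) (hr : 0 < r) {L : Set (Fin t → ZMod p)}
    (hL : ¬ HasClq K L) (hs : Str r L n) :
    ∃ Sur : Finset (Fin t → ZMod p),
      (Sur.card : ℝ) ≤ (p : ℝ) ^ (K * K * r) + (p : ℝ) ^ t * (1 - ((p : ℝ) ^ K)⁻¹) ^ r ∧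
      ∀ v, v ∉ Sur → Str r (insert v L) (n + 1) := by
  classical
  have hb := str_bound hL hs
  obtain ⟨C, hC, rfl⟩ := hs
  have hp0 : (1 : ℝ) ≤ (p : ℝ) := by exact_mod_cast (Fact.out : p.Prime).one_le
  have hp00 : (0 : ℝ) < (p : ℝ) := by linarith
  have hpK : ((p : ℝ) ^ K)⁻¹ ≤ 1 := inv_le_one_of_one_le₀ (one_le_pow₀ hp0)
  have hnonneg : 0 ≤ (p : ℝ) ^ t * (1 - ((p : ℝ) ^ K)⁻¹) ^ r := by
    apply mul_nonneg (by positivity)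
    apply pow_nonneg; linarith
  have hlevK : ¬ (K = 0 ∨ (C.filter (fun S => S.card = K)).card = r) := by
    rintro (h | h)
    · omega
    · rw [← h, card_pos] at hr
      obtain ⟨T, hT⟩ := hr
      rw [mem_filter] at hT
      exact hL ⟨T, (hC.1 T hT.1).2.1, hT.2, (hC.1 T hT.1).2.2⟩
  have hex : ∃ i, ¬ (i = 0 ∨ (C.filter (fun S => S.card = i)).card = r) := ⟨K, hlevK⟩
  set i := Nat.find hex with hi
  have hi1 := Nat.find_spec hex
  have hiK : i ≤ K := Nat.find_min' hex hlevK
  have hi0 : i ≠ 0 := fun h => hi1 (Or.inl h)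
  obtain ⟨j, hj⟩ := Nat.exists_eq_succ_of_ne_zero hi0
  have hjfull := not_not.mp (Nat.find_min hex (m := j) (by omega))
  have hlev : (C.filter (fun S => S.card = j + 1)).card < r := by
    have := hC.2.2.2 (j + 1)
    have h2 : ¬ (C.filter (fun S => S.card = j + 1)).card = r := by
      intro h; apply hi1; right; rw [← hi, hj]; exact h
    omega
  let SpanU : Finset (Fin t → ZMod p) :=
    univ.filter (fun v => v ∈ Submodule.span (ZMod p) (↑(C.biUnion id) : Set (Fin t → ZMod p)))
  have hSU : (SpanU.card : ℝ) ≤ (p : ℝ) ^ (K * K * r) := card_span _ _ hb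
  by_cases hj0 : j = 0
  · subst hj0
    refine ⟨SpanU, by linarith, fun v hv => ?_⟩
    refine str_extend hC ∅ (Or.inr rfl) (by simpa using hlev) v (by simpa [SpanU] using hv)
      (by simp)
  · have hfull := hjfull.resolve_left hj0
    set D := C.filter (fun S => S.card = j) with hD
    have hDC : D ⊆ C := filter_subset _ _
    have hno := card_nonorth D j (fun T hT => (mem_filter.mp hT).2)
      (hC.2.1.subset (by exact_mod_cast hDC))
      (hC.2.2.1.mono (by exact_mod_cast biUnion_subset_biUnion_of_subset_left id hDC))
    rw [hfull] at hno
    have hmono : (p : ℝ) ^ t * (1 - ((p : ℝ) ^ j)⁻¹) ^ r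
        ≤ (p : ℝ) ^ t * (1 - ((p : ℝ) ^ K)⁻¹) ^ r := by
      have h1 : ((p : ℝ) ^ j)⁻¹ ≤ 1 := inv_le_one_of_one_le₀ (one_le_pow₀ hp0)
      have h2 : ((p : ℝ) ^ K)⁻¹ ≤ ((p : ℝ) ^ j)⁻¹ := by
        apply inv_anti₀ (by positivity)
        exact pow_le_pow_right₀ hp0 (by omega)
      apply mul_le_mul_of_nonneg_left _ (by positivity)
      apply pow_le_pow_left₀ (by linarith)
      linarith
    refine ⟨SpanU ∪ univ.filter (fun v => ∀ T ∈ D, ∃ u ∈ T, u ⬝ᵥ v ≠ 0), ?_, ?_⟩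
    · calc _ ≤ ((SpanU.card +
          (univ.filter (fun v => ∀ T ∈ D, ∃ u ∈ T, u ⬝ᵥ v ≠ 0)).card : ℕ) : ℝ) := by
            exact_mod_cast card_union_le _ _
        _ ≤ _ := by push_cast; linarith
    · intro v hv
      simp only [mem_union, not_or, mem_filter, mem_univ, true_and, SpanU] at hv
      obtain ⟨hv1, hv2⟩ := hv
      push Not at hv2
      obtain ⟨T, hT, hvT⟩ := hv2
      have hT' := mem_filter.mp hT
      refine str_extend hC T (Or.inl hT'.1) ?_ v hv1 hvT
      rw [hT'.2]; exact hlev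

open Classical in
/-- counting clique-free tuples -/
lemma count_free {K r : ℕ} (hK : 0 < K) (hr : 0 < r) (S : ℝ) (hS0 : 0 < S)
    (hSM : S ≤ (p : ℝ) ^ t)
    (hS : (p : ℝ) ^ (K * K * r) + (p : ℝ) ^ t * (1 - ((p : ℝ) ^ K)⁻¹) ^ r ≤ S) (n : ℕ) :
    ∀ (L : Set (Fin t → ZMod p)) (j a : ℕ), Str r L j → j + a = K * K * r →
      ((univ.filter (fun x : Fin n → (Fin t → ZMod p) =>
        ¬ HasClq K (L ∪ Set.range x))).card : ℝ) * S ^ a ≤ (2 * S) ^ n * ((p : ℝ) ^ t) ^ a := by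
  have hp0 : (0 : ℝ) < (p : ℝ) := by exact_mod_cast (Fact.out : p.Prime).pos
  induction n with
  | zero =>
    intro L j a _ _
    have h1 : ((univ.filter (fun x : Fin 0 → (Fin t → ZMod p) =>
        ¬ HasClq K (L ∪ Set.range x))).card : ℝ) ≤ 1 := by
      exact_mod_cast (card_filter_le _ _).trans (by simp)
    have h2 : S ^ a ≤ ((p : ℝ) ^ t) ^ a := pow_le_pow_left₀ hS0.le hSM a
    have h3 : 0 < S ^ a := by positivity
    simp only [pow_zero, one_mul]
    nlinarith
  | succ n ih =>
    intro L j a hstr hja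
    by_cases hL : HasClq K L
    · have : (univ.filter (fun x : Fin (n + 1) → (Fin t → ZMod p) =>
        ¬ HasClq K (L ∪ Set.range x))) = ∅ := by
        apply filter_eq_empty_iff.mpr
        intro x _ h
        exact h (hL.mono Set.subset_union_left)
      rw [this]
      simp only [card_empty, Nat.cast_zero, zero_mul]
      positivity
    obtain ⟨Sur, hSur, hstep⟩ := str_step hK hr hL hstr
    have hcount : ((univ.filter (fun x : Fin (n + 1) → (Fin t → ZMod p) =>
        ¬ HasClq K (L ∪ Set.range x))).card : ℝ) = ∑ v : Fin t → ZMod p,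
        ((univ.filter (fun x : Fin n → (Fin t → ZMod p) =>
        ¬ HasClq K (insert v L ∪ Set.range x))).card : ℝ) := by
      rw [← Nat.cast_sum]
      congr 1
      rw [Finset.card_eq_sum_card_fiberwise (f := fun x => x 0) (t := univ) (by intro _ _; simp)]
      apply sum_congr rfl
      intro v _
      have hset : ∀ y : Fin n → (Fin t → ZMod p),
          L ∪ Set.range (Fin.cons v y : Fin (n + 1) → (Fin t → ZMod p))
            = insert v L ∪ Set.range y := by
        intro y
        rw [Fin.range_cons]
        ext z; simp only [Set.mem_union, Set.mem_insert_iff]; tauto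
      refine Finset.card_bij' (fun x _ => Fin.tail x) (fun y _ => Fin.cons v y) ?_ ?_ ?_ ?_
      · intro x hx
        simp only [mem_filter, mem_univ, true_and] at hx ⊢
        rw [← hset, ← hx.2, Fin.cons_self_tail]
        exact hx.1
      · intro y hy
        simp only [mem_filter, mem_univ, true_and] at hy ⊢
        rw [hset]
        exact ⟨hy, by simp⟩
      · intro x hx
        simp only [mem_filter, mem_univ, true_and] at hx
        rw [← hx.2, Fin.cons_self_tail]
      · intro y hy; simp
    set M := (p : ℝ) ^ t with hM
    have hM0 : 0 < M := by positivity
    have hgen : ∀ v, ((univ.filter (fun x : Fin n → (Fin t → ZMod p) =>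
        ¬ HasClq K (insert v L ∪ Set.range x))).card : ℝ) * S ^ a * M ≤
        (2 * S) ^ n * M ^ a * (S + (if v ∈ Sur then M else 0)) := by
      intro v
      split_ifs with hv
      · have := ih (insert v L) j a (hstr.mono (Set.subset_insert _ _)) hja
        have hpos : 0 ≤ (2 * S) ^ n * M ^ a := by positivity
        nlinarith
      · by_cases hcl : HasClq K (insert v L)
        · have : (univ.filter (fun x : Fin n → (Fin t → ZMod p) =>
            ¬ HasClq K (insert v L ∪ Set.range x))) = ∅ := by
            apply filter_eq_empty_iff.mpr
            intro x _ h
            exact h (hcl.mono Set.subset_union_left)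
          rw [this]
          simp only [card_empty, Nat.cast_zero, zero_mul]
          positivity
        · have hs := hstep v hv
          have hb := str_bound hcl hs
          obtain ⟨a', rfl⟩ : ∃ a', a = a' + 1 := ⟨a - 1, by omega⟩
          have := ih (insert v L) (j + 1) a' hs (by omega)
          rw [pow_succ, pow_succ]
          have h3 : 0 < S * M := by positivity
          calc _ = _ * S ^ a' * (S * M) := by ring
            _ ≤ ((2 * S) ^ n * M ^ a') * (S * M) := mul_le_mul_of_nonneg_right this h3.le
            _ = _ := by ring
    have hcardV : (Fintype.card (Fin t → ZMod p) : ℝ) = M := by simp [hM, ZMod.card]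
    have hsum : (∑ v : Fin t → ZMod p, (S + (if v ∈ Sur then M else 0))) = M * S + Sur.card * M := by
      rw [sum_add_distrib, sum_const, nsmul_eq_mul, ← Finset.sum_filter]
      simp only [Finset.filter_univ_mem, sum_const, nsmul_eq_mul, card_univ, hcardV]
    rw [hcount]
    have hfin : (∑ v : Fin t → ZMod p,
        ((univ.filter (fun x : Fin n → (Fin t → ZMod p) =>
        ¬ HasClq K (insert v L ∪ Set.range x))).card : ℝ)) * S ^ a * M
        ≤ (2 * S) ^ (n + 1) * M ^ a * M := by
      rw [sum_mul, sum_mul]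
      refine (sum_le_sum (fun v _ => hgen v)).trans ?_
      rw [← mul_sum, hsum, pow_succ]
      have hpos : 0 ≤ (2 * S) ^ n * M ^ a * M := by positivity
      have : (Sur.card : ℝ) ≤ S := hSur.trans hS
      nlinarith
    exact le_of_mul_le_mul_right hfin hM0

lemma str_empty (r : ℕ) : Str r (∅ : Set (Fin t → ZMod p)) 0 := by
  refine ⟨∅, ⟨by simp, by simp, ?_, by simp⟩, by simp⟩
  simp

open Classical in
lemma free_bound {K r n : ℕ} (hK : 0 < K) (hr : 0 < r) (ht : t = K * K * r + K * K * r)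
    (hq : 2 * (1 - ((p : ℝ) ^ K)⁻¹) ^ r ≤ 1) (hn : 2 * (K * K * r) ≤ n) :
    ((univ.filter (fun x : Fin n → (Fin t → ZMod p) =>
        ¬ HasClq K (Set.range x))).card : ℝ) ^ 2 ≤
      (16 * ((p : ℝ) ^ t) ^ 2 * (1 - ((p : ℝ) ^ K)⁻¹) ^ r) ^ n := by
  have hp2 : (2 : ℝ) ≤ (p : ℝ) := by exact_mod_cast (Fact.out : p.Prime).two_le
  have hpK : (2 : ℝ) ≤ (p : ℝ) ^ K := hp2.trans (le_self_pow₀ (by linarith) hK.ne')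
  set q := 1 - ((p : ℝ) ^ K)⁻¹ with hqd
  have hq0 : 0 < q := by
    have : ((p : ℝ) ^ K)⁻¹ ≤ 2⁻¹ := inv_anti₀ (by norm_num) hpK
    rw [hqd]; norm_num at this ⊢; linarith
  have hq1 : q ≤ 1 := by
    have : 0 ≤ ((p : ℝ) ^ K)⁻¹ := by positivity
    rw [hqd]; linarith
  set D := K * K * r with hD
  set M := (p : ℝ) ^ t with hM
  have hM0 : 0 < M := by positivity
  have hpq : (p : ℝ) ^ D ≤ M * q ^ r := by
    rw [hM, ht, pow_add, mul_assoc]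
    apply le_mul_of_one_le_right (by positivity)
    rw [hD, pow_mul, ← mul_pow]
    apply one_le_pow₀
    have h1 : (p : ℝ) ^ K ≤ (p : ℝ) ^ (K * K) :=
      pow_le_pow_right₀ (by linarith) (Nat.le_mul_of_pos_left K hK)
    have h2 : (p : ℝ) ^ K * q = (p : ℝ) ^ K - 1 := by
      rw [hqd, mul_sub, mul_inv_cancel₀ (by positivity)]; ring
    nlinarith
  have hqr : 0 < q ^ r := by positivity
  have h := count_free (p := p) (t := t) hK hr (2 * (M * q ^ r)) (by positivity)
    (by rw [← hM]; nlinarith) (by rw [← hM, ← hqd, ← hD]; linarith) n ∅ 0 D (str_empty r)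
    (by rw [zero_add])
  simp only [Set.empty_union] at h
  rw [← hM] at h
  set G := ((univ.filter (fun x : Fin n → (Fin t → ZMod p) =>
        ¬ HasClq K (Set.range x))).card : ℝ) with hG
  have hG0 : 0 ≤ G := by positivity
  have h1 : G * (q ^ r) ^ D ≤ (4 * M * q ^ r) ^ n := by
    have hMD : 0 < M ^ D := by positivity
    apply le_of_mul_le_mul_right _ hMD
    calc G * (q ^ r) ^ D * M ^ D = G * (M * q ^ r) ^ D := by rw [mul_pow]; ring
      _ ≤ G * (2 * (M * q ^ r)) ^ D := by
          apply mul_le_mul_of_nonneg_left _ hG0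
          apply pow_le_pow_left₀ (by positivity)
          have : 0 < M * q ^ r := by positivity
          linarith
      _ ≤ _ := h
      _ = _ := by ring
  have h2 : (q ^ r) ^ n ≤ ((q ^ r) ^ D) ^ 2 := by
    rw [← pow_mul (q ^ r)]
    exact pow_le_pow_of_le_one hqr.le (pow_le_one₀ hq0.le hq1) (by omega)
  have h3 : 0 < (q ^ r) ^ n := by positivity
  apply le_of_mul_le_mul_right _ h3
  calc G ^ 2 * (q ^ r) ^ n ≤ G ^ 2 * ((q ^ r) ^ D) ^ 2 := by gcongr
    _ = (G * (q ^ r) ^ D) ^ 2 := by ring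
    _ ≤ ((4 * M * q ^ r) ^ n) ^ 2 := by gcongr
    _ = ((4 * M * q ^ r) ^ 2) ^ n := pow_right_comm _ _ _
    _ = (16 * M ^ 2 * q ^ r) ^ n * (q ^ r) ^ n := by rw [← mul_pow]; ring

/-- non-self-orthogonal vectors -/
abbrev Qs (p t : ℕ) : Type := {v : Fin t → ZMod p // v ⬝ᵥ v ≠ 0}

open Classical in
lemma card_Q (ht : 0 < t) : p ^ t ≤ Fintype.card (Qs p t) * p := by
  let i0 : Fin t := ⟨0, ht⟩
  have hupd : ∀ v : Fin t → ZMod p, Function.update v i0 1 ⬝ᵥ Function.update v i0 1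
      = Function.update v i0 0 ⬝ᵥ Function.update v i0 0 + 1 := by
    intro v
    simp only [dotProduct]
    rw [← Finset.add_sum_erase univ _ (mem_univ i0),
      ← Finset.add_sum_erase univ (fun i => Function.update v i0 0 i * Function.update v i0 0 i)
        (mem_univ i0)]
    have : ∀ c : ZMod p, ∑ i ∈ univ.erase i0, Function.update v i0 c i * Function.update v i0 c i
        = ∑ i ∈ univ.erase i0, v i * v i := by
      intro c
      apply sum_congr rfl
      intro i hi
      rw [Function.update_of_ne (ne_of_mem_erase hi)]
    rw [this 1, this 0]
    simp; ring
  have hex : ∀ v : Fin t → ZMod p, ∃ c : ZMod p,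
      Function.update v i0 c ⬝ᵥ Function.update v i0 c ≠ 0 := by
    intro v
    by_cases h : Function.update v i0 0 ⬝ᵥ Function.update v i0 0 = 0
    · refine ⟨1, ?_⟩
      rw [hupd, h]; simp
    · exact ⟨0, h⟩
  choose c hc using hex
  have := Fintype.card_le_of_injective
    (fun v : Fin t → ZMod p => ((⟨Function.update v i0 (c v), hc v⟩, v i0) : Qs p t × ZMod p)) (by
      intro v v' h
      simp only [Prod.mk.injEq, Subtype.mk.injEq] at h
      funext i
      by_cases hi : i = i0
      · rw [hi]; exact h.2
      · have := congrFun h.1 i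
        simpa [Function.update_of_ne hi] using this)
  simpa [ZMod.card] using this

lemma exists_family {K r n m N : ℕ} (hK : 0 < K) (hr : 0 < r) (ht : t = K * K * r + K * K * r)
    (hq : 2 * (1 - ((p : ℝ) ^ K)⁻¹) ^ r ≤ 1) (hn : 2 * (K * K * r) ≤ n)
    (hN : (N : ℝ) ^ 2 * (16 * (p : ℝ) ^ 2 * (1 - ((p : ℝ) ^ K)⁻¹) ^ r) ^ m < 1) :
    ∃ w : Fin N → Fin m → (Fin t → ZMod p), (∀ a i, w a i ⬝ᵥ w a i ≠ 0) ∧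
      ∀ g : Fin n → Fin N, Function.Injective g →
        ∃ i, HasClq K (Set.range (fun j => w (g j) i)) := by
  classical
  have hp2 : (2 : ℝ) ≤ (p : ℝ) := by exact_mod_cast (Fact.out : p.Prime).two_le
  have hpK : (2 : ℝ) ≤ (p : ℝ) ^ K := hp2.trans (le_self_pow₀ (by linarith) hK.ne')
  have ht0 : 0 < t := by rw [ht]; positivity
  have hfree := free_bound (p := p) (t := t) hK hr ht hq hn
  have hQ := card_Q (p := p) ht0
  set q := 1 - ((p : ℝ) ^ K)⁻¹ with hqd
  have hq0 : 0 < q := by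
    have : ((p : ℝ) ^ K)⁻¹ ≤ 2⁻¹ := inv_anti₀ (by norm_num) hpK
    rw [hqd]; norm_num at this ⊢; linarith
  set CF := univ.filter (fun x : Fin n → (Fin t → ZMod p) => ¬ HasClq K (Set.range x)) with hCF
  have hQpos : 0 < Fintype.card (Qs p t) := by
    by_contra h
    have h0 : Fintype.card (Qs p t) = 0 := by omega
    rw [h0, zero_mul] at hQ
    have : 0 < p ^ t := pow_pos (Fact.out : p.Prime).pos _
    omega
  have : Nonempty (Qs p t) := Fintype.card_pos_iff.mp hQpos
  let Bad : Finset (Fin n → (Fin m → Qs p t)) :=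
    univ.filter (fun w => ∀ i, (fun j => (w j i).1) ∈ CF)
  have hBad : Bad.card ≤ CF.card ^ m := by
    have : Bad.card ≤ (Fintype.piFinset (fun _ : Fin m => CF)).card := by
      apply Finset.card_le_card_of_injOn (fun w i j => (w j i).1)
      · intro w hw
        rw [Finset.mem_coe, Fintype.mem_piFinset]
        exact (mem_filter.mp hw).2
      · intro w _ w' _ h
        funext j i
        exact Subtype.ext (congrFun (congrFun h i) j)
    simpa using this
  have hn0 : n ≠ 0 := by
    have : 0 < K * K * r := by positivity
    omega
  have hlt : N ^ n * Bad.card < (Fintype.card (Fin m → Qs p t)) ^ n := by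
    refine (Nat.mul_le_mul_left _ hBad).trans_lt ?_
    rw [Fintype.card_fun, Fintype.card_fin]
    have hreal : (((N : ℝ) ^ n * (CF.card : ℝ) ^ m)) ^ 2 <
        (((Fintype.card (Qs p t) : ℝ) ^ m) ^ n) ^ 2 := by
      set M := (p : ℝ) ^ t with hM
      have hQr : M ≤ (Fintype.card (Qs p t) : ℝ) * p := by
        rw [hM]; exact_mod_cast hQ
      set Q := (Fintype.card (Qs p t) : ℝ) with hQd
      have hQ0 : 0 < Q := by rw [hQd]; exact_mod_cast hQpos
      have hM0 : 0 < M := by positivity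
      calc ((N : ℝ) ^ n * (CF.card : ℝ) ^ m) ^ 2
          = ((N : ℝ) ^ 2) ^ n * ((CF.card : ℝ) ^ 2) ^ m := by
            rw [mul_pow]; congr 1 <;> rw [← pow_mul, ← pow_mul, mul_comm]
        _ ≤ ((N : ℝ) ^ 2) ^ n * ((16 * M ^ 2 * q ^ r) ^ n) ^ m := by
            gcongr
        _ = ((N : ℝ) ^ 2 * (16 * M ^ 2 * q ^ r) ^ m) ^ n := by
            rw [pow_right_comm _ n m, ← mul_pow]
        _ ≤ ((N : ℝ) ^ 2 * (16 * (Q * p) ^ 2 * q ^ r) ^ m) ^ n := by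
            gcongr
        _ = (((N : ℝ) ^ 2 * (16 * (p : ℝ) ^ 2 * q ^ r) ^ m) * (Q ^ m) ^ 2) ^ n := by
            congr 1
            have : 16 * (Q * p) ^ 2 * q ^ r = (16 * (p : ℝ) ^ 2 * q ^ r) * Q ^ 2 := by ring
            rw [this, mul_pow _ (Q ^ 2), ← pow_mul Q, ← pow_mul Q, mul_comm 2 m]; ring
        _ < (1 * (Q ^ m) ^ 2) ^ n := by
            gcongr
        _ = _ := by rw [one_mul, ← pow_mul, ← pow_mul, ← pow_mul, ← pow_mul]; congr 1; ring
    have := lt_of_pow_lt_pow_left₀ 2 (by positivity) hreal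
    exact_mod_cast this
  obtain ⟨w, hw⟩ := count_avoid n N Bad hlt
  refine ⟨fun a i => (w a i).1, fun a i => (w a i).2, fun g hg => ?_⟩
  have := hw g hg
  simp only [Bad, mem_filter, mem_univ, true_and, not_forall, hCF, not_not] at this
  exact this

end

/-- tensor product vector, padded to dimension `d` -/
noncomputable def tens {F : Type} [Field F] {m t d : ℕ} (e : (Fin m → Fin t) → Fin d)
    (u : Fin m → Fin t → F) : Fin d → F :=
  Function.extend e (fun a => ∏ i, u i (a i)) 0

lemma tens_dot {F : Type} [Field F] {m t d : ℕ} (e : (Fin m → Fin t) → Fin d)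
    (he : Function.Injective e) (u v : Fin m → Fin t → F) :
    ∑ x, tens e u x * tens e v x = ∏ i, (u i ⬝ᵥ v i) := by
  classical
  have h1 : ∑ x, tens e u x * tens e v x = ∑ a, tens e u (e a) * tens e v (e a) := by
    rw [← Finset.sum_image (s := univ) (g := e) (f := fun x => tens e u x * tens e v x)
      (fun a _ b _ h => he h)]
    symm
    apply Finset.sum_subset (subset_univ _)
    intro x _ hx
    have : ¬ ∃ a, e a = x := by
      rintro ⟨a, rfl⟩
      exact hx (mem_image_of_mem _ (mem_univ _))
    simp [tens, Function.extend_apply' _ _ _ this]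
  rw [h1]
  simp only [tens, he.extend_apply, dotProduct]
  rw [Finset.prod_univ_sum]
  simp [Finset.prod_mul_distrib]

lemma exists_set {p : ℕ} [Fact p.Prime] {F : Type} [Field F] [CharP F p] {K k m N t d : ℕ}
    (hK : 2 ≤ K) (htd : t ^ m ≤ d)
    (w : Fin N → Fin m → (Fin t → ZMod p)) (hw : ∀ a i, w a i ⬝ᵥ w a i ≠ 0)
    (hg : ∀ g : Fin (k + 1) → Fin N, Function.Injective g →
        ∃ i, HasClq K (Set.range (fun j => w (g j) i))) :
    ∃ A : Finset (Fin d → F), N ≤ k * A.card ∧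
      (∀ v ∈ A, ∑ i, v i * v i ≠ 0) ∧
      (∀ S ⊆ A, S.card = k + 1 →
        ∃ T ⊆ S, T.card = K ∧ ∀ u ∈ T, ∀ v ∈ T, u ≠ v → ∑ i, u i * v i = 0) := by
  classical
  let φ := ZMod.castHom (dvd_refl p) F
  let e : (Fin m → Fin t) → Fin d := fun a => Fin.castLE htd (finFunctionFinEquiv a)
  have he : Function.Injective e := fun a b h =>
    finFunctionFinEquiv.injective (Fin.castLE_injective htd h)
  let z : Fin N → (Fin d → F) := fun a => tens e (fun i x => φ (w a i x))
  have hz : ∀ a b, ∑ x, z a x * z b x = φ (∏ i, (w a i ⬝ᵥ w b i)) := by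
    intro a b
    simp only [z]
    rw [tens_dot e he, map_prod]
    simp [dotProduct, map_sum]
  have hself : ∀ a, ∑ x, z a x * z a x ≠ 0 := by
    intro a
    rw [hz, Ne, map_eq_zero]
    exact Finset.prod_ne_zero_iff.mpr (fun i _ => hw a i)
  -- cliques of indices
  have hcl : ∀ g : Fin (k + 1) → Fin N, Function.Injective g →
      ∃ J : Finset (Fin (k + 1)), J.card = K ∧
        ∀ a ∈ J, ∀ b ∈ J, a ≠ b → ∑ x, z (g a) x * z (g b) x = 0 := by
    intro g hgi
    obtain ⟨i, T, hTr, hTc, hT⟩ := hg g hgi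
    have hch : ∀ u : T, ∃ j, w (g j) i = u.1 := fun u => hTr u.2
    choose f hf using hch
    have hfi : Function.Injective f := by
      intro u v h
      apply Subtype.ext
      rw [← hf u, ← hf v, h]
    refine ⟨univ.image f, ?_, ?_⟩
    · rw [card_image_of_injective _ hfi]; simpa using hTc
    · intro a ha b hb hab
      obtain ⟨u, -, rfl⟩ := mem_image.mp ha
      obtain ⟨v, -, rfl⟩ := mem_image.mp hb
      rw [hz, map_eq_zero]
      apply Finset.prod_eq_zero (mem_univ i)
      rw [hf u, hf v]
      exact hT u.1 u.2 v.1 v.2 (fun h => hab (by rw [Subtype.ext h]))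
  refine ⟨univ.image z, ?_, ?_, ?_⟩
  · have := Finset.card_le_mul_card_image (f := z) (univ : Finset (Fin N)) k (by
      intro v _
      by_contra hlt
      push Not at hlt
      obtain ⟨P, hP, hPc⟩ := Finset.exists_subset_card_eq (Nat.succ_le_of_lt hlt)
      let g : Fin (k + 1) → Fin N := fun j => (P.equivFinOfCardEq hPc).symm j
      have hgi : Function.Injective g :=
        Subtype.val_injective.comp (P.equivFinOfCardEq hPc).symm.injective
      have hgv : ∀ j, z (g j) = v := fun j =>
        (mem_filter.mp (hP ((P.equivFinOfCardEq hPc).symm j).2)).2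
      obtain ⟨J, hJ, hJ2⟩ := hcl g hgi
      obtain ⟨a, ha, b, hb, hab⟩ := Finset.one_lt_card.mp (show 1 < J.card by omega)
      have h0 := hJ2 a ha b hb hab
      rw [hgv b, ← hgv a] at h0
      exact hself _ h0)
    simpa using this
  · intro v hv
    obtain ⟨a, -, rfl⟩ := mem_image.mp hv
    exact hself a
  · intro S hS hSc
    have hch : ∀ s : S, ∃ a, z a = s.1 := fun s => by
      obtain ⟨a, -, ha⟩ := mem_image.mp (hS s.2)
      exact ⟨a, ha⟩
    choose f hf using hch
    let g : Fin (k + 1) → Fin N := fun j => f ((S.equivFinOfCardEq hSc).symm j)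
    have hgz : ∀ j, z (g j) = ((S.equivFinOfCardEq hSc).symm j).1 := fun j => hf _
    have hzi : Function.Injective (fun j => z (g j)) := by
      intro a b h
      simp only [hgz] at h
      exact (S.equivFinOfCardEq hSc).symm.injective (Subtype.ext h)
    have hgi : Function.Injective g := fun a b h => hzi (by simp only [h])
    obtain ⟨J, hJ, hJ2⟩ := hcl g hgi
    refine ⟨J.image (fun j => z (g j)), ?_, ?_, ?_⟩
    · intro x hx
      obtain ⟨j, -, rfl⟩ := mem_image.mp hx
      rw [hgz]
      exact ((S.equivFinOfCardEq hSc).symm j).2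
    · rw [card_image_of_injective _ hzi, hJ]
    · intro u hu v hv huv
      obtain ⟨a, ha, rfl⟩ := mem_image.mp hu
      obtain ⟨b, hb, rfl⟩ := mem_image.mp hv
      exact hJ2 a ha b hb (fun h => huv (by rw [h]))

lemma final_est {η : ℝ} (hη : 1 < η) {K r k d m : ℕ} (hK : 0 < K) (hr : 0 < r)
    (hm : 0 < m) (hk2 : 2 ≤ k) (hkd : k ≤ d)
    (hkr : k ≤ 4 * (K * K) * r) (hdm : d < k ^ (m + 1)) {δ : ℝ} (hδ0 : 0 < δ)
    (hδ : δ ≤ Real.log η / (8 * (K * K))) :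
    (d : ℝ) ^ (δ * k / Real.logb 2 k) ≤ (η ^ r) ^ m := by
  have hd0 : (0 : ℝ) < d := by exact_mod_cast (by omega : 0 < d)
  have hk0 : (0 : ℝ) < k := by exact_mod_cast (by omega : 0 < k)
  have hk1 : (1 : ℝ) < k := by exact_mod_cast (by omega : 1 < k)
  have hK0 : (0 : ℝ) < K := by exact_mod_cast hK
  have hη0 : 0 < η := by linarith
  have hlk : 0 < Real.log k := Real.log_pos hk1
  have hl2 : 0 < Real.log 2 := Real.log_pos (by norm_num)
  have hl21 : Real.log 2 ≤ 1 := by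
    have := Real.log_le_sub_one_of_pos (show (0 : ℝ) < 2 by norm_num); linarith
  have hlη : 0 < Real.log η := Real.log_pos hη
  have hlogd : Real.log d ≤ (m + 1) * Real.log k := by
    have : (d : ℝ) ≤ (k : ℝ) ^ (m + 1) := by exact_mod_cast hdm.le
    have := Real.log_le_log hd0 this
    rw [Real.log_pow] at this
    exact_mod_cast this
  have hm1 : (1 : ℝ) ≤ m := by exact_mod_cast hm
  have hkr' : (k : ℝ) ≤ 4 * (K * K) * r := by exact_mod_cast hkr
  rw [← Real.log_le_log_iff (by positivity) (by positivity), Real.log_rpow hd0, Real.log_pow,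
    Real.log_pow]
  have hexp : δ * k / Real.logb 2 k * Real.log d = δ * k * Real.log 2 * (Real.log d / Real.log k) := by
    rw [Real.logb]; field_simp
  rw [hexp]
  have h1 : Real.log d / Real.log k ≤ 2 * m := by
    rw [div_le_iff₀ hlk]; nlinarith
  have h2 : δ * (8 * (K * K)) ≤ Real.log η := by
    rwa [le_div_iff₀ (by positivity)] at hδ
  calc δ * k * Real.log 2 * (Real.log d / Real.log k)
      ≤ δ * k * Real.log 2 * (2 * m) := by gcongr
    _ ≤ δ * k * 1 * (2 * m) := by gcongr
    _ ≤ δ * (4 * (K * K) * r) * 1 * (2 * m) := by gcongr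
    _ = (δ * (8 * (K * K))) * (m * r) := by ring
    _ ≤ Real.log η * (m * r) := by gcongr
    _ = _ := by ring

lemma main_large {p : ℕ} [Fact p.Prime] {F : Type} [Field F] [CharP F p] {K k d r : ℕ}
    (hK : 2 ≤ K) {η : ℝ} (hη : 1 < η) (hη8 : η ^ 8 = (1 - ((p : ℝ) ^ K)⁻¹)⁻¹)
    (hr : 0 < r) (hr1 : 2 * (K * K) * r ≤ k) (hr2 : k < 2 * (K * K) * (r + 1))
    (hbig : (4 * (K * K) + 16 * (p : ℝ) ^ 2) * r ≤ η ^ r) (hkd : k ≤ d)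
    {δ : ℝ} (hδ0 : 0 < δ) (hδ : δ ≤ Real.log η / (8 * (K * K))) :
    ∃ A : Finset (Fin d → F),
            (d : ℝ) ^ (δ * k / Real.logb 2 k) ≤ (A.card : ℝ) ∧
            (∀ v ∈ A, ∑ i, v i * v i ≠ 0) ∧
            (∀ S ⊆ A, S.card = k + 1 →
              ∃ T ⊆ S, T.card = K ∧
                ∀ u ∈ T, ∀ v ∈ T, u ≠ v → ∑ i, u i * v i = 0) := by
  have hp2 : (2 : ℝ) ≤ (p : ℝ) := by exact_mod_cast (Fact.out : p.Prime).two_le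
  set q := 1 - ((p : ℝ) ^ K)⁻¹ with hqd
  have hKK : 4 ≤ K * K := by nlinarith
  have hr1' : (1 : ℝ) ≤ r := by exact_mod_cast hr
  set E := η ^ r with hE
  have hKr : (0 : ℝ) ≤ K * K := by positivity
  have hKK4 : (4 : ℝ) ≤ K * K := by exact_mod_cast hKK
  have hE16 : 16 * (p : ℝ) ^ 2 < E := by
    have h1 : (0 : ℝ) ≤ 4 * (K * K) + 16 * (p : ℝ) ^ 2 := by positivity
    have h2 := le_mul_of_one_le_right h1 hr1'
    linarith
  have hE2 : 2 < E := by nlinarith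
  have hEk : (k : ℝ) + 1 ≤ E := by
    have h1 : (k : ℝ) + 1 ≤ 2 * (K * K) * (r + 1) := by exact_mod_cast hr2
    nlinarith [sq_nonneg (p : ℝ)]
  have hkr : k ≤ 4 * (K * K) * r := by nlinarith
  set t := K * K * r + K * K * r with ht
  have htk : t ≤ k := by rw [ht]; linarith
  have ht2 : 2 ≤ t := by rw [ht]; nlinarith
  have hd0 : d ≠ 0 := by omega
  set m := Nat.log t d with hm
  have hm0 : 0 < m := Nat.log_pos (by omega) (by omega)
  have htd : t ^ m ≤ d := Nat.pow_log_le_self t hd0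
  have hdt : d < k ^ (m + 1) :=
    (Nat.lt_pow_succ_log_self (by omega) d).trans_le (Nat.pow_le_pow_left htk _)
  have hE0 : 0 < E := by linarith
  have hqr : q ^ r = (E ^ 8)⁻¹ := by
    rw [hE, pow_right_comm, hη8, inv_pow, inv_inv]
  set N := ⌊(E ^ m) ^ 2⌋₊ with hN
  have hNle : (N : ℝ) ≤ (E ^ m) ^ 2 := Nat.floor_le (by positivity)
  have hNlt : (E ^ m) ^ 2 < N + 1 := Nat.lt_floor_add_one _
  have hE8 : E ≤ E ^ 8 := le_self_pow₀ (by linarith) (by norm_num)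
  obtain ⟨w, hw, hg⟩ := exists_family (p := p) (t := t) (K := K) (r := r) (n := k + 1) (m := m)
    (N := N) (by omega) hr rfl (by
      rw [← hqd, hqr]
      rw [mul_inv_le_iff₀ (by positivity)]; linarith) (by linarith) (by
      rw [← hqd, hqr]
      have hlt : 16 * (p : ℝ) ^ 2 * (E ^ 8)⁻¹ < (E ^ 4)⁻¹ := by
        have hE4 : E ≤ E ^ 4 := le_self_pow₀ (by linarith) (by norm_num)
        calc 16 * (p : ℝ) ^ 2 * (E ^ 8)⁻¹ < E ^ 4 * (E ^ 8)⁻¹ := by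
              gcongr; linarith
          _ = (E ^ 4)⁻¹ := by field_simp
      calc (N : ℝ) ^ 2 * (16 * (p : ℝ) ^ 2 * (E ^ 8)⁻¹) ^ m
          ≤ ((E ^ m) ^ 2) ^ 2 * (16 * (p : ℝ) ^ 2 * (E ^ 8)⁻¹) ^ m := by gcongr
        _ < ((E ^ m) ^ 2) ^ 2 * ((E ^ 4)⁻¹) ^ m := by gcongr
        _ = 1 := by
          rw [inv_pow, ← pow_mul (E ^ m), pow_right_comm E m]
          exact mul_inv_cancel₀ (by positivity))
  obtain ⟨A, hA1, hA2, hA3⟩ := exists_set (F := F) (d := d) hK htd w hw hg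
  refine ⟨A, ?_, hA2, hA3⟩
  refine (final_est hη (by omega) hr hm0 (by omega) hkd hkr hdt hδ0 hδ).trans ?_
  rw [← hE]
  have hEm : E ≤ E ^ m := le_self_pow₀ (by linarith) hm0.ne'
  have hA1' : (N : ℝ) ≤ k * A.card := by exact_mod_cast hA1
  have hk0 : (0 : ℝ) < k := by exact_mod_cast (by omega : 0 < k)
  have : (k : ℝ) * E ^ m ≤ k * A.card := by nlinarith
  exact le_of_mul_le_mul_left this hk0

lemma main_small {F : Type} [Field F] {K k d K0 : ℕ} (hk2 : 2 ≤ k)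
    (hKk : K ≤ k + 1) (hkd : k ≤ d) (hkK : k ≤ K0) {δ : ℝ} (hδ0 : 0 < δ)
    (hδ : δ * K0 ≤ 1) :
    ∃ A : Finset (Fin d → F),
            (d : ℝ) ^ (δ * k / Real.logb 2 k) ≤ (A.card : ℝ) ∧
            (∀ v ∈ A, ∑ i, v i * v i ≠ 0) ∧
            (∀ S ⊆ A, S.card = k + 1 →
              ∃ T ⊆ S, T.card = K ∧
                ∀ u ∈ T, ∀ v ∈ T, u ≠ v → ∑ i, u i * v i = 0) := by
  classical
  let f : Fin d → (Fin d → F) := fun i => Pi.single i 1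
  have hf : Function.Injective f := fun i j h => by
    by_contra hne
    have := congrFun h i
    simp [f, Pi.single_apply, hne] at this
  refine ⟨univ.image f, ?_, ?_, ?_⟩
  · rw [card_image_of_injective _ hf, card_univ, Fintype.card_fin]
    have hd1 : (1 : ℝ) ≤ d := by exact_mod_cast (by omega : 1 ≤ d)
    have hlog : 1 ≤ Real.logb 2 k := by
      rw [Real.le_logb_iff_rpow_le (by norm_num) (by positivity)]
      simpa using (by exact_mod_cast hk2 : (2 : ℝ) ≤ k)
    have hkK' : (k : ℝ) ≤ K0 := by exact_mod_cast hkK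
    have hle : δ * k / Real.logb 2 k ≤ 1 := by
      rw [div_le_one (by linarith)]
      nlinarith
    calc (d : ℝ) ^ (δ * k / Real.logb 2 k) ≤ (d : ℝ) ^ (1 : ℝ) :=
          Real.rpow_le_rpow_of_exponent_le hd1 hle
      _ = d := Real.rpow_one _
  · intro v hv
    obtain ⟨i, -, rfl⟩ := mem_image.mp hv
    simp [f, Pi.single_apply]
  · intro S hS hSc
    obtain ⟨T, hT, hTc⟩ := Finset.exists_subset_card_eq (show K ≤ S.card by omega)
    refine ⟨T, hT, hTc, ?_⟩
    intro u hu v hv huv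
    obtain ⟨i, -, rfl⟩ := mem_image.mp (hS (hT hu))
    obtain ⟨j, -, rfl⟩ := mem_image.mp (hS (hT hv))
    have hij : i ≠ j := fun h => huv (by rw [h])
    apply Finset.sum_eq_zero
    intro x _
    by_cases hx : x = i
    · subst hx; simp [f, Pi.single_apply, hij]
    · simp [f, Pi.single_apply, hx]

end NearOrth


/-- For every prime `p` and integer `ℓ ≥ 1` there is `δ = δ(p,ℓ) > 0` such that
for every field `F` of characteristic `p` and all integers `k ≥ 2`,
`d ≥ k ≥ ℓ`, there is a set `A ⊆ F^d` of non-self-orthogonal vectors of size at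
least `d^(δ·k/log₂ k)` such that every `k+1` vectors of `A` include `ℓ+1`
pairwise orthogonal vectors. -/
theorem stmt_12 (p : ℕ) (hp : p.Prime) (ℓ : ℕ) (hℓ : 1 ≤ ℓ) :
    ∃ δ : ℝ, 0 < δ ∧
      ∀ (F : Type) [Field F], CharP F p →
        ∀ k d : ℕ, 2 ≤ k → ℓ ≤ k → k ≤ d →
          ∃ A : Finset (Fin d → F),
            (d : ℝ) ^ (δ * k / Real.logb 2 k) ≤ (A.card : ℝ) ∧
            (∀ v ∈ A, ∑ i, v i * v i ≠ 0) ∧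
            (∀ S ⊆ A, S.card = k + 1 →
              ∃ T ⊆ S, T.card = ℓ + 1 ∧
                ∀ u ∈ T, ∀ v ∈ T, u ≠ v → ∑ i, u i * v i = 0) := by

  have : Fact p.Prime := ⟨hp⟩
  have hp2 : (2 : ℝ) ≤ (p : ℝ) := by exact_mod_cast hp.two_le
  obtain ⟨K, hKdef⟩ : ∃ K, K = ℓ + 1 := ⟨_, rfl⟩
  have hK : 2 ≤ K := by omega
  have hpK : (2 : ℝ) ≤ (p : ℝ) ^ K := hp2.trans (le_self_pow₀ (by linarith) (by omega))
  obtain ⟨q, hqd⟩ : ∃ q : ℝ, q = 1 - ((p : ℝ) ^ K)⁻¹ := ⟨_, rfl⟩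
  have hq0 : 0 < q := by
    have : ((p : ℝ) ^ K)⁻¹ ≤ 2⁻¹ := inv_anti₀ (by norm_num) hpK
    rw [hqd]; norm_num at this ⊢; linarith
  have hq1 : q < 1 := by
    have : 0 < ((p : ℝ) ^ K)⁻¹ := by positivity
    rw [hqd]; linarith
  have hq1' : 1 < q⁻¹ := (one_lt_inv₀ hq0).mpr hq1
  obtain ⟨η, hηd⟩ : ∃ η : ℝ, η = q⁻¹ ^ ((1 : ℝ) / 8) := ⟨_, rfl⟩
  have hη : 1 < η := by rw [hηd]; exact Real.one_lt_rpow hq1' (by norm_num)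
  have hη8 : η ^ 8 = (1 - ((p : ℝ) ^ K)⁻¹)⁻¹ := by
    rw [← hqd, hηd, ← Real.rpow_natCast, ← Real.rpow_mul (by positivity)]
    norm_num
  obtain ⟨B, hB⟩ : ∃ B : ℝ, B = 4 * (K * K) + 16 * (p : ℝ) ^ 2 := ⟨_, rfl⟩
  have hB0 : 0 < B := by rw [hB]; positivity
  have htend := tendsto_pow_const_div_const_pow_of_one_lt 1 hη
  have hev := htend.eventually_lt_const (show (0 : ℝ) < B⁻¹ by positivity)
  obtain ⟨r0, hr0⟩ := Filter.eventually_atTop.mp hev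
  have hbig : ∀ r : ℕ, r0 ≤ r → B * r ≤ η ^ r := by
    intro r hr
    have h := hr0 r hr
    have hpos : 0 < η ^ r := pow_pos (by linarith) r
    rw [pow_one, div_lt_iff₀ hpos, inv_mul_eq_div, lt_div_iff₀ hB0] at h
    linarith
  have hKK : 0 < 2 * (K * K) := by positivity
  obtain ⟨K0, hK0⟩ : ∃ K0, K0 = 2 * (K * K) * (r0 + 1) := ⟨_, rfl⟩
  have hK0pos : 0 < K0 := by rw [hK0]; positivity
  have hK0r : (0 : ℝ) < K0 := by exact_mod_cast hK0pos
  have hKr : (0 : ℝ) < K := by exact_mod_cast (by omega : 0 < K)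
  have hlη : 0 < Real.log η := Real.log_pos hη
  refine ⟨min (1 / (K0 : ℝ)) (Real.log η / (8 * (K * K))), by positivity, ?_⟩
  intro F _ hchar k d hk2 hℓk hkd
  have hδ0 : 0 < min (1 / (K0 : ℝ)) (Real.log η / (8 * (K * K))) := by positivity
  have hδ1 := min_le_left (1 / (K0 : ℝ)) (Real.log η / (8 * (K * K)))
  have hδ2 := min_le_right (1 / (K0 : ℝ)) (Real.log η / (8 * (K * K)))
  rw [← hKdef]
  by_cases hk : k ≤ K0
  · exact NearOrth.main_small hk2 (by omega) hkd hk hδ0 ((le_div_iff₀ hK0r).mp hδ1)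
  · have hdiv : r0 + 1 ≤ k / (2 * (K * K)) := by
      rw [Nat.le_div_iff_mul_le hKK, mul_comm, ← hK0]; omega
    exact NearOrth.main_large (p := p) (r := k / (2 * (K * K))) hK hη hη8 (by omega)
      (Nat.mul_div_le _ _) (Nat.lt_mul_div_succ _ hKK)
      (by rw [← hB]; exact hbig _ (by omega)) hkd hδ0 hδ2
end

section
/- For every prime p and every integer ℓ ≥ 2, there exists δ = δ(p,ℓ) > 0 such that for all integers k ≥ 2 and d ≥ k ≥ ℓ, there exists a set A of at least d^{δ·k/log₂ k} non-self-orthogonal vectors in F_p^d such that: (1) every subset of A of size k includes ℓ pairwise orthogonal vectors, and (2) for every two subsets A_1, A_2 ⊆ A of size 2k−1 each, there exist v_1 ∈ A_1 and v_2 ∈ A_2 with <v_1,v_2> = 0. -/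
namespace NearOrth

open Classical in
/-- Fraction of the elements of a finite type that satisfy a predicate. -/
noncomputable def dens {α : Type*} [Fintype α] (P : α → Prop) : ℝ :=
  ((Finset.univ.filter P).card : ℝ) / (Fintype.card α : ℝ)

lemma dens_eq {α : Type*} [Fintype α] (P : α → Prop) [DecidablePred P] :
    dens P = ((Finset.univ.filter P).card : ℝ) / (Fintype.card α : ℝ) := by
  unfold dens
  congr

lemma dens_mono {α : Type*} [Fintype α] {P Q : α → Prop} (h : ∀ a, P a → Q a) :
    dens P ≤ dens Q := by
  classical
  simp only [dens_eq]
  gcongr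
  exact h _

lemma dens_nonneg {α : Type*} [Fintype α] (P : α → Prop) : 0 ≤ dens P := by
  unfold dens; positivity

lemma dens_or {α : Type*} [Fintype α] (P Q : α → Prop) :
    dens (fun a => P a ∨ Q a) ≤ dens P + dens Q := by
  classical
  simp only [dens_eq]
  rw [← add_div]
  gcongr
  rw [Finset.filter_or]
  exact_mod_cast Finset.card_union_le _ _

lemma dens_exists {α β : Type*} [Fintype α] [Fintype β] (P : β → α → Prop) (c : ℝ)
    (h : ∀ b, dens (P b) ≤ c) :
    dens (fun a => ∃ b, P b a) ≤ (Fintype.card β : ℝ) * c := by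
  classical
  calc dens (fun a => ∃ b, P b a) ≤ ∑ b, dens (P b) := by
        simp only [dens_eq]
        rw [← Finset.sum_div]
        gcongr
        have : (Finset.univ.filter fun a => ∃ b, P b a) ⊆
            Finset.univ.biUnion fun b => Finset.univ.filter (P b) := by
          intro a; simp
        exact_mod_cast (Finset.card_le_card this).trans Finset.card_biUnion_le
    _ ≤ ∑ b : β, c := Finset.sum_le_sum fun b _ => h b
    _ = _ := by simp

lemma exists_of_dens {α : Type*} [Fintype α] [Nonempty α] (P : α → Prop)
    (h : dens P < 1) : ∃ a, ¬ P a := by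
  classical
  by_contra! hc
  have : dens P = 1 := by
    simp only [dens_eq]
    simp [hc]
  linarith

lemma dens_equiv {α β : Type*} [Fintype α] [Fintype β] (e : α ≃ β) (P : β → Prop) :
    dens (fun a => P (e a)) = dens P := by
  classical
  simp only [dens_eq]
  rw [Fintype.card_congr e]
  congr 2
  exact Finset.card_bij (fun a _ => e a) (by simp) (by simp)
    (fun b hb => ⟨e.symm b, by simpa using hb, by simp⟩)

lemma dens_prod_le {α β : Type*} [Fintype α] [Fintype β] (P : α → β → Prop) (c : ℝ)
    (h : ∀ a, dens (P a) ≤ c) [Nonempty α] [Nonempty β] :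
    dens (fun x : α × β => P x.1 x.2) ≤ c := by
  classical
  have hβ : (0 : ℝ) < Fintype.card β := by exact_mod_cast Fintype.card_pos
  have hα : (0 : ℝ) < Fintype.card α := by exact_mod_cast Fintype.card_pos
  simp only [dens_eq] at *
  rw [Fintype.card_prod, div_le_iff₀ (by push_cast; positivity)]
  have : ((Finset.univ.filter fun x : α × β => P x.1 x.2).card) =
      ∑ a, (Finset.univ.filter (P a)).card := by
    simp only [Finset.card_filter]
    rw [Fintype.sum_prod_type]
  rw [this]
  push_cast
  calc ∑ a, ((Finset.univ.filter (P a)).card : ℝ) ≤ ∑ a : α, c * Fintype.card β :=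
        Finset.sum_le_sum fun a _ => (div_le_iff₀ hβ).1 (h a)
    _ = _ := by simp; ring

lemma dens_fst {α β : Type*} [Fintype α] [Fintype β] (P : α → Prop) [Nonempty β] :
    dens (fun x : α × β => P x.1) = dens P := by
  classical
  have hβ : (0 : ℝ) < Fintype.card β := by exact_mod_cast Fintype.card_pos
  simp only [dens_eq]
  have : (Finset.univ.filter fun x : α × β => P x.1) =
      (Finset.univ.filter P) ×ˢ Finset.univ := by ext; simp
  rw [this, Finset.card_product, Fintype.card_prod, Finset.card_univ]
  push_cast
  rw [mul_div_mul_right _ _ hβ.ne']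

lemma dens_comp {κ ι E : Type*} [Fintype κ] [Fintype ι] [Fintype E] [Nonempty E]
    [DecidableEq κ] [DecidableEq ι]
    (e : κ → ι) (he : Function.Injective e) (P : (κ → E) → Prop) :
    dens (fun f : ι → E => P (f ∘ e)) = dens P := by
  classical
  let q : ι → Prop := fun i => i ∈ Set.range e
  let e1 := Equiv.piEquivPiSubtypeProd q (fun _ => E)
  let e2 : (κ → E) ≃ ({i // q i} → E) := (Equiv.ofInjective e he).arrowCongr (Equiv.refl E)
  rw [← dens_fst (β := ({i // ¬ q i} → E)) P]
  rw [← dens_equiv (e1.trans (e2.symm.prodCongr (Equiv.refl _)))]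
  congr 1

lemma dens_pow {κ τ E : Type*} [Fintype κ] [Fintype τ] [Fintype E] [Nonempty E]
    [DecidableEq κ] [DecidableEq τ] (P : (κ → E) → Prop) :
    dens (fun w : κ → τ → E => ∀ s, P (fun i => w i s)) = dens P ^ Fintype.card τ := by
  classical
  rw [← dens_equiv (Equiv.piComm (fun (_ : τ) (_ : κ) => E))]
  simp only [dens_eq]
  have : (Finset.univ.filter fun a : τ → κ → E =>
      ∀ s, P fun i => (Equiv.piComm (fun (_ : τ) (_ : κ) => E)) a i s) =
      Fintype.piFinset fun _ : τ => Finset.univ.filter P := by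
    ext a; simp
  rw [this, Fintype.card_piFinset, div_pow]
  simp

lemma few {p : ℕ} [Fact p.Prime] {r n : ℕ} (u : Fin r → Fin n → ZMod p)
    (hu : LinearIndependent (ZMod p) u) (h : ZMod p → ℝ) :
    ∑ w : Fin n → ZMod p, ∏ i, h (u i ⬝ᵥ w) = (p : ℝ) ^ n / (p : ℝ) ^ r * (∑ y, h y) ^ r := by
  classical
  have hp0 : (p : ℝ) ≠ 0 := by exact_mod_cast (Fact.out : p.Prime).ne_zero
  let L : (Fin n → ZMod p) →ₗ[ZMod p] (Fin r → ZMod p) := Matrix.mulVecLin (Matrix.of u)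
  have hLa : ∀ w i, L w i = u i ⬝ᵥ w := fun w i => rfl
  have hL : Function.Surjective L := by
    rw [← LinearMap.range_eq_top]
    apply Submodule.eq_top_of_finrank_eq
    have h1 : (Matrix.of u).rank = Fintype.card (Fin r) := LinearIndependent.rank_matrix hu
    rw [Matrix.rank] at h1
    simpa using h1
  have hfib : ∀ y, (Finset.univ.filter fun w => L w = y).card =
      (Finset.univ.filter fun w => L w = 0).card := by
    intro y
    obtain ⟨w0, rfl⟩ := hL y
    refine Finset.card_bij (fun w _ => w - w0) ?_ ?_ ?_
    · intro w hw; simp at hw ⊢; rw [hw, sub_self]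
    · intro a _ b _ hab; simpa using hab
    · intro b hb; exact ⟨b + w0, by simpa using hb, by simp⟩
  set c := (Finset.univ.filter fun w => L w = 0).card with hc
  have hsum : ∀ g : (Fin r → ZMod p) → ℝ, ∑ w, g (L w) = c * ∑ y, g y := by
    intro g
    rw [← Finset.sum_fiberwise Finset.univ L, Finset.mul_sum]
    refine Finset.sum_congr rfl fun y _ => ?_
    rw [Finset.sum_congr rfl (g := fun _ => g y)]
    · rw [Finset.sum_const, hfib y, nsmul_eq_mul]
    · intro w hw; simp at hw; rw [hw]
  have hcc : (p : ℝ) ^ n = c * (p : ℝ) ^ r := by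
    have := hsum (fun _ => 1)
    simpa [ZMod.card] using this
  rw [hcc, mul_div_assoc, div_self (by positivity), mul_one]
  have := hsum (fun y => ∏ i, h (y i))
  simp only [hLa] at this
  rw [this, Fintype.sum_pow]

lemma rank_dens {p : ℕ} [Fact p.Prime] (r n k : ℕ) :
    dens (fun u : Fin k → Fin n → ZMod p =>
      ¬ ∃ e : Fin r → Fin k, LinearIndependent (ZMod p) (u ∘ e)) ≤
      (p : ℝ) ^ (n * r + r * k) / (p : ℝ) ^ (n * k) := by
  classical
  simp only [dens_eq]
  have hcard : Fintype.card (Fin k → Fin n → ZMod p) = p ^ (n * k) := by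
    simp [ZMod.card, pow_mul]
  rw [hcard]
  push_cast
  gcongr
  let Φ : (Fin r → Fin n → ZMod p) × (Fin k → Fin r → ZMod p) → (Fin k → Fin n → ZMod p) :=
    fun x j => ∑ i, x.2 j i • x.1 i
  have hsub : (Finset.univ.filter fun u : Fin k → Fin n → ZMod p =>
      ¬ ∃ e : Fin r → Fin k, LinearIndependent (ZMod p) (u ∘ e)) ⊆
      Finset.univ.image Φ := by
    intro u hu
    simp only [Finset.mem_filter, Finset.mem_univ, true_and] at hu
    obtain ⟨κ, a, ha, hspan, hli⟩ := exists_linearIndependent' (ZMod p) u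
    have : Finite κ := Finite.of_injective a ha
    have := Fintype.ofFinite κ
    have hlt : Fintype.card κ < r := by
      by_contra! hr
      obtain ⟨g⟩ : Nonempty (Fin r ↪ κ) :=
        Function.Embedding.nonempty_of_card_le (by simpa using hr)
      exact hu ⟨a ∘ g, hli.comp g g.injective⟩
    obtain ⟨g⟩ : Nonempty (κ ↪ Fin r) :=
      Function.Embedding.nonempty_of_card_le (by simpa using hlt.le)
    let b : Fin r → Fin n → ZMod p := Function.extend g (u ∘ a) 0
    have hb : ∀ j, u j ∈ Submodule.span (ZMod p) (Set.range b) := by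
      intro j
      have h1 : u j ∈ Submodule.span (ZMod p) (Set.range (u ∘ a)) := by
        rw [hspan]; exact Submodule.subset_span ⟨j, rfl⟩
      refine Submodule.span_mono ?_ h1
      rintro _ ⟨x, rfl⟩
      exact ⟨g x, by simp only [b]; rw [g.injective.extend_apply]⟩
    simp only [Submodule.mem_span_range_iff_exists_fun] at hb
    choose c hc using hb
    simp only [Finset.mem_image, Finset.mem_univ, true_and]
    exact ⟨(b, c), funext fun j => hc j⟩
  have h1 := (Finset.card_le_card hsub).trans Finset.card_image_le
  have h2 : (Finset.univ : Finset ((Fin r → Fin n → ZMod p) × (Fin k → Fin r → ZMod p))).card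
      = p ^ (n * r + r * k) := by
    simp [ZMod.card, pow_mul, pow_add]
  rw [h2] at h1
  exact_mod_cast h1

lemma key {p : ℕ} [Fact p.Prime] (r k : ℕ) (hk : 4 * r ≤ k) :
    dens (fun x : (Fin k → Fin (2 * r) → ZMod p) × (Fin k → Fin (2 * r) → ZMod p) =>
      ∀ i, 4 * p * (Finset.univ.filter fun j => x.1 i ⬝ᵥ x.2 j = 0).card ≤ k) ≤
      2 * Real.exp (-(r * k / (4 * p) : ℝ)) := by
  classical
  have hpp : p.Prime := Fact.out
  have hp2 : (2 : ℝ) ≤ p := by exact_mod_cast hpp.two_le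
  have hp0 : (0 : ℝ) < p := by linarith
  set good : (Fin k → Fin (2 * r) → ZMod p) → Prop := fun u =>
    ∃ e : Fin r → Fin k, LinearIndependent (ZMod p) (u ∘ e) with hgood
  set cond : (Fin k → Fin (2 * r) → ZMod p) → (Fin k → Fin (2 * r) → ZMod p) → Prop :=
    fun u w => ∀ i, 4 * p * (Finset.univ.filter fun j => u i ⬝ᵥ w j = 0).card ≤ k with hcond
  have h1 : dens (fun x : (Fin k → Fin (2 * r) → ZMod p) × (Fin k → Fin (2 * r) → ZMod p) =>
      cond x.1 x.2) ≤ dens (fun x : (Fin k → Fin (2 * r) → ZMod p) ×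
        (Fin k → Fin (2 * r) → ZMod p) => ¬ good x.1) +
      dens (fun x : (Fin k → Fin (2 * r) → ZMod p) × (Fin k → Fin (2 * r) → ZMod p) =>
        good x.1 ∧ cond x.1 x.2) := by
    refine le_trans (dens_mono ?_) (dens_or _ _)
    intro x hx
    by_cases hg : good x.1
    · exact Or.inr ⟨hg, hx⟩
    · exact Or.inl hg
  have h2 : dens (fun x : (Fin k → Fin (2 * r) → ZMod p) ×
        (Fin k → Fin (2 * r) → ZMod p) => ¬ good x.1) ≤ Real.exp (-(r * k / (4 * p) : ℝ)) := by
    rw [dens_fst (β := Fin k → Fin (2 * r) → ZMod p) (fun u => ¬ good u)]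
    refine (rank_dens r (2 * r) k).trans ?_
    have hlog : (1 / 2 : ℝ) ≤ Real.log p := by
      have := Real.log_two_gt_d9
      have := Real.log_le_log (by norm_num) hp2
      linarith
    have hexp : (p : ℝ) = Real.exp (Real.log p) := (Real.exp_log hp0).symm
    rw [div_le_iff₀ (by positivity), hexp, ← Real.exp_nat_mul, ← Real.exp_nat_mul,
      ← Real.exp_add, Real.exp_le_exp, ← hexp]
    push_cast
    have hk' : (4 * r : ℝ) ≤ k := by exact_mod_cast hk
    have hr : (0 : ℝ) ≤ r := by positivity
    have hrk : 4 * (r * r : ℝ) ≤ r * k := by nlinarith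
    have h8 : (r * k / (4 * p) : ℝ) ≤ r * k / 8 := by
      apply div_le_div_of_nonneg_left <;> first | positivity | linarith
    have hrk0 : (0 : ℝ) ≤ r * k := by positivity
    have : (2 * r * r + r * k : ℝ) * Real.log p ≤ (2 * r * k - r * k / 2) * Real.log p := by
      apply mul_le_mul_of_nonneg_right _ (by linarith)
      nlinarith
    nlinarith
  have h3 : dens (fun x : (Fin k → Fin (2 * r) → ZMod p) × (Fin k → Fin (2 * r) → ZMod p) =>
        good x.1 ∧ cond x.1 x.2) ≤ Real.exp (-(r * k / (4 * p) : ℝ)) := by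
    apply dens_prod_le (fun u w => good u ∧ cond u w)
    intro u
    by_cases hg : good u
    swap
    · have : dens (fun w => good u ∧ cond u w) = 0 := by
        simp [dens_eq, hg]
      rw [this]; positivity
    obtain ⟨e, he⟩ := hg
    let h : ZMod p → ℝ := fun y => Real.exp (-(if y = 0 then 1 else 0))
    have hh : ∑ y, h y ≤ p * Real.exp (-(1 / (2 * p))) := by
      have e1 : ∑ y, h y = Real.exp (-1) + ((p : ℝ) - 1) := by
        rw [← Finset.add_sum_erase _ _ (Finset.mem_univ (0 : ZMod p))]
        congr 1
        · simp [h]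
        · rw [Finset.sum_congr rfl (g := fun _ => (1 : ℝ))]
          · rw [Finset.sum_const, Finset.card_erase_of_mem (Finset.mem_univ _),
              Finset.card_univ, ZMod.card, nsmul_eq_mul, mul_one,
              Nat.cast_sub hpp.one_le, Nat.cast_one]
          · intro y hy
            simp [h, Finset.ne_of_mem_erase hy]
      have e2 : Real.exp (-1) ≤ 1 / 2 := by
        have := Real.exp_neg_one_lt_d9
        linarith
      have e3 := Real.add_one_le_exp (-(1 / (2 * p) : ℝ))
      have e4 : (p : ℝ) * (-(1 / (2 * p)) + 1) = p - 1 / 2 := by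
        field_simp; ring
      have e5 := mul_le_mul_of_nonneg_left e3 hp0.le
      rw [e1]; linarith
    have hh0 : 0 ≤ ∑ y, h y := Finset.sum_nonneg fun y _ => (Real.exp_pos _).le
    have hF := few (u ∘ e) he h
    have hcount : ((Finset.univ.filter (cond u)).card : ℝ) ≤
        Real.exp (r * k / (4 * p)) *
          (∑ x : Fin (2 * r) → ZMod p, ∏ i, h ((u ∘ e) i ⬝ᵥ x)) ^ k := by
      rw [Fintype.sum_pow, Finset.card_filter, Nat.cast_sum, Finset.mul_sum]
      refine Finset.sum_le_sum fun w _ => ?_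
      by_cases hw : cond u w
      swap
      · rw [if_neg hw, Nat.cast_zero]
        exact mul_nonneg (Real.exp_pos _).le (Finset.prod_nonneg fun _ _ =>
          Finset.prod_nonneg fun _ _ => (Real.exp_pos _).le)
      rw [if_pos hw, Nat.cast_one]
      simp only [h]
      rw [Finset.prod_comm]
      simp only [← Real.exp_sum]
      rw [← Real.exp_add, Real.one_le_exp_iff]
      have hrow : ∀ i, ∑ j, (-(if (u ∘ e) i ⬝ᵥ w j = 0 then 1 else 0) : ℝ) ≥ -(k / (4 * p)) := by
        intro i
        rw [Finset.sum_neg_distrib]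
        have := hw (e i)
        have h4 : (4 * p * ((Finset.univ.filter fun j => u (e i) ⬝ᵥ w j = 0).card : ℝ)) ≤ k := by
          exact_mod_cast this
        have h5 : (∑ j, (if (u ∘ e) i ⬝ᵥ w j = 0 then 1 else 0) : ℝ) =
            ((Finset.univ.filter fun j => u (e i) ⬝ᵥ w j = 0).card : ℝ) := by
          simp
        rw [h5, ge_iff_le, neg_le_neg_iff, le_div_iff₀ (by positivity)]
        linarith
      have hs : ∑ i : Fin r, ∑ j, (-(if (u ∘ e) i ⬝ᵥ w j = 0 then 1 else 0) : ℝ) ≥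
          ∑ i : Fin r, (-(k / (4 * p)) : ℝ) := Finset.sum_le_sum fun i _ => hrow i
      rw [Finset.sum_const, Finset.card_univ, Fintype.card_fin, nsmul_eq_mul] at hs
      have : (r * k / (4 * p) : ℝ) = r * (k / (4 * p)) := by ring
      linarith
    have hmono : dens (fun w => good u ∧ cond u w) ≤ dens (cond u) :=
      dens_mono fun w hw => hw.2
    refine hmono.trans ?_
    rw [dens_eq, div_le_iff₀ (by exact_mod_cast Fintype.card_pos)]
    refine hcount.trans ?_
    rw [hF]
    have hc : (Fintype.card (Fin k → Fin (2 * r) → ZMod p) : ℝ) = ((p : ℝ) ^ (2 * r)) ^ k := by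
      simp [ZMod.card]
    rw [hc]
    have hb : (p : ℝ) ^ (2 * r) / (p : ℝ) ^ r * (∑ y, h y) ^ r ≤
        (p : ℝ) ^ (2 * r) * Real.exp (-(1 / (2 * p))) ^ r := by
      have := pow_le_pow_left₀ hh0 hh r
      rw [mul_pow] at this
      calc (p : ℝ) ^ (2 * r) / (p : ℝ) ^ r * (∑ y, h y) ^ r
          ≤ (p : ℝ) ^ (2 * r) / (p : ℝ) ^ r * (p ^ r * Real.exp (-(1 / (2 * p))) ^ r) := by
            gcongr
        _ = _ := by field_simp
    have hb2 := pow_le_pow_left₀ (by positivity) hb k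
    refine (mul_le_mul_of_nonneg_left hb2 (Real.exp_pos _).le).trans ?_
    rw [mul_pow, ← pow_mul (Real.exp _), ← Real.exp_nat_mul, mul_left_comm, ← Real.exp_add,
      mul_comm]
    refine mul_le_mul_of_nonneg_right (Real.exp_le_exp.2 ?_) (by positivity)
    push_cast
    apply le_of_eq
    field_simp
    ring
  linarith

/-- The family `w` has `ℓ` pairwise orthogonal members. -/
def HasK {p n : ℕ} {ι : Type*} (ℓ : ℕ) (w : ι → Fin n → ZMod p) : Prop :=
  ∃ T : Finset ι, T.card = ℓ ∧ ∀ i ∈ T, ∀ j ∈ T, i ≠ j → w i ⬝ᵥ w j = 0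

lemma HasK.of_comp {p n ℓ : ℕ} {ι κ : Type*} {w : ι → Fin n → ZMod p} {e : κ → ι}
    (he : Function.Injective e) (h : HasK ℓ (w ∘ e)) : HasK ℓ w := by
  obtain ⟨T, hT, h⟩ := h
  refine ⟨T.map ⟨e, he⟩, by simpa using hT, ?_⟩
  intro i hi j hj hij
  simp only [Finset.mem_map, Function.Embedding.coeFn_mk] at hi hj
  obtain ⟨i, hi, rfl⟩ := hi
  obtain ⟨j, hj, rfl⟩ := hj
  exact h i hi j hj (fun h => hij (by rw [h]))

lemma noK_step {p : ℕ} [Fact p.Prime] (ℓ C r0 : ℕ) (γ : ℝ) (hγ : 0 < γ)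
    (H : ∀ r ≥ r0, ∀ k ≥ C * r, dens (fun w : Fin k → Fin (2 * r) → ZMod p => ¬ HasK ℓ w) ≤
        Real.exp (-(γ * r * k)))
    (r : ℕ) (hr : r0 ≤ r) (a : ℕ) (ha : (4 * p * C + 4) * r ≤ a) :
    dens (fun w : Fin a ⊕ Fin a → Fin (2 * r) → ZMod p => ¬ HasK (ℓ + 1) w) ≤
      2 * Real.exp (-(r * a / (4 * p) : ℝ)) + 2 ^ a * Real.exp (-(γ * r * a / (4 * p))) := by
  classical
  have hpp : p.Prime := Fact.out
  have hp0 : (0 : ℝ) < p := by exact_mod_cast hpp.pos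
  rw [← dens_equiv (Equiv.sumArrowEquivProdArrow (Fin a) (Fin a) (Fin (2 * r) → ZMod p)).symm]
  have hk4 : 4 * r ≤ a := by nlinarith [Nat.zero_le (4 * p * C * r)]
  have hsplit := dens_or
    (fun x : (Fin a → Fin (2 * r) → ZMod p) × (Fin a → Fin (2 * r) → ZMod p) =>
      ∀ i, 4 * p * (Finset.univ.filter fun j => x.1 i ⬝ᵥ x.2 j = 0).card ≤ a)
    (fun x => ∃ S : Finset (Fin a), a < 4 * p * S.card ∧
      ¬ HasK ℓ (x.2 ∘ (S.orderEmbOfFin rfl)))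
  refine le_trans (dens_mono ?_) (hsplit.trans (add_le_add (key r a hk4) ?_))
  · intro x hx
    by_cases hc : ∀ i, 4 * p * (Finset.univ.filter fun j => x.1 i ⬝ᵥ x.2 j = 0).card ≤ a
    · exact Or.inl hc
    right
    push Not at hc
    obtain ⟨i, hi⟩ := hc
    obtain ⟨S, hS⟩ : ∃ S, S = Finset.univ.filter fun j => x.1 i ⬝ᵥ x.2 j = 0 := ⟨_, rfl⟩
    rw [← hS] at hi
    refine ⟨S, hi, ?_⟩
    rintro ⟨T, hT, hTo⟩
    apply hx
    let g : Fin S.card ↪ Fin a ⊕ Fin a :=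
      ((S.orderEmbOfFin rfl).toEmbedding).trans ⟨Sum.inr, Sum.inr_injective⟩
    have hmem : ∀ y, x.1 i ⬝ᵥ x.2 (S.orderEmbOfFin rfl y) = 0 := by
      intro y
      have := S.orderEmbOfFin_mem rfl y
      have h2 : ∀ z, z ∈ S → x.1 i ⬝ᵥ x.2 z = 0 := by
        intro z hz
        simpa [hS] using hz
      exact h2 _ this
    have hin : Sum.inl i ∉ T.map g := by simp [g]
    refine ⟨insert (Sum.inl i) (T.map g), ?_, ?_⟩
    · rw [Finset.card_insert_of_notMem hin, Finset.card_map, hT]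
    · intro y hy z hz hyz
      rw [Finset.mem_insert, Finset.mem_map] at hy hz
      rcases hy with rfl | ⟨y, hy, rfl⟩ <;> rcases hz with rfl | ⟨z, hz, rfl⟩
      · exact absurd rfl hyz
      · exact hmem z
      · exact (dotProduct_comm _ _).trans (hmem y)
      · exact hTo y hy z hz (fun h => hyz (by rw [h]))
  · have hS : ∀ S : Finset (Fin a),
        dens (fun x : (Fin a → Fin (2 * r) → ZMod p) × (Fin a → Fin (2 * r) → ZMod p) =>
          a < 4 * p * S.card ∧ ¬ HasK ℓ (x.2 ∘ (S.orderEmbOfFin rfl))) ≤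
          Real.exp (-(γ * r * a / (4 * p))) := by
      intro S
      apply dens_prod_le (fun _ w => a < 4 * p * S.card ∧ ¬ HasK ℓ (w ∘ (S.orderEmbOfFin rfl)))
      intro _
      by_cases hc : a < 4 * p * S.card
      swap
      · have : dens (fun w : Fin a → Fin (2 * r) → ZMod p => a < 4 * p * S.card ∧
            ¬ HasK ℓ (w ∘ (S.orderEmbOfFin rfl))) = 0 := by
          simp [dens_eq, hc]
        rw [this]; positivity
      refine (dens_mono (fun w hw => hw.2)).trans ?_
      rw [dens_comp (S.orderEmbOfFin rfl) (S.orderEmbOfFin rfl).injective (fun w => ¬ HasK ℓ w)]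
      have hCr : C * r ≤ S.card := by
        by_contra! hlt
        have : 4 * p * S.card ≤ 4 * p * (C * r) := Nat.mul_le_mul_left _ hlt.le
        nlinarith
      refine (H r hr _ hCr).trans (Real.exp_le_exp.2 (neg_le_neg ?_))
      have hc' : (a : ℝ) ≤ 4 * p * S.card := by exact_mod_cast hc.le
      rw [div_le_iff₀ (by positivity)]
      have : 0 ≤ γ * r := by positivity
      nlinarith
    have := dens_exists _ _ hS
    simpa using this

lemma noK (p : ℕ) [Fact p.Prime] (ℓ : ℕ) : ∃ C r0 : ℕ, ∃ γ : ℝ, 0 < γ ∧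
    ∀ r ≥ r0, ∀ k ≥ C * r, dens (fun w : Fin k → Fin (2 * r) → ZMod p => ¬ HasK (ℓ + 1) w) ≤
        Real.exp (-(γ * r * k)) := by
  classical
  have hpp : p.Prime := Fact.out
  have hp0 : (0 : ℝ) < p := by exact_mod_cast hpp.pos
  induction ℓ with
  | zero =>
    refine ⟨1, 1, 1, one_pos, fun r hr k hk => ?_⟩
    have hk1 : 0 < k := by omega
    have : ∀ w : Fin k → Fin (2 * r) → ZMod p, HasK (0 + 1) w := fun w =>
      ⟨{⟨0, hk1⟩}, by simp, by
        intro i hi j hj hij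
        simp only [Finset.mem_singleton] at hi hj
        exact absurd (hi.trans hj.symm) hij⟩
    have h0 : dens (fun w : Fin k → Fin (2 * r) → ZMod p => ¬ HasK (0 + 1) w) = 0 := by
      simp only [dens_eq, this]
      simp
    rw [h0]; positivity
  | succ ℓ ih =>
    obtain ⟨C, r0, γ, hγ, H⟩ := ih
    set γ1 : ℝ := min (1 / (4 * p)) (γ / (8 * p)) with hγ1
    have hγ1p : 0 < γ1 := by positivity
    obtain ⟨R1, hR1⟩ := exists_nat_ge (8 * p / γ)
    obtain ⟨R2, hR2⟩ := exists_nat_ge (4 / γ1)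
    refine ⟨2 * (4 * p * C + 4), r0 + R1 + R2 + 1, γ1 / 6, by positivity, fun r hr k hk => ?_⟩
    set a := k / 2 with haa
    have ha : (4 * p * C + 4) * r ≤ a := by
      rw [haa, Nat.le_div_iff_mul_le (by norm_num)]
      nlinarith
    have hra : r ≤ a := by nlinarith [Nat.zero_le (4 * p * C * r)]
    have hr1 : (1 : ℝ) ≤ r := by exact_mod_cast (by omega : 1 ≤ r)
    have ha1 : (1 : ℝ) ≤ a := by exact_mod_cast (by omega : 1 ≤ a)
    have hka : (k : ℝ) ≤ 3 * a := by exact_mod_cast (by omega : k ≤ 3 * a)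
    have hstep := noK_step (ℓ + 1) C r0 γ hγ H r (by omega) a ha
    obtain ⟨e⟩ : Nonempty (Fin a ⊕ Fin a ↪ Fin k) :=
      Function.Embedding.nonempty_of_card_le (by simp; omega)
    have hle : dens (fun w : Fin k → Fin (2 * r) → ZMod p => ¬ HasK (ℓ + 1 + 1) w) ≤
        dens (fun w : Fin a ⊕ Fin a → Fin (2 * r) → ZMod p => ¬ HasK (ℓ + 1 + 1) w) := by
      rw [← dens_comp e e.injective]
      exact dens_mono fun w hw h => hw (h.of_comp e.injective)
    refine hle.trans (hstep.trans ?_)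
    have hR1r : 8 * p / γ ≤ r := hR1.trans (by exact_mod_cast (by omega : R1 ≤ r))
    have hR2r : 4 / γ1 ≤ r := hR2.trans (by exact_mod_cast (by omega : R2 ≤ r))
    have hra0 : (0 : ℝ) ≤ r * a := by positivity
    have b1 : Real.exp (-(r * a / (4 * p) : ℝ)) ≤ Real.exp (-(γ1 * (r * a))) := by
      refine Real.exp_le_exp.2 (neg_le_neg ?_)
      have := mul_le_mul_of_nonneg_right (min_le_left (1 / (4 * p) : ℝ) (γ / (8 * p))) hra0
      calc _ ≤ _ := this
        _ = _ := by ring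
    have b2 : (2 : ℝ) ^ a * Real.exp (-(γ * r * a / (4 * p))) ≤ Real.exp (-(γ1 * (r * a))) := by
      have h2 : (2 : ℝ) ^ a ≤ Real.exp a := by
        have : (2 : ℝ) ≤ Real.exp 1 := by
          have := Real.add_one_le_exp (1 : ℝ); linarith
        calc (2 : ℝ) ^ a ≤ Real.exp 1 ^ a := by gcongr
          _ = _ := by rw [← Real.exp_nat_mul, mul_one]
      refine (mul_le_mul_of_nonneg_right h2 (Real.exp_pos _).le).trans ?_
      rw [← Real.exp_add, Real.exp_le_exp]
      have h3 := mul_le_mul_of_nonneg_right (min_le_right (1 / (4 * p) : ℝ) (γ / (8 * p))) hra0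
      have h4 : (a : ℝ) ≤ γ / (8 * p) * (r * a) := by
        rw [div_le_iff₀ hγ] at hR1r
        rw [div_mul_eq_mul_div, le_div_iff₀ (by positivity)]
        nlinarith
      have h5 : γ * r * a / (4 * p) = 2 * (γ / (8 * p) * (r * a)) := by
        field_simp; ring
      rw [h5]; linarith
    have b3 : (3 : ℝ) ≤ Real.exp 2 := by
      have := Real.add_one_le_exp (2 : ℝ); linarith
    calc _ ≤ 2 * Real.exp (-(γ1 * (r * a))) + Real.exp (-(γ1 * (r * a))) := by
          gcongr
      _ = 3 * Real.exp (-(γ1 * (r * a))) := by ring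
      _ ≤ Real.exp 2 * Real.exp (-(γ1 * (r * a))) := by gcongr
      _ = Real.exp (2 + -(γ1 * (r * a))) := by rw [Real.exp_add]
      _ ≤ _ := by
        rw [Real.exp_le_exp]
        have h6 : 4 ≤ γ1 * (r * a) := by
          rw [div_le_iff₀ hγ1p] at hR2r
          nlinarith
        have h7 : γ1 / 6 * r * k ≤ γ1 * (r * a) / 2 := by
          have : 0 ≤ γ1 / 6 * r := by positivity
          nlinarith
        linarith

/-- Non-self-orthogonal vectors. -/
abbrev NSO (p n : ℕ) : Type := {v : Fin n → ZMod p // v ⬝ᵥ v ≠ 0}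

noncomputable instance instFintypeNSO (p n : ℕ) [Fact p.Prime] : Fintype (NSO p n) :=
  Fintype.ofFinite _

lemma card_NSO (p n : ℕ) [Fact p.Prime] (hn : 0 < n) :
    p ^ n ≤ p * Fintype.card (NSO p n) := by
  classical
  obtain ⟨m, rfl⟩ : ∃ m, n = m + 1 := ⟨n - 1, by omega⟩
  let F : (Fin m → ZMod p) → NSO p (m + 1) := fun x =>
    ⟨Fin.cons (if x ⬝ᵥ x = 0 then 1 else 0) x, by
      have : (Fin.cons (if x ⬝ᵥ x = 0 then 1 else 0) x : Fin (m + 1) → ZMod p) ⬝ᵥ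
          (Fin.cons (if x ⬝ᵥ x = 0 then 1 else 0) x : Fin (m + 1) → ZMod p) =
          (if x ⬝ᵥ x = 0 then 1 else 0) * (if x ⬝ᵥ x = 0 then 1 else 0) + x ⬝ᵥ x := by
        simp only [dotProduct]
        rw [Fin.sum_univ_succ]
        simp
      rw [this]
      by_cases h : x ⬝ᵥ x = 0 <;> simp [h]⟩
  have hF : Function.Injective F := by
    intro x y hxy
    have h1 := congrArg Subtype.val hxy
    funext i
    have h3 := congrFun h1 i.succ
    simpa [F] using h3
  have := Fintype.card_le_of_injective F hF
  have h2 : Fintype.card (Fin m → ZMod p) = p ^ m := by simp [ZMod.card]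
  rw [h2] at this
  rw [pow_succ, mul_comm]
  exact Nat.mul_le_mul_left _ this

lemma nonempty_NSO (p n : ℕ) [Fact p.Prime] (hn : 0 < n) : Nonempty (NSO p n) := by
  rw [← Fintype.card_pos_iff]
  have h := card_NSO p n hn
  have : 0 < p ^ n := pow_pos (Fact.out : p.Prime).pos _
  by_contra! h0
  have h1 : Fintype.card (NSO p n) = 0 := by omega
  rw [h1] at h
  omega

lemma dens_NSO {κ : Type*} [Fintype κ] [DecidableEq κ] (p n : ℕ) [Fact p.Prime] (hn : 0 < n)
    (P : (κ → Fin n → ZMod p) → Prop) :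
    dens (fun w : κ → NSO p n => P (fun i => (w i).1)) ≤ (p : ℝ) ^ Fintype.card κ * dens P := by
  classical
  have := nonempty_NSO p n hn
  simp only [dens_eq]
  have hB : (0 : ℝ) < Fintype.card (κ → NSO p n) := by exact_mod_cast Fintype.card_pos
  have hE : (0 : ℝ) < Fintype.card (κ → Fin n → ZMod p) := by exact_mod_cast Fintype.card_pos
  have h1 : (Finset.univ.filter fun w : κ → NSO p n => P (fun i => (w i).1)).card ≤
      (Finset.univ.filter P).card := by
    refine Finset.card_le_card_of_injOn (fun w i => (w i).1) ?_ ?_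
    · intro w hw; simpa using hw
    · intro w _ w' _ h
      funext i
      exact Subtype.ext (congrFun h i)
  have h2 : (Fintype.card (κ → Fin n → ZMod p) : ℝ) ≤
      (p : ℝ) ^ Fintype.card κ * Fintype.card (κ → NSO p n) := by
    have := Nat.pow_le_pow_left (card_NSO p n hn) (Fintype.card κ)
    rw [mul_pow] at this
    have h3 : Fintype.card (κ → Fin n → ZMod p) = (p ^ n) ^ Fintype.card κ := by
      simp [ZMod.card]
    have h4 : Fintype.card (κ → NSO p n) = (Fintype.card (NSO p n)) ^ Fintype.card κ :=
      Fintype.card_fun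
    rw [h3, h4]
    exact_mod_cast this
  have h1' : ((Finset.univ.filter fun w : κ → NSO p n => P (fun i => (w i).1)).card : ℝ) ≤
      (Finset.univ.filter P).card := by exact_mod_cast h1
  rw [div_le_iff₀ hB, mul_div_assoc', div_mul_eq_mul_div, le_div_iff₀ hE]
  calc _ ≤ ((Finset.univ.filter P).card : ℝ) *
        ((p : ℝ) ^ Fintype.card κ * Fintype.card (κ → NSO p n)) := by gcongr
    _ = _ := by ring

lemma base (p : ℕ) [Fact p.Prime] (ℓ : ℕ) : ∃ C r0 : ℕ, ∃ γ : ℝ, 0 < γ ∧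
    ∀ r ≥ r0, 0 < r → ∀ k ≥ C * r,
      dens (fun w : Fin k → NSO p (2 * r) => ¬ HasK (ℓ + 1) (fun i => (w i).1)) ≤
        Real.exp (-(γ * r * k)) ∧
      dens (fun w : Fin k ⊕ Fin k → NSO p (2 * r) =>
        ∀ i j, (w (Sum.inl i)).1 ⬝ᵥ (w (Sum.inr j)).1 ≠ 0) ≤
        Real.exp (-(γ * r * (2 * k))) := by
  classical
  have hpp : p.Prime := Fact.out
  have hp0 : (0 : ℝ) < p := by exact_mod_cast hpp.pos
  have hpe : (p : ℝ) ≤ Real.exp p := by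
    have := Real.add_one_le_exp (p : ℝ); linarith
  obtain ⟨C, r0, γ, hγ, H⟩ := noK p ℓ
  obtain ⟨R1, hR1⟩ := exists_nat_ge (2 * p / γ)
  obtain ⟨R2, hR2⟩ := exists_nat_ge ((2 * p + 1) * (8 * p) : ℝ)
  refine ⟨C + 4, r0 + R1 + R2, min (γ / 2) (1 / (16 * p)), by positivity,
    fun r hr hr0 k hk => ?_⟩
  have hn : 0 < 2 * r := by omega
  have hkC : C * r ≤ k := by nlinarith
  have hk4 : 4 * r ≤ k := by nlinarith [Nat.zero_le (C * r)]
  have hk1 : (1 : ℝ) ≤ k := by exact_mod_cast (by omega : 1 ≤ k)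
  have hR1r : 2 * p / γ ≤ r := hR1.trans (by exact_mod_cast (by omega : R1 ≤ r))
  have hR2r : ((2 * p + 1) * (8 * p) : ℝ) ≤ r :=
    hR2.trans (by exact_mod_cast (by omega : R2 ≤ r))
  have hrk : (0 : ℝ) ≤ r * k := by positivity
  constructor
  · refine (dens_NSO p (2 * r) hn (fun w => ¬ HasK (ℓ + 1) w)).trans ?_
    refine (mul_le_mul (pow_le_pow_left₀ hp0.le hpe _) (H r (by omega) k hkC)
      (dens_nonneg _) (by positivity)).trans ?_
    rw [Fintype.card_fin, ← Real.exp_nat_mul, ← Real.exp_add, Real.exp_le_exp]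
    have h1 := mul_le_mul_of_nonneg_right (min_le_left (γ / 2) (1 / (16 * p) : ℝ)) hrk
    rw [div_le_iff₀ hγ] at hR1r
    nlinarith
  · refine (dens_NSO p (2 * r) hn (fun w : Fin k ⊕ Fin k → Fin (2 * r) → ZMod p =>
      ∀ i j, (w (Sum.inl i)) ⬝ᵥ (w (Sum.inr j)) ≠ 0)).trans ?_
    rw [← dens_equiv
      (Equiv.sumArrowEquivProdArrow (Fin k) (Fin k) (Fin (2 * r) → ZMod p)).symm]
    have hkey : dens (fun x : (Fin k → Fin (2 * r) → ZMod p) × (Fin k → Fin (2 * r) → ZMod p) =>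
        ∀ i j, ((Equiv.sumArrowEquivProdArrow (Fin k) (Fin k)
          (Fin (2 * r) → ZMod p)).symm x (Sum.inl i)) ⬝ᵥ
          ((Equiv.sumArrowEquivProdArrow (Fin k) (Fin k)
          (Fin (2 * r) → ZMod p)).symm x (Sum.inr j)) ≠ 0) ≤
        2 * Real.exp (-(r * k / (4 * p) : ℝ)) := by
      refine (dens_mono ?_).trans (key r k hk4)
      intro x hx i
      have : (Finset.univ.filter fun j => x.1 i ⬝ᵥ x.2 j = 0) = ∅ := by
        apply Finset.filter_eq_empty_iff.2
        intro j _
        exact hx i j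
      rw [this]; simp
    have h2e : (2 : ℝ) ≤ Real.exp 1 := by
      have := Real.add_one_le_exp (1 : ℝ); linarith
    have hkey' := hkey.trans (mul_le_mul_of_nonneg_right h2e (Real.exp_pos _).le)
    refine (mul_le_mul (pow_le_pow_left₀ hp0.le hpe _) hkey'
      (dens_nonneg _) (by positivity)).trans ?_
    rw [← Real.exp_nat_mul, ← Real.exp_add, ← Real.exp_add, Real.exp_le_exp]
    simp only [Fintype.card_sum, Fintype.card_fin]
    push_cast
    have h1 := mul_le_mul_of_nonneg_right (min_le_right (γ / 2) (1 / (16 * p) : ℝ)) hrk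
    have h3 : 1 / (16 * p) * (r * k : ℝ) = (r * k / (4 * p)) / 4 := by field_simp; ring
    have h4 : ((2 * p + 1) * k : ℝ) ≤ (r * k / (4 * p)) / 2 := by
      rw [div_div, le_div_iff₀ (by positivity)]
      nlinarith
    nlinarith

lemma exists_f (p : ℕ) [Fact p.Prime] (ℓ r k t N : ℕ) (γ : ℝ) (hr : 0 < r) (hk : 2 ≤ k)
    (h1 : dens (fun w : Fin k → NSO p (2 * r) => ¬ HasK ℓ (fun i => (w i).1)) ≤
        Real.exp (-(γ * r * k)))
    (h2 : dens (fun w : Fin k ⊕ Fin k → NSO p (2 * r) =>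
        ∀ i j, (w (Sum.inl i)).1 ⬝ᵥ (w (Sum.inr j)).1 ≠ 0) ≤
        Real.exp (-(γ * r * (2 * k))))
    (hN : (N : ℝ) ≤ Real.exp (γ * r * t) / 2) :
    ∃ f : Fin N → Fin t → NSO p (2 * r),
      (∀ e : Fin k → Fin N, Function.Injective e →
        ∃ s, HasK ℓ (fun i => (f (e i) s).1)) ∧
      (∀ e : Fin k ⊕ Fin k → Fin N, Function.Injective e →
        ∃ s i j, (f (e (Sum.inl i)) s).1 ⬝ᵥ (f (e (Sum.inr j)) s).1 = 0) := by
  classical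
  have hne := nonempty_NSO p (2 * r) (by omega)
  let Q1 : (Fin k → Fin N) → (Fin N → Fin t → NSO p (2 * r)) → Prop := fun e f =>
    Function.Injective e ∧ ∀ s, ¬ HasK ℓ (fun i => (f (e i) s).1)
  let Q2 : (Fin k ⊕ Fin k → Fin N) → (Fin N → Fin t → NSO p (2 * r)) → Prop := fun e f =>
    Function.Injective e ∧ ∀ s, ∀ i j, (f (e (Sum.inl i)) s).1 ⬝ᵥ (f (e (Sum.inr j)) s).1 ≠ 0
  have hQ1 : ∀ e, dens (Q1 e) ≤ Real.exp (-(γ * r * k)) ^ t := by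
    intro e
    by_cases he : Function.Injective e
    swap
    · have : dens (Q1 e) = 0 := by simp [dens_eq, Q1, he]
      rw [this]; positivity
    refine (dens_mono (fun f hf => hf.2)).trans ?_
    have := dens_comp (E := Fin t → NSO p (2 * r)) e he
      (fun w => ∀ s, ¬ HasK ℓ (fun i => (w i s).1))
    refine (le_of_eq this).trans ?_
    have h3 := dens_pow (τ := Fin t) (fun w : Fin k → NSO p (2 * r) =>
      ¬ HasK ℓ (fun i => (w i).1))
    rw [h3, Fintype.card_fin]
    exact pow_le_pow_left₀ (dens_nonneg _) h1 _
  have hQ2 : ∀ e, dens (Q2 e) ≤ Real.exp (-(γ * r * (2 * k))) ^ t := by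
    intro e
    by_cases he : Function.Injective e
    swap
    · have : dens (Q2 e) = 0 := by simp [dens_eq, Q2, he]
      rw [this]; positivity
    refine (dens_mono (fun f hf => hf.2)).trans ?_
    have := dens_comp (E := Fin t → NSO p (2 * r)) e he
      (fun w => ∀ s, ∀ i j, (w (Sum.inl i) s).1 ⬝ᵥ (w (Sum.inr j) s).1 ≠ 0)
    refine (le_of_eq this).trans ?_
    have h3 := dens_pow (τ := Fin t) (fun w : Fin k ⊕ Fin k → NSO p (2 * r) =>
      ∀ i j, (w (Sum.inl i)).1 ⬝ᵥ (w (Sum.inr j)).1 ≠ 0)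
    rw [h3, Fintype.card_fin]
    exact pow_le_pow_left₀ (dens_nonneg _) h2 _
  have hE1 := dens_exists Q1 _ hQ1
  have hE2 := dens_exists Q2 _ hQ2
  have hor := dens_or (fun f => ∃ e, Q1 e f) (fun f => ∃ e, Q2 e f)
  have hx : (N : ℝ) * Real.exp (-(γ * r * t)) ≤ 1 / 2 := by
    have := mul_le_mul_of_nonneg_right hN (Real.exp_pos (-(γ * r * t))).le
    rw [div_mul_eq_mul_div, ← Real.exp_add, add_neg_cancel, Real.exp_zero] at this
    exact this
  have hx0 : 0 ≤ (N : ℝ) * Real.exp (-(γ * r * t)) := by positivity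
  have e1 : (Fintype.card (Fin k → Fin N) : ℝ) * Real.exp (-(γ * r * k)) ^ t =
      ((N : ℝ) * Real.exp (-(γ * r * t))) ^ k := by
    rw [mul_pow, ← Real.exp_nat_mul, ← Real.exp_nat_mul]
    simp only [Fintype.card_fun, Fintype.card_fin]
    push_cast
    congr 2
    ring
  have e2 : (Fintype.card (Fin k ⊕ Fin k → Fin N) : ℝ) * Real.exp (-(γ * r * (2 * k))) ^ t =
      ((N : ℝ) * Real.exp (-(γ * r * t))) ^ (k + k) := by
    rw [mul_pow, ← Real.exp_nat_mul, ← Real.exp_nat_mul]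
    simp only [Fintype.card_fun, Fintype.card_fin, Fintype.card_sum]
    push_cast
    congr 2
    ring
  have b1 : ((N : ℝ) * Real.exp (-(γ * r * t))) ^ k ≤ (1 / 2) ^ 2 :=
    (pow_le_pow_left₀ hx0 hx k).trans (pow_le_pow_of_le_one (by norm_num) (by norm_num) hk)
  have b2 : ((N : ℝ) * Real.exp (-(γ * r * t))) ^ (k + k) ≤ (1 / 2) ^ 2 :=
    (pow_le_pow_left₀ hx0 hx _).trans
      (pow_le_pow_of_le_one (by norm_num) (by norm_num) (by omega))
  obtain ⟨f, hf⟩ := exists_of_dens (fun f => (∃ e, Q1 e f) ∨ (∃ e, Q2 e f)) (by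
    rw [e1] at hE1
    rw [e2] at hE2
    norm_num at b1 b2
    linarith)
  push Not at hf
  refine ⟨f, fun e he => ?_, fun e he => ?_⟩
  · by_contra! hc
    exact hf.1 e ⟨he, hc⟩
  · by_contra! hc
    exact hf.2 e ⟨he, hc⟩

lemma tensor (p d n t : ℕ) (h : n ^ t ≤ d) :
    ∃ G : (Fin t → Fin n → ZMod p) → (Fin d → ZMod p),
      ∀ w w', G w ⬝ᵥ G w' = ∏ s, w s ⬝ᵥ w' s := by
  classical
  obtain ⟨φ⟩ : Nonempty ((Fin t → Fin n) ↪ Fin d) :=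
    Function.Embedding.nonempty_of_card_le (by simpa using h)
  refine ⟨fun w => Function.extend φ (fun i => ∏ s, w s (i s)) 0, fun w w' => ?_⟩
  simp only [dotProduct]
  rw [← Fintype.sum_of_injective φ φ.injective
    (fun i : Fin t → Fin n => (∏ s, w s (i s)) * ∏ s, w' s (i s))]
  · rw [Finset.prod_univ_sum, Fintype.piFinset_univ]
    simp only [Finset.prod_mul_distrib]
  · intro x hx
    rw [Function.extend_apply' _ _ _ (fun ⟨a, ha⟩ => hx ⟨a, ha⟩)]
    simp
  · intro i
    simp only [φ.injective.extend_apply]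

lemma assemble (p : ℕ) [Fact p.Prime] (ℓ k d N : ℕ) (hℓ : 2 ≤ ℓ)
    (g : Fin N → Fin d → ZMod p) (hg : ∀ i, g i ⬝ᵥ g i ≠ 0)
    (h1 : ∀ e : Fin k → Fin N, Function.Injective e → HasK ℓ (g ∘ e))
    (h2 : ∀ e : Fin k ⊕ Fin k → Fin N, Function.Injective e →
      ∃ i j, g (e (Sum.inl i)) ⬝ᵥ g (e (Sum.inr j)) = 0) :
    ∃ A : Finset (Fin d → ZMod p), N ≤ k * A.card ∧
      (∀ v ∈ A, v ⬝ᵥ v ≠ 0) ∧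
      (∀ S ⊆ A, S.card = k → ∃ T ⊆ S, T.card = ℓ ∧
          ∀ u ∈ T, ∀ v ∈ T, u ≠ v → u ⬝ᵥ v = 0) ∧
      (∀ A₁ ⊆ A, ∀ A₂ ⊆ A, A₁.card = 2 * k - 1 → A₂.card = 2 * k - 1 →
            ∃ v₁ ∈ A₁, ∃ v₂ ∈ A₂, v₁ ⬝ᵥ v₂ = 0) := by
  classical
  set A := Finset.univ.image g with hA
  have hsec : ∀ {κ : Type} (h : κ → Fin d → ZMod p), (∀ x, h x ∈ A) → Function.Injective h →
      ∃ e : κ → Fin N, Function.Injective e ∧ ∀ x, g (e x) = h x := by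
    intro κ h hh hi
    have : ∀ x, ∃ i, g i = h x := by
      intro x
      have := hh x
      simpa [hA] using this
    choose e he using this
    refine ⟨e, fun x y hxy => hi ?_, he⟩
    rw [← he x, ← he y, hxy]
  have hc1 : ∀ S ⊆ A, S.card = k → ∃ T ⊆ S, T.card = ℓ ∧
          ∀ u ∈ T, ∀ v ∈ T, u ≠ v → u ⬝ᵥ v = 0 := by
    intro S hS hk
    let h : Fin k → Fin d → ZMod p := fun i => ((S.equivFinOfCardEq hk).symm i : Fin d → ZMod p)
    have hinj : Function.Injective h :=
      Subtype.val_injective.comp (S.equivFinOfCardEq hk).symm.injective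
    have hmem : ∀ x, h x ∈ S := fun x => ((S.equivFinOfCardEq hk).symm x).2
    obtain ⟨e, he, hge⟩ := hsec h (fun x => hS (hmem x)) hinj
    obtain ⟨T, hT, hTo⟩ := h1 e he
    refine ⟨T.image h, ?_, ?_, ?_⟩
    · intro v hv
      obtain ⟨i, _, rfl⟩ := Finset.mem_image.1 hv
      exact hmem i
    · rw [Finset.card_image_of_injective _ hinj, hT]
    · intro u hu v hv huv
      obtain ⟨i, hi, rfl⟩ := Finset.mem_image.1 hu
      obtain ⟨j, hj, rfl⟩ := Finset.mem_image.1 hv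
      have := hTo i hi j hj (fun h => huv (by rw [h]))
      simpa only [Function.comp, hge] using this
  refine ⟨A, ?_, ?_, hc1, ?_⟩
  · have := Finset.card_le_mul_card_image (f := g) (Finset.univ : Finset (Fin N)) k (by
      intro v _
      by_contra! hlt
      obtain ⟨S, hS, hSk⟩ := Finset.exists_subset_card_eq hlt.le
      let e : Fin k → Fin N := fun i => ((S.equivFinOfCardEq hSk).symm i : Fin N)
      have hinj : Function.Injective e :=
        Subtype.val_injective.comp (S.equivFinOfCardEq hSk).symm.injective
      have hmem : ∀ x, g (e x) = v := fun x => by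
        have := hS ((S.equivFinOfCardEq hSk).symm x).2
        simpa using this
      obtain ⟨T, hT, hTo⟩ := h1 e hinj
      obtain ⟨i, hi, j, hj, hij⟩ := Finset.one_lt_card.1 (by omega : 1 < T.card)
      have h0 := hTo i hi j hj hij
      simp only [Function.comp] at h0
      rw [hmem j, ← hmem i] at h0
      exact hg _ h0)
    simpa using this
  · intro v hv
    obtain ⟨i, _, rfl⟩ := Finset.mem_image.1 hv
    exact hg i
  · intro A₁ hA₁ A₂ hA₂ hk₁ hk₂
    by_cases hI : k ≤ (A₁ ∩ A₂).card
    · obtain ⟨S, hS, hSk⟩ := Finset.exists_subset_card_eq hI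
      obtain ⟨T, hT, hTc, hTo⟩ := hc1 S
        (hS.trans (Finset.inter_subset_left.trans hA₁)) hSk
      obtain ⟨u, hu, v, hv, huv⟩ := Finset.one_lt_card.1 (by omega : 1 < T.card)
      exact ⟨u, (Finset.mem_inter.1 (hS (hT hu))).1, v, (Finset.mem_inter.1 (hS (hT hv))).2,
        hTo u hu v hv huv⟩
    · have hd : k ≤ (A₁ \ A₂).card := by
        have := Finset.card_sdiff_add_card_inter A₁ A₂
        omega
      obtain ⟨S, hS, hSk⟩ := Finset.exists_subset_card_eq hd
      obtain ⟨S', hS', hSk'⟩ := Finset.exists_subset_card_eq (by omega : k ≤ A₂.card)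
      let h : Fin k ⊕ Fin k → Fin d → ZMod p := Sum.elim
        (fun i => ((S.equivFinOfCardEq hSk).symm i : Fin d → ZMod p))
        (fun i => ((S'.equivFinOfCardEq hSk').symm i : Fin d → ZMod p))
      have m1 : ∀ i, h (Sum.inl i) ∈ A₁ \ A₂ := fun i =>
        hS ((S.equivFinOfCardEq hSk).symm i).2
      have m2 : ∀ i, h (Sum.inr i) ∈ A₂ := fun i =>
        hS' ((S'.equivFinOfCardEq hSk').symm i).2
      have hinj : Function.Injective h := by
        apply Function.Injective.sumElim
        · exact Subtype.val_injective.comp (S.equivFinOfCardEq hSk).symm.injective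
        · exact Subtype.val_injective.comp (S'.equivFinOfCardEq hSk').symm.injective
        · intro i j hij
          have q1 := m1 i
          have q2 := m2 j
          have : h (Sum.inl i) = h (Sum.inr j) := hij
          rw [this] at q1
          exact (Finset.mem_sdiff.1 q1).2 q2
      obtain ⟨e, he, hge⟩ := hsec h (by
        rintro (i | i)
        · exact hA₁ (Finset.mem_sdiff.1 (m1 i)).1
        · exact hA₂ (m2 i)) hinj
      obtain ⟨i, j, hij⟩ := h2 e he
      rw [hge, hge] at hij
      exact ⟨_, (Finset.mem_sdiff.1 (m1 i)).1, _, m2 j, hij⟩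

lemma trivial_case (p : ℕ) [Fact p.Prime] (ℓ k d : ℕ) (hk : 2 ≤ k) (hlk : ℓ ≤ k) :
    ∃ A : Finset (Fin d → ZMod p), d = A.card ∧
      (∀ v ∈ A, v ⬝ᵥ v ≠ 0) ∧
      (∀ S ⊆ A, S.card = k → ∃ T ⊆ S, T.card = ℓ ∧
          ∀ u ∈ T, ∀ v ∈ T, u ≠ v → u ⬝ᵥ v = 0) ∧
      (∀ A₁ ⊆ A, ∀ A₂ ⊆ A, A₁.card = 2 * k - 1 → A₂.card = 2 * k - 1 →
            ∃ v₁ ∈ A₁, ∃ v₂ ∈ A₂, v₁ ⬝ᵥ v₂ = 0) := by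
  classical
  let b : Fin d → Fin d → ZMod p := fun i => Pi.single i 1
  have hb : Function.Injective b := by
    intro i j hij
    by_contra hne
    have := congrFun hij i
    simp [b, Pi.single_apply, hne] at this
  have horth : ∀ u ∈ Finset.univ.image b, ∀ v ∈ Finset.univ.image b, u ≠ v → u ⬝ᵥ v = 0 := by
    intro u hu v hv huv
    obtain ⟨i, _, rfl⟩ := Finset.mem_image.1 hu
    obtain ⟨j, _, rfl⟩ := Finset.mem_image.1 hv
    have : i ≠ j := fun h => huv (by rw [h])
    simp [b, this, Pi.single_apply]
  refine ⟨Finset.univ.image b, ?_, ?_, ?_, ?_⟩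
  · rw [Finset.card_image_of_injective _ hb]; simp
  · intro v hv
    obtain ⟨i, _, rfl⟩ := Finset.mem_image.1 hv
    simp [b]
  · intro S hS hSk
    obtain ⟨T, hT, hTc⟩ := Finset.exists_subset_card_eq (by omega : ℓ ≤ S.card)
    exact ⟨T, hT, hTc, fun u hu v hv => horth u (hS (hT hu)) v (hS (hT hv))⟩
  · intro A₁ hA₁ A₂ hA₂ h₁ h₂
    obtain ⟨v, hv⟩ := Finset.card_pos.1 (by omega : 0 < A₂.card)
    obtain ⟨u, hu, huv⟩ := Finset.exists_mem_ne (by omega : 1 < A₁.card) v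
    exact ⟨u, hu, v, hv, horth u (hA₁ hu) v (hA₂ hv) huv⟩

end NearOrth

/-- For every prime `p` and integer `ℓ ≥ 2` there is `δ = δ(p,ℓ) > 0` such that
for all `k ≥ 2` and `d ≥ k ≥ ℓ` there is a set `A` of at least
`d^(δ·k/log₂ k)` non-self-orthogonal vectors of `F_p^d` such that (1) every
subset of `A` of size `k` includes `ℓ` pairwise orthogonal vectors, and
(2) any two subsets of `A` of size `2k-1` each contain an orthogonal cross
pair. -/
theorem stmt_13 (p : ℕ) (hp : p.Prime) (ℓ : ℕ) (hℓ : 2 ≤ ℓ) :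
    ∃ δ : ℝ, 0 < δ ∧
      ∀ k d : ℕ, 2 ≤ k → ℓ ≤ k → k ≤ d →
        ∃ A : Finset (Fin d → ZMod p),
          (d : ℝ) ^ (δ * k / Real.logb 2 k) ≤ (A.card : ℝ) ∧
          (∀ v ∈ A, ∑ i, v i * v i ≠ 0) ∧
          (∀ S ⊆ A, S.card = k →
            ∃ T ⊆ S, T.card = ℓ ∧
              ∀ u ∈ T, ∀ v ∈ T, u ≠ v → ∑ i, u i * v i = 0) ∧
          (∀ A₁ ⊆ A, ∀ A₂ ⊆ A, A₁.card = 2 * k - 1 → A₂.card = 2 * k - 1 →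
            ∃ v₁ ∈ A₁, ∃ v₂ ∈ A₂, ∑ i, v₁ i * v₂ i = 0) := by
  haveI : Fact p.Prime := ⟨hp⟩
  obtain ⟨C0, r0, γ, hγ, H⟩ := NearOrth.base p (ℓ - 1)
  rw [Nat.sub_add_cancel (by omega : 1 ≤ ℓ)] at H
  obtain ⟨R1, hR1⟩ := exists_nat_ge (16 / γ)
  set C := C0 + 2 with hC
  set K0 := C * (r0 + R1 + 1) with hK0
  have hK0pos : (0 : ℝ) < K0 := by
    have : 0 < K0 := by positivity
    exact_mod_cast this
  have hCpos : (0 : ℝ) < C := by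
    have : 0 < C := by positivity
    exact_mod_cast this
  refine ⟨min (1 / K0) (γ / (16 * C)), by positivity, fun k d hk hlk hkd => ?_⟩
  set δ : ℝ := min (1 / K0) (γ / (16 * C)) with hδ
  have hδ0 : 0 < δ := by positivity
  have hδ1 : δ ≤ 1 / K0 := min_le_left _ _
  have hδ2 : δ ≤ γ / (16 * C) := min_le_right _ _
  have hk2 : (2 : ℝ) ≤ k := by exact_mod_cast hk
  have hkd' : (k : ℝ) ≤ d := by exact_mod_cast hkd
  have hd1 : (1 : ℝ) ≤ d := by linarith
  have hL1 : 1 ≤ Real.logb 2 k := by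
    rw [Real.le_logb_iff_rpow_le (by norm_num) (by linarith)]
    simpa using hk2
  by_cases hx : δ * k / Real.logb 2 k ≤ 1
  · obtain ⟨A, hA, hA1, hA2, hA3⟩ := NearOrth.trivial_case p ℓ k d hk hlk
    refine ⟨A, ?_, hA1, hA2, hA3⟩
    rw [← hA]
    calc (d : ℝ) ^ (δ * k / Real.logb 2 k) ≤ (d : ℝ) ^ (1 : ℝ) :=
          Real.rpow_le_rpow_of_exponent_le hd1 hx
      _ = d := Real.rpow_one _
  push Not at hx
  have hkK : K0 ≤ k := by
    by_contra! hlt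
    have h1 : (k : ℝ) ≤ K0 := by exact_mod_cast hlt.le
    have h2 : δ * k ≤ 1 := by
      calc δ * k ≤ 1 / K0 * K0 := by gcongr
        _ = 1 := by field_simp
    rw [lt_div_iff₀ (by linarith)] at hx
    linarith
  set r := k / C with hr
  have hrR : r0 + R1 + 1 ≤ r := by
    rw [hr, Nat.le_div_iff_mul_le (by positivity), mul_comm]
    exact hkK
  have hCr : C * r ≤ k := Nat.mul_div_le k C
  have hkCr : k ≤ 2 * C * r := by
    have h1 : k < C * (r + 1) := Nat.lt_mul_div_succ k (by positivity)
    nlinarith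
  have hC0r : C0 * r ≤ k := by nlinarith
  have h2rk : 2 * r ≤ k := by nlinarith [Nat.zero_le (C0 * r)]
  set t := Nat.log (2 * r) d with ht
  have ht1 : 1 ≤ t := Nat.log_pos (by omega) (by omega)
  have htd : (2 * r) ^ t ≤ d := Nat.pow_log_le_self _ (by omega)
  have hdt : d ≤ (2 * r) ^ (2 * t) := by
    have h1 : d < (2 * r) ^ (t + 1) := Nat.lt_pow_succ_log_self (by omega) d
    exact h1.le.trans (Nat.pow_le_pow_right (by omega) (by omega))
  obtain ⟨H1, H2⟩ := H r (by omega) (by omega) k hC0r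
  set X := Real.exp (γ * r * t / 2) with hX
  have hXX : Real.exp (γ * r * t) = X * X := by
    rw [hX, ← Real.exp_add]; congr 1; ring
  have ht1' : (1 : ℝ) ≤ t := by exact_mod_cast ht1
  have hX4 : 4 ≤ X := by
    have h1 : 16 / γ ≤ r := hR1.trans (by exact_mod_cast (by omega : R1 ≤ r))
    rw [div_le_iff₀ hγ] at h1
    have h2 := Real.add_one_le_exp (γ * r * t / 2)
    nlinarith
  set N := ⌊Real.exp (γ * r * t) / 2⌋₊ with hN
  have hNle : (N : ℝ) ≤ Real.exp (γ * r * t) / 2 := Nat.floor_le (by positivity)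
  have hNge : X ≤ N := by
    have h1 : Real.exp (γ * r * t) / 2 < N + 1 := Nat.lt_floor_add_one _
    rw [hXX] at h1
    nlinarith
  obtain ⟨f, hf1, hf2⟩ := NearOrth.exists_f p ℓ r k t N γ (by omega) hk H1 H2 hNle
  obtain ⟨G, hG⟩ := NearOrth.tensor p d (2 * r) t htd
  let g : Fin N → Fin d → ZMod p := fun i => G (fun s => (f i s).1)
  have hgg : ∀ i j, g i ⬝ᵥ g j = ∏ s, (f i s).1 ⬝ᵥ (f j s).1 := fun i j => hG _ _
  obtain ⟨A, hA0, hA1, hA2, hA3⟩ := NearOrth.assemble p ℓ k d N hℓ g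
    (by
      intro i
      rw [hgg]
      exact Finset.prod_ne_zero_iff.2 fun s _ => (f i s).2)
    (by
      intro e he
      obtain ⟨s, T, hT, hTo⟩ := hf1 e he
      refine ⟨T, hT, fun i hi j hj hij => ?_⟩
      exact (hgg _ _).trans (Finset.prod_eq_zero (Finset.mem_univ s) (hTo i hi j hj hij)))
    (by
      intro e he
      obtain ⟨s, i, j, hij⟩ := hf2 e he
      exact ⟨i, j, (hgg _ _).trans (Finset.prod_eq_zero (Finset.mem_univ s) hij)⟩)
  refine ⟨A, ?_, hA1, hA2, hA3⟩
  set D := (d : ℝ) ^ (δ * k / Real.logb 2 k) with hD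
  have hdD : (d : ℝ) ≤ D := by
    calc (d : ℝ) = (d : ℝ) ^ (1 : ℝ) := (Real.rpow_one _).symm
      _ ≤ _ := Real.rpow_le_rpow_of_exponent_le hd1 hx.le
  have hlogk : 0 < Real.log k := Real.log_pos (by linarith)
  have hlogd : Real.log d ≤ 2 * t * Real.log k := by
    have h1 : (d : ℝ) ≤ (k : ℝ) ^ (2 * t) := by
      have : d ≤ k ^ (2 * t) := hdt.trans (Nat.pow_le_pow_left h2rk _)
      exact_mod_cast this
    have h2 := Real.log_le_log (by linarith) h1
    rw [Real.log_pow] at h2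
    push_cast at h2
    exact h2
  have hDX : D * D ≤ X := by
    rw [hD, hX, Real.rpow_def_of_pos (by linarith), ← Real.exp_add, Real.exp_le_exp]
    have hl2 : Real.log 2 ≤ 1 := by
      have := Real.log_two_lt_d9; linarith
    have hl0 : 0 < Real.log 2 := Real.log_pos (by norm_num)
    have h1 : δ * k / Real.logb 2 k = δ * k * Real.log 2 / Real.log k := by
      rw [Real.logb]; field_simp
    have h2 : Real.log d * (δ * k / Real.logb 2 k) ≤ 2 * t * δ * k := by
      rw [h1]
      calc Real.log d * (δ * k * Real.log 2 / Real.log k)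
          ≤ (2 * t * Real.log k) * (δ * k * 1 / Real.log k) := by gcongr
        _ = 2 * t * δ * k := by field_simp
    have h3 : (k : ℝ) ≤ 2 * C * r := by exact_mod_cast hkCr
    have h4 : 2 * t * δ * k ≤ 2 * t * (γ / (16 * C)) * (2 * C * r) := by gcongr
    have h5 : 2 * t * (γ / (16 * C)) * (2 * C * r) = γ * r * t / 4 := by
      field_simp; ring
    linarith
  have hA0' : (N : ℝ) ≤ k * A.card := by exact_mod_cast hA0
  have hk0 : (0 : ℝ) < k := by linarith
  have hfin : (k : ℝ) * D ≤ k * A.card := by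
    have : (k : ℝ) * D ≤ D * D :=
      mul_le_mul_of_nonneg_right (by linarith) (by linarith)
    linarith
  exact le_of_mul_le_mul_left hfin hk0
end
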